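/- Let K₁ = ⟨V, M⟩, K₂ = ⟨V, C, E, T⟩, K = ⟨K₁, K₂⟩, G₁ = ⟨A, M, S, Σ⟩, G₂ = ⟨Q, S, E, T, Σ⟩, G = ⟨G₁, G₂⟩, and for c ∈ F_q let Ω_c = {(a,b,c) : a,b ∈ F_q}. Then: (i) an element g ∈ G maps every block Ω_c onto itself if and only if g ∈ K⟨β_{1,−1}⟩; (ii) K is isomorphic as a group to the direct product of q copies of the alternating group on q² letters (i.e. K ≅ ∏_{c ∈ F_q} Alt(Ω_c)), and the centralizer of K in G is trivial. -/

import Mathlib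

open Equiv

/-! Context: `q = 3^r`, `K = F_q` a finite field with `3^r` elements, `Ω = K × K × K`,
`ε = 3^(r-1)` (so `q = 3ε`).  Permutations of `Ω` are composed left to right in the paper;
in Lean, `(g * h) x = g (h x)`, so the paper's product `g·h` corresponds to `h * g` here,
and the paper's conjugate `g⁻¹ x g` corresponds to `g * x * g⁻¹`. -/

/-- The permutation `α_{(u,v,w)} : (a,b,c) ↦ (a+u, b+v, c+w)` of `Ω = K × K × K`. -/
def alphaPerm {K : Type*} [Field K] (u v w : K) : Equiv.Perm (K × K × K) where
  toFun x := (x.1 + u, x.2.1 + v, x.2.2 + w)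
  invFun x := (x.1 - u, x.2.1 - v, x.2.2 - w)
  left_inv x := by simp
  right_inv x := by simp

/-- The permutation `β_{λ,μ} : (a,b,c) ↦ (λa, μb, (λμ)^{2ε} c)` of `Ω = K × K × K`. -/
def betaPerm {K : Type*} [Field K] (ε : ℕ) (l m : Kˣ) : Equiv.Perm (K × K × K) where
  toFun x := ((l : K) * x.1, (m : K) * x.2.1, (((l * m) ^ (2 * ε) : Kˣ) : K) * x.2.2)
  invFun x := ((l⁻¹ : Kˣ) * x.1, (m⁻¹ : Kˣ) * x.2.1, ((((l * m) ^ (2 * ε))⁻¹ : Kˣ) : K) * x.2.2)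
  left_inv x := by simp
  right_inv x := by simp

/-- The permutation `γ_e : (a,b,c) ↦ (a+eb, b, c)` of `Ω = K × K × K`. -/
def gammaPerm {K : Type*} [Field K] (e : K) : Equiv.Perm (K × K × K) where
  toFun x := (x.1 + e * x.2.1, x.2.1, x.2.2)
  invFun x := (x.1 - e * x.2.1, x.2.1, x.2.2)
  left_inv x := by simp
  right_inv x := by simp

/-- The permutation `δ : (a,b,c) ↦ (b, -a, c)` of `Ω = K × K × K`. -/
def deltaPerm (K : Type*) [Field K] : Equiv.Perm (K × K × K) where
  toFun x := (x.2.1, -x.1, x.2.2)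
  invFun x := (-x.2.1, x.1, x.2.2)
  left_inv x := by simp
  right_inv x := by simp

/-- The permutation `τ_d : (a,b,c) ↦ (a + d·b² + d^ε·c, b, c)` of `Ω = K × K × K`. -/
def tauPerm {K : Type*} [Field K] (ε : ℕ) (d : K) : Equiv.Perm (K × K × K) where
  toFun x := (x.1 + d * x.2.1 ^ 2 + d ^ ε * x.2.2, x.2.1, x.2.2)
  invFun x := (x.1 - d * x.2.1 ^ 2 - d ^ ε * x.2.2, x.2.1, x.2.2)
  left_inv x := by obtain ⟨a, b, c⟩ := x; simp; ring
  right_inv x := by obtain ⟨a, b, c⟩ := x; simp; ring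

/-- The cube map `x ↦ x³` as a permutation of a finite field of characteristic 3. -/
noncomputable def frobPerm (K : Type*) [Field K] [Fintype K] [CharP K 3] : Equiv.Perm K :=
  Equiv.ofBijective (fun x => x ^ 3)
    (Finite.injective_iff_bijective.mp (by
      intro x y h
      exact frobenius_inj K 3 (by simpa [frobenius_def] using h)))

/-- The permutation `σ : (a,b,c) ↦ (a³, b³, c³)` of `Ω = K × K × K`. -/
noncomputable def sigmaPerm (K : Type*) [Field K] [Fintype K] [CharP K 3] :
    Equiv.Perm (K × K × K) :=
  (frobPerm K).prodCongr ((frobPerm K).prodCongr (frobPerm K))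

variable (K : Type*) [Field K]

/-- `A = ⟨α_{(u,v,w)} : u,v,w ∈ F_q⟩`. -/
def Agrp : Subgroup (Equiv.Perm (K × K × K)) :=
  Subgroup.closure {g | ∃ u v w : K, g = alphaPerm u v w}

/-- `V = ⟨α_{(u,v,0)} : u,v ∈ F_q⟩`. -/
def Vgrp : Subgroup (Equiv.Perm (K × K × K)) :=
  Subgroup.closure {g | ∃ u v : K, g = alphaPerm u v 0}

/-- `F = ⟨α_{(0,0,w)} : w ∈ F_q⟩`. -/
def Fgrp : Subgroup (Equiv.Perm (K × K × K)) :=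
  Subgroup.closure {g | ∃ w : K, g = alphaPerm 0 0 w}

/-- `Z₀ = ⟨α_{(u,0,w)} : u,w ∈ F_q⟩`. -/
def Z0grp : Subgroup (Equiv.Perm (K × K × K)) :=
  Subgroup.closure {g | ∃ u w : K, g = alphaPerm u 0 w}

/-- `Z = ⟨α_{(u,0,0)} : u ∈ F_q⟩`. -/
def Zgrp : Subgroup (Equiv.Perm (K × K × K)) :=
  Subgroup.closure {g | ∃ u : K, g = alphaPerm u 0 0}

/-- `C = ⟨γ_e : e ∈ F_q⟩`. -/
def Cgrp : Subgroup (Equiv.Perm (K × K × K)) :=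
  Subgroup.closure {g | ∃ e : K, g = gammaPerm e}

/-- `R = ⟨β_{μ,μ} : μ ∈ F_q^×⟩`. -/
def Rgrp (ε : ℕ) : Subgroup (Equiv.Perm (K × K × K)) :=
  Subgroup.closure {g | ∃ μ : Kˣ, g = betaPerm ε μ μ}

/-- `S = ⟨β_{μ²,μ} : μ ∈ F_q^×⟩`. -/
def Sgrp (ε : ℕ) : Subgroup (Equiv.Perm (K × K × K)) :=
  Subgroup.closure {g | ∃ μ : Kˣ, g = betaPerm ε (μ ^ 2) μ}

/-- `T = ⟨β_{μ,μ⁻¹} : μ ∈ F_q^×⟩`. -/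
def Tgrp (ε : ℕ) : Subgroup (Equiv.Perm (K × K × K)) :=
  Subgroup.closure {g | ∃ μ : Kˣ, g = betaPerm ε μ μ⁻¹}

/-- `D = ⟨δ⟩`. -/
def Dgrp : Subgroup (Equiv.Perm (K × K × K)) :=
  Subgroup.closure {deltaPerm K}

/-- `E = ⟨τ_d : d ∈ F_q⟩`. -/
def Egrp (ε : ℕ) : Subgroup (Equiv.Perm (K × K × K)) :=
  Subgroup.closure {g | ∃ d : K, g = tauPerm ε d}

/-- `M = ⟨C, D, T⟩`. -/
def Mgrp (ε : ℕ) : Subgroup (Equiv.Perm (K × K × K)) :=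
  Cgrp K ⊔ Dgrp K ⊔ Tgrp K ε

/-- `Q = ⟨A, C⟩`. -/
def QgrpBig : Subgroup (Equiv.Perm (K × K × K)) :=
  Agrp K ⊔ Cgrp K

/-- `P = ⟨Q, E⟩`. -/
def Pgrp (ε : ℕ) : Subgroup (Equiv.Perm (K × K × K)) :=
  QgrpBig K ⊔ Egrp K ε

/-- `Σ = ⟨σ⟩`. -/
noncomputable def Siggrp (K : Type*) [Field K] [Fintype K] [CharP K 3] :
    Subgroup (Equiv.Perm (K × K × K)) :=
  Subgroup.closure {sigmaPerm K}

/-- `K₁ = ⟨V, M⟩`. -/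
def K1grp (K : Type*) [Field K] (ε : ℕ) : Subgroup (Equiv.Perm (K × K × K)) :=
  Vgrp K ⊔ Mgrp K ε

/-- `K₂ = ⟨V, C, E, T⟩`. -/
def K2grp (K : Type*) [Field K] (ε : ℕ) : Subgroup (Equiv.Perm (K × K × K)) :=
  Vgrp K ⊔ Cgrp K ⊔ Egrp K ε ⊔ Tgrp K ε

/-- `G₁ = ⟨A, M, S, Σ⟩`. -/
noncomputable def G1grp (K : Type*) [Field K] [Fintype K] [CharP K 3] (ε : ℕ) :
    Subgroup (Equiv.Perm (K × K × K)) :=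
  Agrp K ⊔ Mgrp K ε ⊔ Sgrp K ε ⊔ Siggrp K

/-- `G₂ = ⟨Q, S, E, T, Σ⟩`. -/
noncomputable def G2grp (K : Type*) [Field K] [Fintype K] [CharP K 3] (ε : ℕ) :
    Subgroup (Equiv.Perm (K × K × K)) :=
  QgrpBig K ⊔ Sgrp K ε ⊔ Egrp K ε ⊔ Tgrp K ε ⊔ Siggrp K

/-- `G₁₂ = ⟨Q, S, T, Σ⟩`. -/
noncomputable def G12grp (K : Type*) [Field K] [Fintype K] [CharP K 3] (ε : ℕ) :
    Subgroup (Equiv.Perm (K × K × K)) :=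
  QgrpBig K ⊔ Sgrp K ε ⊔ Tgrp K ε ⊔ Siggrp K

open Equiv

namespace S17

/-! abstract Steiner-type counting -/
section steiner
variable {α : Type*} [DecidableEq α]

theorem card_biUnion_const {ι : Type*} [DecidableEq ι] (I : Finset ι) (f : ι → Finset α) (n : ℕ)
    (hd : ∀ i ∈ I, ∀ j ∈ I, i ≠ j → Disjoint (f i) (f j)) (hc : ∀ i ∈ I, (f i).card = n) :
    (I.biUnion f).card = I.card * n := by
  rw [Finset.card_biUnion hd, Finset.sum_congr rfl hc, Finset.sum_const, smul_eq_mul]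

/-- partition counting -/
theorem card_of_classes (B : Finset α) (f : α → Finset α) (n : ℕ)
    (h1 : ∀ z ∈ B, z ∈ f z) (h2 : ∀ z ∈ B, f z ⊆ B) (h3 : ∀ z ∈ B, (f z).card = n)
    (h4 : ∀ z ∈ B, ∀ w ∈ f z, f w = f z) :
    B.card = (B.image f).card * n := by
  have : B = (B.image f).biUnion id := by
    ext x
    simp only [Finset.mem_biUnion, Finset.mem_image, id]
    constructor
    · intro hx; exact ⟨f x, ⟨x, hx, rfl⟩, h1 x hx⟩
    · rintro ⟨_, ⟨z, hz, rfl⟩, hx⟩; exact h2 z hz hx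
  conv_lhs => rw [this]
  apply card_biUnion_const
  · intro i hi j hj hij
    simp only [Finset.mem_image] at hi hj
    obtain ⟨z, hz, rfl⟩ := hi
    obtain ⟨w, hw, rfl⟩ := hj
    rw [Finset.disjoint_left]
    intro x hx hx'
    exact hij ((h4 z hz x hx).symm.trans (h4 w hw x hx'))
  · intro i hi
    simp only [Finset.mem_image] at hi
    obtain ⟨z, hz, rfl⟩ := hi
    exact h3 z hz

variable (cl : Finset α → Finset α) (t m : ℕ)
  (hs : ∀ U : Finset α, U.card = t → U ⊆ cl U)
  (hex : ∀ U V : Finset α, U.card = t → V.card = t → V ⊆ cl U → cl V = cl U)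
  (hm : ∀ U : Finset α, U.card = t → (cl U).card = m)

include hs hex hm

theorem st_dvd (A p : Finset α) (hA : ∀ U, U.card = t → U ⊆ A → cl U ⊆ A)
    (hp : p ⊆ A) (hpt : p.card + 1 = t) : (m - t + 1) ∣ A.card - p.card := by
  have hc : ∀ z, z ∉ p → (insert z p).card = t := fun z hz => by
    rw [Finset.card_insert_of_notMem hz, hpt]
  have key := card_of_classes (A \ p) (fun z => cl (insert z p) \ p) (m - t + 1) ?_ ?_ ?_ ?_
  · rw [← Finset.card_sdiff_of_subset hp, key]; exact Dvd.intro_left _ rfl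
  · intro z hz
    rw [Finset.mem_sdiff] at hz ⊢
    exact ⟨hs _ (hc z hz.2) (Finset.mem_insert_self _ _), hz.2⟩
  · intro z hz
    rw [Finset.mem_sdiff] at hz
    exact Finset.sdiff_subset_sdiff (hA _ (hc z hz.2) (Finset.insert_subset hz.1 hp)) le_rfl
  · intro z hz
    rw [Finset.mem_sdiff] at hz
    have h1 := hs _ (hc z hz.2)
    have h2 : p ⊆ cl (insert z p) := (Finset.subset_insert _ _).trans h1
    have h3 := Finset.card_le_card h1
    rw [Finset.card_sdiff_of_subset h2, hm _ (hc z hz.2)]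
    rw [hm _ (hc z hz.2), hc z hz.2] at h3
    omega
  · intro z hz w hw
    rw [Finset.mem_sdiff] at hz hw
    have h1 := hs _ (hc z hz.2)
    have h2 : p ⊆ cl (insert z p) := (Finset.subset_insert _ _).trans h1
    rw [hex _ _ (hc z hz.2) (hc w hw.2) (Finset.insert_subset hw.1 h2)]

theorem st_mul (A U : Finset α) (z : α) (hA : ∀ U, U.card = t → U ⊆ A → cl U ⊆ A)
    (hU : U ⊆ A) (hUt : U.card = t) (hz : z ∈ A) (hzU : z ∉ cl U) :
    (t + 1) * (m - t + 1) ≤ A.card := by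
  have hzU' : z ∉ U := fun h => hzU (hs U hUt h)
  set Y := insert z U with hY
  have hYc : Y.card = t + 1 := by rw [hY, Finset.card_insert_of_notMem hzU', hUt]
  have hYA : Y ⊆ A := Finset.insert_subset hz hU
  have hc : ∀ y ∈ Y, (Y.erase y).card = t := fun y hy => by
    rw [Finset.card_erase_of_mem hy, hYc]; rfl
  have hn : ∀ y ∈ Y, y ∉ cl (Y.erase y) := by
    intro y hy hyc
    have : Y ⊆ cl (Y.erase y) := by
      intro x hx
      by_cases hxy : x = y
      · rwa [hxy]
      · exact hs _ (hc y hy) (Finset.mem_erase.2 ⟨hxy, hx⟩)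
    have h2 := hex _ U (hc y hy) hUt ((Finset.subset_insert _ _).trans this)
    rw [h2] at hzU
    exact hzU (this (Finset.mem_insert_self _ _))
  have hint : ∀ y ∈ Y, (cl (Y.erase y) \ Y).card = m - t := by
    intro y hy
    have : cl (Y.erase y) \ Y = cl (Y.erase y) \ (Y.erase y) := by
      ext x
      simp only [Finset.mem_sdiff, Finset.mem_erase, not_and]
      constructor
      · rintro ⟨a, b⟩; exact ⟨a, fun _ => b⟩
      · rintro ⟨a, b⟩
        refine ⟨a, b ?_⟩
        rintro rfl
        exact hn _ hy a
    rw [this, Finset.card_sdiff_of_subset (hs _ (hc y hy)), hm _ (hc y hy), hc y hy]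
  have hdis : ∀ y ∈ Y, ∀ y' ∈ Y, y ≠ y' → Disjoint (cl (Y.erase y) \ Y) (cl (Y.erase y') \ Y) := by
    intro y hy y' hy' hne
    rw [Finset.disjoint_left]
    intro w hw hw'
    rw [Finset.mem_sdiff] at hw hw'
    set W := insert w ((Y.erase y).erase y') with hW
    have hWc : W.card = t := by
      have hwn : w ∉ (Y.erase y).erase y' := fun h =>
        hw.2 (Finset.mem_of_mem_erase (Finset.mem_of_mem_erase h))
      rw [hW, Finset.card_insert_of_notMem hwn, Finset.card_erase_of_mem
        (Finset.mem_erase.2 ⟨hne.symm, hy'⟩), hc y hy]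
      have : 0 < t := by
        rw [← hc y hy]; exact Finset.card_pos.2 ⟨y', Finset.mem_erase.2 ⟨hne.symm, hy'⟩⟩
      omega
    have e1 := hex _ W (hc y hy) hWc (Finset.insert_subset hw.1
      ((Finset.erase_subset _ _).trans (hs _ (hc y hy))))
    have e2 := hex _ W (hc y' hy') hWc (Finset.insert_subset hw'.1 (by
      rw [Finset.erase_right_comm]
      exact (Finset.erase_subset _ _).trans (hs _ (hc y' hy'))))
    apply hn y hy
    rw [← e1, e2]
    exact hs _ (hc y' hy') (Finset.mem_erase.2 ⟨hne, hy⟩)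
  have hcard := card_biUnion_const Y _ _ hdis hint
  have hsub : Y.biUnion (fun y => cl (Y.erase y) \ Y) ∪ Y ⊆ A := by
    refine Finset.union_subset ?_ hYA
    intro x hx
    simp only [Finset.mem_biUnion] at hx
    obtain ⟨y, hy, hx⟩ := hx
    exact hA _ (hc y hy) ((Finset.erase_subset _ _).trans hYA) (Finset.mem_sdiff.1 hx).1
  have hdj : Disjoint (Y.biUnion (fun y => cl (Y.erase y) \ Y)) Y := by
    rw [Finset.disjoint_left]
    intro x hx hx'
    simp only [Finset.mem_biUnion] at hx
    obtain ⟨y, hy, hx⟩ := hx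
    exact (Finset.mem_sdiff.1 hx).2 hx'
  have := Finset.card_le_card hsub
  rw [Finset.card_union_of_disjoint hdj, hcard, hYc] at this
  linarith

/-- the (3c) count: `L`, `L'` disjoint, everything closed. -/
theorem st_two (L L' p : Finset α) (x : α) (hL : ∀ U, U.card = t → U ⊆ L → cl U ⊆ L)
    (hLL : ∀ U, U.card = t → U ⊆ L ∪ L' → cl U ⊆ L ∪ L')
    (hdj : Disjoint L L') (hp : p ⊆ L) (hpt : p.card + 2 = t) (hx : x ∈ L') :
    (m - t) * (L.card - p.card) ≤ L'.card - 1 := by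
  have hxL : x ∉ L := fun h => Finset.disjoint_left.1 hdj h hx
  have hxp : x ∉ p := fun h => hxL (hp h)
  have hc : ∀ z ∈ L \ p, (insert x (insert z p)).card = t := by
    intro z hz
    rw [Finset.mem_sdiff] at hz
    rw [Finset.card_insert_of_notMem, Finset.card_insert_of_notMem hz.2, ← hpt]
    rw [Finset.mem_insert, not_or]
    exact ⟨fun h => hxL (h ▸ hz.1), hxp⟩
  have hc2 : ∀ z ∈ L \ p, ∀ w, w ∈ L → w ∈ cl (insert x (insert z p)) → w ∈ insert z p := by
    intro z hz w hw hwc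
    by_contra hcon
    have hz' := Finset.mem_sdiff.1 hz
    have h1 : (insert w (insert z p)).card = t := by
      rw [Finset.card_insert_of_notMem hcon, Finset.card_insert_of_notMem hz'.2, ← hpt]
    have h2 := hex _ (insert w (insert z p)) (hc z hz) h1 (Finset.insert_subset hwc
      ((Finset.subset_insert _ _).trans (hs _ (hc z hz))))
    have h3 := hL _ h1 (Finset.insert_subset hw (Finset.insert_subset hz'.1 hp))
    rw [h2] at h3
    exact hxL (h3 (hs _ (hc z hz) (Finset.mem_insert_self _ _)))
  have hsub : (L \ p).biUnion (fun z => cl (insert x (insert z p)) \ insert x (insert z p))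
      ⊆ L'.erase x := by
    intro y hy
    simp only [Finset.mem_biUnion] at hy
    obtain ⟨z, hz, hy⟩ := hy
    have hz' := Finset.mem_sdiff.1 hz
    have hy' := Finset.mem_sdiff.1 hy
    have := hLL _ (hc z hz) (by
      refine Finset.insert_subset (Finset.mem_union_right _ hx) ?_
      exact (Finset.insert_subset hz'.1 hp).trans Finset.subset_union_left) hy'.1
    rcases Finset.mem_union.1 this with h | h
    · exact absurd (Finset.mem_insert_of_mem (hc2 z hz y h hy'.1)) hy'.2
    · refine Finset.mem_erase.2 ⟨?_, h⟩
      rintro rfl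
      exact hy'.2 (Finset.mem_insert_self _ _)
  have hcard := card_biUnion_const (L \ p)
    (fun z => cl (insert x (insert z p)) \ insert x (insert z p)) (m - t) ?_ ?_
  · have := Finset.card_le_card hsub
    rw [hcard, Finset.card_erase_of_mem hx, Finset.card_sdiff_of_subset hp] at this
    linarith
  · intro z hz z' hz' hne
    rw [Finset.disjoint_left]
    intro y hy hy'
    have h1 := Finset.mem_erase.1 (hsub (Finset.mem_biUnion.2 ⟨z, hz, hy⟩))
    have h2 : y ∉ L := fun h => Finset.disjoint_left.1 hdj h h1.2
    have h3 : (insert y (insert x p)).card = t := by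
      rw [Finset.card_insert_of_notMem, Finset.card_insert_of_notMem hxp, ← hpt]
      rw [Finset.mem_insert, not_or]
      exact ⟨h1.1, fun h => h2 (hp h)⟩
    have gen : ∀ z ∈ L \ p, y ∈ cl (insert x (insert z p)) \ insert x (insert z p) →
        cl (insert y (insert x p)) = cl (insert x (insert z p)) := by
      intro z hz hy
      refine hex _ _ (hc z hz) h3 ?_
      refine Finset.insert_subset (Finset.mem_sdiff.1 hy).1 ((Finset.insert_subset_insert _
        (Finset.subset_insert _ _)).trans (hs _ (hc z hz)))
    have h4 := (gen z hz hy).symm.trans (gen z' hz' hy')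
    have h5 : z' ∈ cl (insert x (insert z p)) := by
      rw [h4]; exact hs _ (hc z' hz') (by simp)
    have h6 := hc2 z hz z' (Finset.mem_sdiff.1 hz').1 h5
    rcases Finset.mem_insert.1 h6 with h | h
    · exact hne h.symm
    · exact (Finset.mem_sdiff.1 hz').2 h
  · intro z hz
    rw [Finset.card_sdiff_of_subset (hs _ (hc z hz)), hm _ (hc z hz), hc z hz]

end steiner
end S17

open Equiv

namespace S17

section geom
variable {F : Type*} [Field F] [Fintype F] [DecidableEq F]

/-- shear -/
def X (f : F → F) : Perm (F × F) where
  toFun x := (x.1 + f x.2, x.2)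
  invFun x := (x.1 - f x.2, x.2)
  left_inv x := by simp
  right_inv x := by simp

omit [Fintype F] [DecidableEq F] in
@[simp] theorem X_apply (f : F → F) (x : F × F) : X f x = (x.1 + f x.2, x.2) := rfl

omit [Fintype F] [DecidableEq F] in
theorem X_fix {f : F → F} {x : F × F} (h : f x.2 = 0) : X f x = x := by
  rw [X_apply, h, add_zero]

def rot (F : Type*) [Field F] : Perm (F × F) where
  toFun x := (x.2, -x.1)
  invFun x := (-x.2, x.1)
  left_inv x := by simp
  right_inv x := by simp

omit [Fintype F] [DecidableEq F] in
@[simp] theorem rot_apply (x : F × F) : rot F x = (x.2, -x.1) := rfl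
omit [Fintype F] [DecidableEq F] in
@[simp] theorem rot_inv_apply (x : F × F) : (rot F)⁻¹ x = (-x.2, x.1) := rfl

structure Good (H : Subgroup (Perm (F × F))) : Prop where
  shear : ∀ e0 e1 e2 : F, X (fun b => e0 + e1 * b + e2 * b ^ 2) ∈ H
  rot_mem : rot F ∈ H

def HT {α : Type*} (H : Subgroup (Perm α)) (t : ℕ) : Prop :=
  ∀ (U : Finset α) (φ : α → α), U.card ≤ t → Set.InjOn φ U → ∃ h ∈ H, ∀ u ∈ U, h u = φ u

section ht
variable {α : Type*} [DecidableEq α] {H : Subgroup (Perm α)} {t : ℕ}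

omit [DecidableEq α] in
theorem HT.mono {s : ℕ} (h : HT H t) (hst : s ≤ t) : HT H s :=
  fun U φ hU hφ => h U φ (hU.trans hst) hφ

theorem HT.move (h : HT H t) (U V : Finset α) (hUV : U.card = V.card) (hU : U.card ≤ t) :
    ∃ g ∈ H, ∀ x, x ∈ U ↔ g x ∈ V := by
  classical
  let e : U ≃ V := Finset.equivOfCardEq hUV
  let φ : α → α := fun x => if hx : x ∈ U then (e ⟨x, hx⟩ : α) else x
  obtain ⟨g, hg, hgu⟩ := h U φ hU (by
    intro x hx y hy hxy
    have hx' : x ∈ U := hx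
    have hy' : y ∈ U := hy
    simp only [φ, hx', hy', dif_pos] at hxy
    have := e.injective (Subtype.ext hxy)
    exact congrArg Subtype.val this)
  have hsub : U.image g ⊆ V := by
    intro y hy
    obtain ⟨x, hx, rfl⟩ := Finset.mem_image.1 hy
    rw [hgu x hx]
    simp only [φ, hx, dif_pos]
    exact (e ⟨x, hx⟩).2
  have heq : U.image g = V := Finset.eq_of_subset_of_card_le hsub (by
    rw [Finset.card_image_of_injective _ g.injective, hUV])
  refine ⟨g, hg, fun x => ⟨fun hx => hsub (Finset.mem_image_of_mem _ hx), fun hx => ?_⟩⟩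
  rw [← heq] at hx
  obtain ⟨y, hy, hyx⟩ := Finset.mem_image.1 hx
  rwa [← g.injective hyx]

theorem HT.fix1 (h : HT H t) (p : Finset α) (hp : p.card + 1 ≤ t) {x y : α} (hx : x ∉ p)
    (hy : y ∉ p) : ∃ g ∈ H, (∀ u ∈ p, g u = u) ∧ g x = y := by
  obtain ⟨g, hg, hgu⟩ := h (insert x p) (fun u => if u = x then y else u) (by
    rw [Finset.card_insert_of_notMem hx]; exact hp) (by
    intro u hu v hv huv
    simp only [Finset.coe_insert, Set.mem_insert_iff, Finset.mem_coe] at hu hv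
    simp only at huv
    split_ifs at huv <;> grind)
  refine ⟨g, hg, fun u hu => ?_, ?_⟩
  · rw [hgu u (Finset.mem_insert_of_mem hu), if_neg]
    rintro rfl; exact hx hu
  · rw [hgu x (Finset.mem_insert_self _ _), if_pos rfl]

theorem HT.fix2 (h : HT H t) (p : Finset α) (hp : p.card + 2 ≤ t) {x y x' y' : α} (hx : x ∉ p)
    (hy : y ∉ p) (hxy : x ≠ y) (hx' : x' ∉ p) (hy' : y' ∉ p) (hxy' : x' ≠ y') :
    ∃ g ∈ H, (∀ u ∈ p, g u = u) ∧ g x = x' ∧ g y = y' := by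
  obtain ⟨g, hg, hgu⟩ := h (insert x (insert y p))
    (fun u => if u = x then x' else if u = y then y' else u) (by
    rw [Finset.card_insert_of_notMem (by grind), Finset.card_insert_of_notMem hy]; exact hp) (by
    intro u hu v hv huv
    simp only [Finset.coe_insert, Set.mem_insert_iff, Finset.mem_coe] at hu hv
    simp only at huv
    split_ifs at huv <;> grind)
  refine ⟨g, hg, fun u hu => ?_, ?_, ?_⟩
  · rw [hgu u (by simp [hu]), if_neg, if_neg]
    · rintro rfl; exact hy hu
    · rintro rfl; exact hx hu
  · rw [hgu x (by simp), if_pos rfl]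
  · rw [hgu y (by simp), if_neg hxy.symm, if_pos rfl]

/-- from 2-transitivity of stabilisers of a single `p0` of size `k` -/
theorem HT.step {k : ℕ} (h : HT H (k + 1)) (p0 : Finset α) (hp0 : p0.card = k)
    (h2 : ∀ x y x' y', x ∉ p0 → y ∉ p0 → x ≠ y → x' ∉ p0 → y' ∉ p0 → x' ≠ y' →
      ∃ g ∈ H, (∀ u ∈ p0, g u = u) ∧ g x = x' ∧ g y = y') : HT H (k + 2) := by
  intro U φ hU hφ
  by_cases hU1 : U.card ≤ k + 1
  · exact h U φ hU1 hφ
  have hUc : U.card = k + 2 := by omega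
  obtain ⟨u1, hu1, u2, hu2, hne⟩ := Finset.one_lt_card.1 (by omega : 1 < U.card)
  set W := (U.erase u1).erase u2 with hW
  have hWU : ∀ w ∈ W, w ∈ U ∧ w ≠ u1 ∧ w ≠ u2 := by
    intro w hw; simp only [hW, Finset.mem_erase] at hw; tauto
  have hWc : W.card = k := by
    rw [hW, Finset.card_erase_of_mem (Finset.mem_erase.2 ⟨hne.symm, hu2⟩),
      Finset.card_erase_of_mem hu1]; omega
  obtain ⟨h1, hh1, hh1'⟩ := h.move W p0 (by omega) (by omega)
  have hinjW : Set.InjOn φ W := hφ.mono (fun w hw => (hWU w hw).1)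
  have hψ : ∃ ψ : α → α, ∀ w ∈ W, ψ (φ w) = w := by
    classical
    refine ⟨fun y => if hy : ∃ w ∈ W, φ w = y then hy.choose else y, fun w hw => ?_⟩
    have hy : ∃ w' ∈ W, φ w' = φ w := ⟨w, hw, rfl⟩
    simp only [dif_pos hy]
    exact hinjW hy.choose_spec.1 hw hy.choose_spec.2
  obtain ⟨ψ, hψ⟩ := hψ
  obtain ⟨h3, hh3, hh3'⟩ := h (W.image φ) (fun y => h1 (ψ y))
    (by rw [Finset.card_image_of_injOn hinjW]; omega) (by
    intro y hy y' hy' hyy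
    simp only [Finset.coe_image, Set.mem_image, Finset.mem_coe] at hy hy'
    obtain ⟨w, hw, rfl⟩ := hy
    obtain ⟨w', hw', rfl⟩ := hy'
    have := h1.injective hyy
    rw [hψ w hw, hψ w' hw'] at this
    rw [this])
  have hh3'' : ∀ w ∈ W, h3 (φ w) = h1 w := fun w hw => by
    rw [hh3' _ (Finset.mem_image_of_mem _ hw), hψ w hw]
  have hout : ∀ u ∈ U, u ∉ W → h3 (φ u) ∉ p0 := by
    intro u hu huW hc
    have h4 : h1 (h1⁻¹ (h3 (φ u))) = h3 (φ u) := by simp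
    rw [← h4] at hc
    have h5 := (hh1' _).2 hc
    rw [← hh3'' _ h5] at h4
    have h6 := hφ (hWU _ h5).1 hu (h3.injective h4)
    rw [h6] at h5; exact huW h5
  have hu1W : u1 ∉ W := fun h => (hWU _ h).2.1 rfl
  have hu2W : u2 ∉ W := fun h => (hWU _ h).2.2 rfl
  obtain ⟨g, hg, hgp, hg1, hg2⟩ := h2 (h1 u1) (h1 u2) (h3 (φ u1)) (h3 (φ u2))
    (fun h => hu1W ((hh1' _).2 h)) (fun h => hu2W ((hh1' _).2 h))
    (fun h => hne (h1.injective h)) (hout _ hu1 hu1W) (hout _ hu2 hu2W)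
    (fun h => hne (hφ hu1 hu2 (h3.injective h)))
  refine ⟨h3⁻¹ * g * h1, H.mul_mem (H.mul_mem (H.inv_mem hh3) hg) hh1, fun u hu => ?_⟩
  simp only [Perm.mul_apply, Perm.inv_eq_iff_eq]
  by_cases h1' : u = u1
  · rw [h1', hg1]
  by_cases h2' : u = u2
  · rw [h2', hg2]
  have huW : u ∈ W := by simp only [hW, Finset.mem_erase]; exact ⟨h2', h1', hu⟩
  rw [hh3'' u huW, hgp _ ((hh1' u).1 huW)]

end ht

variable {H : Subgroup (Perm (F × F))}

omit [Fintype F] [DecidableEq F] in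
theorem Good.quad (hH : Good H) (b1 b2 d : F) : X (fun b => d * ((b - b1) * (b - b2))) ∈ H := by
  have := hH.shear (d * (b1 * b2)) (-(d * (b1 + b2))) d
  convert this using 3
  ring

omit [Fintype F] [DecidableEq F] in
theorem Good.quad0 (hH : Good H) (b1 d : F) : X (fun b => d * (b * (b - b1))) ∈ H := by
  have := hH.quad 0 b1 d
  simpa using this

omit [Fintype F] [DecidableEq F] in
theorem Good.lin (hH : Good H) (d : F) : X (fun b => d * b) ∈ H := by
  have := hH.shear 0 d 0
  simpa using this

omit [Fintype F] [DecidableEq F] in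
theorem Good.const (hH : Good H) (d : F) : X (fun _ => d) ∈ H := by
  have := hH.shear d 0 0
  simpa using this

omit [Fintype F] [DecidableEq F] in
/-- vertical translation -/
theorem Good.vert (hH : Good H) (d : F) : ∃ g ∈ H, ∀ x : F × F, g x = (x.1, x.2 + d) :=
  ⟨rot F * X (fun _ => -d) * (rot F)⁻¹, H.mul_mem (H.mul_mem hH.rot_mem (hH.const _))
    (H.inv_mem hH.rot_mem), fun x => by
      simp [Perm.mul_apply]; ring⟩

omit [Fintype F] [DecidableEq F] in
theorem Good.trans (hH : Good H) (y : F × F) : ∃ g ∈ H, ∀ x : F × F, g x = x + y := by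
  obtain ⟨g, hg, hgx⟩ := hH.vert y.2
  refine ⟨X (fun _ => y.1) * g, H.mul_mem (hH.const _) hg, fun x => ?_⟩
  rw [Perm.mul_apply, hgx, X_apply]; rfl

omit [Fintype F] [DecidableEq F] in
theorem Good.vlin (hH : Good H) (d : F) : ∃ g ∈ H, ∀ x : F × F, g x = (x.1, x.2 + d * x.1) :=
  ⟨rot F * X (fun b => (-d) * b) * (rot F)⁻¹, H.mul_mem (H.mul_mem hH.rot_mem (hH.lin _))
    (H.inv_mem hH.rot_mem), fun x => by
      simp [Perm.mul_apply]; ring⟩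

omit [Fintype F] in
theorem Good.to10 (hH : Good H) (z w : F × F) (hzw : z ≠ w) :
    ∃ g ∈ H, g z = (0, 0) ∧ g w = (1, 0) := by
  -- move z to zero
  have key : ∀ v : F × F, v ≠ 0 → ∃ g ∈ H, g (0, 0) = (0, 0) ∧ g v = (1, 0) := by
    -- first with second coordinate nonzero
    have k1 : ∀ v : F × F, v.2 ≠ 0 → ∃ g ∈ H, g (0, 0) = (0, 0) ∧ g v = (1, 0) := by
      intro v hv
      obtain ⟨g, hg, hgx⟩ := hH.vlin (-v.2)
      refine ⟨g * X (fun b => ((1 - v.1) / v.2) * b), H.mul_mem hg (hH.lin _), ?_, ?_⟩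
      · rw [Perm.mul_apply, X_apply, hgx]; simp
      · rw [Perm.mul_apply, X_apply, hgx]
        simp [div_mul_cancel₀ _ hv]
    intro v hv
    by_cases h2 : v.2 = 0
    · have h1 : v.1 ≠ 0 := fun h1 => hv (Prod.ext h1 h2)
      obtain ⟨g, hg, hgx⟩ := hH.vlin 1
      obtain ⟨g', hg', h0, h1'⟩ := k1 (g v) (by rw [hgx]; simpa [h2] using h1)
      refine ⟨g' * g, H.mul_mem hg' hg, ?_, h1'⟩
      rw [Perm.mul_apply, hgx]; simpa using h0
    · exact k1 v h2
  obtain ⟨g, hg, hgx⟩ := hH.trans (-z)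
  obtain ⟨g', hg', h0, h1⟩ := key (g w) (by
    rw [hgx]; intro h; apply hzw; rw [← sub_eq_add_neg, sub_eq_zero] at h; exact h.symm)
  refine ⟨g' * g, H.mul_mem hg' hg, ?_, h1⟩
  rw [Perm.mul_apply, hgx]
  rw [show z + -z = (0, 0) by rw [add_neg_cancel]; rfl]; exact h0

omit [Fintype F] in
theorem Good.ht2 (hH : Good H) : HT H 2 := by
  have h1 : HT H 1 := by
    intro U φ hU hφ
    by_cases hU0 : U = ∅
    · exact ⟨1, H.one_mem, by simp [hU0]⟩
    · obtain ⟨u, rfl⟩ := Finset.card_eq_one.1 (le_antisymm hU (Finset.card_pos.2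
        (Finset.nonempty_iff_ne_empty.2 hU0)))
      obtain ⟨g, hg, hgx⟩ := hH.trans (φ u - u)
      refine ⟨g, hg, fun v hv => ?_⟩
      rw [Finset.mem_singleton.1 hv, hgx]; abel
  refine HT.step (k := 0) h1 ∅ rfl ?_
  intro x y x' y' _ _ hxy _ _ hxy'
  obtain ⟨g, hg, h0, h1⟩ := hH.to10 x y hxy
  obtain ⟨g', hg', h0', h1'⟩ := hH.to10 x' y' hxy'
  refine ⟨g'⁻¹ * g, H.mul_mem (H.inv_mem hg') hg, by simp, ?_, ?_⟩
  · rw [Perm.mul_apply, h0, ← h0']; simp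
  · rw [Perm.mul_apply, h1, ← h1']; simp

/-- the line `b = c` -/
def line (c : F) : Finset (F × F) := Finset.univ.filter (fun x => x.2 = c)

@[simp] theorem mem_line (c : F) (x : F × F) : x ∈ line c ↔ x.2 = c := by simp [line]

theorem card_line (c : F) : (line c).card = Fintype.card F := by
  have : line c = Finset.univ.image (fun a : F => (a, c)) := by
    ext x; simp only [mem_line, Finset.mem_image, Finset.mem_univ, true_and]
    constructor
    · intro h; exact ⟨x.1, by rw [← h]⟩
    · rintro ⟨a, rfl⟩; rfl
  rw [this, Finset.card_image_of_injective _ (fun a b h => by simpa using h), Finset.card_univ]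

/-- if `B` has, with `w`, all its translates by `d * c`, `c ≠ 0`, it contains the line. -/
theorem line_subset {B : Finset (F × F)} {w : F × F} {c : F} (hc : c ≠ 0)
    (h : ∀ d : F, (w.1 + d * c, w.2) ∈ B) : line w.2 ⊆ B := by
  intro x hx
  rw [mem_line] at hx
  have := h ((x.1 - w.1) / c)
  rw [div_mul_cancel₀ _ hc] at this
  convert this using 1
  ext <;> simp [hx]

/-- a set closed under full lines has cardinality divisible by q -/
theorem dvd_of_lines (B : Finset (F × F)) (h : ∀ w ∈ B, line w.2 ⊆ B) :
    Fintype.card F ∣ B.card := by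
  rw [card_of_classes B (fun z => line z.2) (Fintype.card F)]
  · exact Dvd.intro_left _ rfl
  · intro z _; simp
  · exact h
  · intro z _; exact card_line _
  · intro z _ w hw; rw [mem_line] at hw; simp only [hw]

end geom
end S17

open Equiv

namespace S17
section small
variable {F : Type*} [Field F] [Fintype F] [DecidableEq F]

open Classical in
noncomputable def cl (H : Subgroup (Perm (F × F))) (U : Finset (F × F)) : Finset (F × F) :=
  Finset.univ.filter (fun y => ∀ h ∈ H, ∀ b1 b2 : F,
    (∀ u ∈ U, (h u).2 = b1 ∨ (h u).2 = b2) → ((h y).2 = b1 ∨ (h y).2 = b2))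

variable {H : Subgroup (Perm (F × F))}

theorem mem_cl {U : Finset (F × F)} {y : F × F} : y ∈ cl H U ↔ ∀ h ∈ H, ∀ b1 b2 : F,
    (∀ u ∈ U, (h u).2 = b1 ∨ (h u).2 = b2) → ((h y).2 = b1 ∨ (h y).2 = b2) := by
  simp [cl]

theorem subset_cl (U : Finset (F × F)) : U ⊆ cl H U := fun y hy =>
  mem_cl.2 fun _ _ _ _ h => h y hy

theorem cl_mono' {U V : Finset (F × F)} (h : V ⊆ cl H U) : cl H V ⊆ cl H U := by
  intro y hy
  rw [mem_cl] at hy ⊢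
  intro g hg b1 b2 hU
  exact hy g hg b1 b2 fun v hv => mem_cl.1 (h hv) g hg b1 b2 hU

theorem cl_two {U : Finset (F × F)} (b1 b2 : F) (h : U ⊆ line b1 ∪ line b2) :
    cl H U ⊆ line b1 ∪ line b2 := by
  intro y hy
  have := mem_cl.1 hy 1 H.one_mem b1 b2 (fun u hu => by simpa using h hu)
  simpa using this

theorem cl_one {U : Finset (F × F)} (b : F) (h : U ⊆ line b) : cl H U ⊆ line b := by
  have := cl_two (H := H) b b (U := U) (by simpa using h)
  simpa using this

theorem card_cl_le {U V : Finset (F × F)} {g : Perm (F × F)} (hg : g ∈ H)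
    (h : ∀ x, x ∈ U ↔ g x ∈ V) : (cl H U).card ≤ (cl H V).card := by
  rw [← Finset.card_image_of_injective (cl H U) g.injective]
  apply Finset.card_le_card
  intro y hy
  obtain ⟨x, hx, rfl⟩ := Finset.mem_image.1 hy
  rw [mem_cl] at hx ⊢
  intro h' hh' b1 b2 hV
  exact hx (h' * g) (H.mul_mem hh' hg) b1 b2 fun u hu => hV _ ((h u).1 hu)

theorem card_cl_eq {t : ℕ} (ht : HT H t) {U V : Finset (F × F)} (hU : U.card = t)
    (hV : V.card = t) : (cl H U).card = (cl H V).card := by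
  obtain ⟨g, hg, h⟩ := ht.move U V (by omega) hU.le
  obtain ⟨g', hg', h'⟩ := ht.move V U (by omega) hV.le
  exact le_antisymm (card_cl_le hg h) (card_cl_le hg' h')

theorem card_cl {t : ℕ} (ht : HT H t) (h2 : 2 ≤ t) (htq : t + 1 ≤ Fintype.card F)
    (hq : 5 ≤ Fintype.card F) (hodd : Odd (Fintype.card F)) (U : Finset (F × F))
    (hU : U.card = t) : (cl H U).card = t := by
  set q := Fintype.card F with hqd
  obtain ⟨U0, hU0, hU0c⟩ := Finset.exists_subset_card_eq (s := line (0 : F)) (n := t)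
    (by rw [card_line]; omega)
  obtain ⟨p0, hp0, hp0c⟩ := Finset.exists_subset_card_eq (s := line (0 : F)) (n := t - 1)
    (by rw [card_line]; omega)
  obtain ⟨p1, hp1, hp1c⟩ := Finset.exists_subset_card_eq (s := line (0 : F)) (n := t - 2)
    (by rw [card_line]; omega)
  set m := (cl H U0).card with hm
  have hmU : ∀ U : Finset (F × F), U.card = t → (cl H U).card = m := fun U hU =>
    card_cl_eq ht hU hU0c
  rw [hmU U hU]
  by_contra hne
  have hmt : t < m := by
    refine lt_of_le_of_ne ?_ (Ne.symm hne)
    rw [← hU0c]; exact Finset.card_le_card (subset_cl _)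
  have hmq : m ≤ q := by
    rw [hqd, ← card_line (0 : F)]; exact Finset.card_le_card (cl_one 0 hU0)
  have hs : ∀ U : Finset (F × F), U.card = t → U ⊆ cl H U := fun U _ => subset_cl U
  have hex : ∀ U V : Finset (F × F), U.card = t → V.card = t → V ⊆ cl H U → cl H V = cl H U :=
    fun U V hU hV hVU => Finset.eq_of_subset_of_card_le (cl_mono' hVU)
      (by rw [hmU U hU, hmU V hV])
  have hA1 : ∀ U : Finset (F × F), U.card = t → U ⊆ line (0 : F) → cl H U ⊆ line 0 :=
    fun U _ h => cl_one 0 h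
  have hA2 : ∀ U : Finset (F × F), U.card = t → U ⊆ line (0 : F) ∪ line 1 →
      cl H U ⊆ line 0 ∪ line 1 := fun U _ h => cl_two 0 1 h
  have hdj : Disjoint (line (0 : F)) (line 1) := by
    rw [Finset.disjoint_left]; intro x hx hx'
    rw [mem_line] at hx hx'; rw [hx] at hx'; exact zero_ne_one hx'
  have hc2 : (line (0 : F) ∪ line 1).card = 2 * q := by
    rw [Finset.card_union_of_disjoint hdj, card_line, card_line]; ring
  have d1 := st_dvd (cl H) t m hs hex hmU (line 0) p0 hA1 hp0 (by omega)
  have d2 := st_dvd (cl H) t m hs hex hmU (line 0 ∪ line 1) p0 hA2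
    (hp0.trans Finset.subset_union_left) (by omega)
  rw [card_line, hp0c, ← hqd] at d1
  rw [hc2, hp0c] at d2
  have d3 : (m - t + 1) ∣ q := by
    have := Nat.dvd_sub d2 d1
    rwa [show 2 * q - (t - 1) - (q - (t - 1)) = q by omega] at this
  have hm3 : t + 2 ≤ m := by
    by_contra hlt
    have : m - t + 1 = 2 := by omega
    rw [this] at d3
    rcases hodd with ⟨j, hj⟩
    omega
  by_cases hmq' : m = q
  · -- cl U0 = line
    have := st_mul (cl H) t m hs hex hmU (line 0 ∪ line 1) U0 (0, 1) hA2
      (hU0.trans Finset.subset_union_left) hU0c (by simp) (fun h => by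
        have := hA1 U0 hU0c hU0 h
        simp at this)
    rw [hc2, hmq'] at this
    obtain ⟨j, hj⟩ : ∃ j, q = t + 2 + j := ⟨q - t - 2, by omega⟩
    rw [hj, show t + 2 + j - t + 1 = j + 3 by omega] at this
    obtain ⟨i, hi⟩ : ∃ i, t = 2 + i := ⟨t - 2, by omega⟩
    rw [hi] at this
    nlinarith
  · obtain ⟨z, hz, hzU⟩ : ∃ z ∈ line (0 : F), z ∉ cl H U0 := by
      by_contra hcon
      push Not at hcon
      have := Finset.card_le_card (show line (0 : F) ⊆ cl H U0 from hcon)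
      rw [card_line] at this
      omega
    have h1 := st_mul (cl H) t m hs hex hmU (line 0) U0 z hA1 hU0 hU0c hz hzU
    have h2' := st_two (cl H) t m hs hex hmU (line 0) (line 1) p1 (0, 1) hA1 hA2 hdj hp1
      (by omega) (by simp)
    rw [card_line, ← hqd] at h1
    rw [card_line, card_line, ← hqd, hp1c] at h2'
    have h3 : (t + 1) * 3 ≤ q := le_trans (Nat.mul_le_mul le_rfl (by omega)) h1
    have h4 : 2 * (q - (t - 2)) ≤ q - 1 := le_trans (Nat.mul_le_mul (by omega) le_rfl) h2'
    omega

/-- the small case -/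
theorem small_case (hH : Good H) {k : ℕ} (hk : 1 ≤ k) (hkq : k + 2 ≤ Fintype.card F)
    (ht : HT H (k + 1)) (hq : 5 ≤ Fintype.card F) (hodd : Odd (Fintype.card F))
    (p : Finset (F × F)) (hp : p ⊆ line 0) (hpk : p.card = k)
    (R : F × F → F × F → Prop) (hR : Equivalence R)
    (hRp : ∀ x ∈ p, ∀ y, R x y → y = x)
    (hinv : ∀ g ∈ H, (∀ u ∈ p, g u = u) → ∀ x y, R x y → R (g x) (g y))
    (hline : ∀ x y, R x y → x.2 = y.2) (x y : F × F) (hxy : R x y) : x = y := by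
  classical
  by_contra hne
  let C : F × F → Finset (F × F) := fun z => Finset.univ.filter (R z)
  have hC : ∀ z w, w ∈ C z ↔ R z w := fun z w => by simp [C]
  -- all classes outside p have equal size
  have hle : ∀ z w, z ∉ p → w ∉ p → (C z).card ≤ (C w).card := by
    intro z w hz hw
    obtain ⟨g, hg, hgp, hgz⟩ := ht.fix1 p (by omega) hz hw
    rw [← Finset.card_image_of_injective (C z) g.injective]
    apply Finset.card_le_card
    intro v hv
    obtain ⟨u, hu, rfl⟩ := Finset.mem_image.1 hv
    rw [hC] at hu ⊢
    rw [← hgz]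
    exact hinv g hg hgp _ _ hu
  have hnp : ∀ {z w}, R z w → z ∉ p → w ∉ p := by
    intro z w h hz hw
    exact hz ((hRp w hw z (hR.symm h)) ▸ hw)
  -- a point of line 0 outside p
  obtain ⟨z0, hz0, hz0p⟩ : ∃ z ∈ line (0 : F), z ∉ p := by
    by_contra hcon
    push Not at hcon
    have := Finset.card_le_card (show line (0 : F) ⊆ p from hcon)
    rw [card_line] at this
    omega
  have hlt : ∀ z, z ∉ p → (C z).card < Fintype.card F := by
    intro z hz
    refine lt_of_le_of_lt (hle z z0 hz hz0p) ?_
    rw [← card_line (0 : F)]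
    have hsub : C z0 ⊆ line 0 \ p := by
      intro w hw
      rw [hC] at hw
      rw [Finset.mem_sdiff, mem_line, ← hline _ _ hw]
      exact ⟨by simpa using hz0, hnp hw hz0p⟩
    refine lt_of_le_of_lt (Finset.card_le_card hsub) ?_
    rw [Finset.card_sdiff_of_subset hp]
    have : 0 < (line (0 : F)).card := by rw [card_line]; omega
    omega
  have hxp : x ∉ p := fun h => hne (hRp x h y hxy).symm
  have hyp : y ∉ p := hnp hxy hxp
  have hycl : y ∈ cl H (insert x p) := by
    rw [mem_cl]
    intro h hh b1 b2 hb
    by_contra hcon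
    push Not at hcon
    have hfix : ∀ d, ∀ u ∈ insert x p, (h⁻¹ * X (fun b => d * ((b - b1) * (b - b2))) * h) u = u := by
      intro d u hu
      have : X (fun b => d * ((b - b1) * (b - b2))) (h u) = h u := by
        apply X_fix
        rcases hb u hu with e | e <;> simp [e]
      simp only [Perm.mul_apply, this]; simp
    have hmem : ∀ d, (h⁻¹ * X (fun b => d * ((b - b1) * (b - b2))) * h) ∈ H := fun d =>
      H.mul_mem (H.mul_mem (H.inv_mem hh) (hH.quad _ _ _)) hh
    have hall : line (h y).2 ⊆ (C x).image h := by
      apply line_subset (c := ((h y).2 - b1) * ((h y).2 - b2))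
        (mul_ne_zero (sub_ne_zero.2 hcon.1) (sub_ne_zero.2 hcon.2))
      intro d
      have h1 := hinv _ (hmem d) (fun u hu => hfix d u (Finset.mem_insert_of_mem hu)) _ _ hxy
      rw [hfix d x (Finset.mem_insert_self _ _)] at h1
      refine Finset.mem_image.2 ⟨_, (hC _ _).2 h1, ?_⟩
      simp [Perm.mul_apply]
    have := Finset.card_le_card hall
    rw [card_line, Finset.card_image_of_injective _ h.injective] at this
    exact absurd (hlt x hxp) (by omega)
  have hcard : (insert x p).card = k + 1 := by rw [Finset.card_insert_of_notMem hxp, hpk]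
  have h1 := card_cl ht (by omega) (by omega) hq hodd (insert x p) hcard
  have h2 : insert y (insert x p) ⊆ cl H (insert x p) :=
    Finset.insert_subset hycl (subset_cl _)
  have h3 := Finset.card_le_card h2
  rw [h1, Finset.card_insert_of_notMem, hcard] at h3
  · omega
  · rw [Finset.mem_insert, not_or]; exact ⟨fun h => hne h.symm, hyp⟩

end small
end S17

open Equiv

namespace S17
section large
variable {F : Type*} [Field F] [Fintype F] [DecidableEq F]
variable {H : Subgroup (Perm (F × F))}

theorem card_plane : (Finset.univ : Finset (F × F)).card = Fintype.card F * Fintype.card F := by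
  rw [Finset.card_univ, Fintype.card_prod]

theorem large_case (hH : Good H) {k : ℕ} (hk : 1 ≤ k) (hkq : k + 2 ≤ Fintype.card F)
    (ht : HT H (k + 1)) (hq : 5 ≤ Fintype.card F)
    (p : Finset (F × F)) (hp : p ⊆ line 0) (hpk : p.card = k)
    (R : F × F → F × F → Prop) (hR : Equivalence R)
    (hRp : ∀ x ∈ p, ∀ y, R x y → y = x)
    (hinv : ∀ g ∈ H, (∀ u ∈ p, g u = u) → ∀ x y, R x y → R (g x) (g y))
    (hline : ∀ x y, x.2 = y.2 → x.2 ≠ 0 → R x y) (x1 y1 : F × F) (hx1 : x1 ∉ p) (hy1 : y1 ∉ p) :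
    R x1 y1 := by
  classical
  by_contra hne
  set q := Fintype.card F with hqd
  let C : F × F → Finset (F × F) := fun z => Finset.univ.filter (R z)
  have hC : ∀ z w, w ∈ C z ↔ R z w := fun z w => by simp [C]
  have hCeq : ∀ z w, R z w → C w = C z := by
    intro z w h
    ext v; rw [hC, hC]; exact ⟨fun h' => hR.trans h h', fun h' => hR.trans (hR.symm h) h'⟩
  have hCeq' : ∀ z w, C w = C z → R z w := by
    intro z w h
    rw [← hC, ← h, hC]; exact hR.refl w
  have hle : ∀ z w, z ∉ p → w ∉ p → (C z).card ≤ (C w).card := by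
    intro z w hz hw
    obtain ⟨g, hg, hgp, hgz⟩ := ht.fix1 p (by omega) hz hw
    rw [← Finset.card_image_of_injective (C z) g.injective]
    apply Finset.card_le_card
    intro v hv
    obtain ⟨u, hu, rfl⟩ := Finset.mem_image.1 hv
    rw [hC] at hu ⊢
    rw [← hgz]
    exact hinv g hg hgp _ _ hu
  have hnp : ∀ {z w}, R z w → z ∉ p → w ∉ p := by
    intro z w h hz hw
    exact hz ((hRp w hw z (hR.symm h)) ▸ hw)
  set s := (C x1).card with hs
  have hsc : ∀ z, z ∉ p → (C z).card = s := fun z hz =>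
    le_antisymm (hle z x1 hz hx1) (hle x1 z hx1 hz)
  set Δ : Finset (F × F) := Finset.univ \ p with hΔ
  have hmΔ : ∀ z, z ∈ Δ ↔ z ∉ p := fun z => by simp [hΔ]
  have hΔc : Δ.card = q * q - k := by
    rw [hΔ, Finset.card_sdiff_of_subset (Finset.subset_univ _), card_plane, hpk]
  have hpart := card_of_classes Δ C s (fun z _ => (hC z z).2 (hR.refl z))
    (fun z hz w hw => (hmΔ w).2 (hnp ((hC z w).1 hw) ((hmΔ z).1 hz)))
    (fun z hz => hsc z ((hmΔ z).1 hz)) (fun z _ w hw => hCeq z w ((hC z w).1 hw))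
  set β := (Δ.image C).card with hβ
  set e := s % q with he
  have hinter : ∀ z, z ∉ p → (C z ∩ line 0).card = e := by
    intro z hz
    have h1 : q ∣ (C z \ line 0).card := by
      apply dvd_of_lines
      intro w hw x hx
      rw [Finset.mem_sdiff, hC, mem_line] at hw ⊢
      rw [mem_line] at hx
      refine ⟨hR.trans hw.1 (hline w x hx.symm hw.2), by rw [hx]; exact hw.2⟩
    have h2 := Finset.card_inter_add_card_sdiff (C z) (line 0)
    rw [hsc z hz] at h2
    have h3 : (C z ∩ line 0).card < q := by
      have : C z ∩ line 0 ⊆ line 0 \ p := by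
        intro w hw
        rw [Finset.mem_inter, hC] at hw
        exact Finset.mem_sdiff.2 ⟨hw.2, hnp hw.1 hz⟩
      have := Finset.card_le_card this
      rw [Finset.card_sdiff_of_subset hp, card_line, hpk] at this
      omega
    obtain ⟨c, hc⟩ := h1
    rw [he, ← h2, hc, Nat.add_mul_mod_self_left, Nat.mod_eq_of_lt h3]
  have hβe : q - k = β * e := by
    have h1 : (line (0:F) \ p).card = q - k := by
      rw [Finset.card_sdiff_of_subset hp, card_line, hpk]
    rw [← h1, Finset.card_eq_sum_card_fiberwise (f := C) (t := Δ.image C), Finset.sum_congr rfl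
      (g := fun _ => e), Finset.sum_const, smul_eq_mul]
    · intro b hb
      obtain ⟨z, hz, rfl⟩ := Finset.mem_image.1 hb
      rw [← hinter z ((hmΔ z).1 hz)]
      congr 1
      ext w
      simp only [Finset.mem_filter, Finset.mem_sdiff, Finset.mem_inter, hC]
      constructor
      · rintro ⟨⟨h1, h2⟩, h3⟩; exact ⟨hCeq' _ _ h3, h1⟩
      · rintro ⟨h1, h2⟩; exact ⟨⟨h2, hnp h1 ((hmΔ z).1 hz)⟩, hCeq _ _ h1⟩
    · intro w hw
      rw [Finset.mem_coe, Finset.mem_sdiff] at hw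
      exact Finset.mem_coe.2 (Finset.mem_image_of_mem _ ((hmΔ w).2 hw.2))
  have he1 : 1 ≤ e := by
    rcases Nat.eq_zero_or_pos e with h | h
    · rw [h] at hβe; omega
    · exact h
  have hsq : q + 1 ≤ s := by
    have h1 : (0, 1) ∉ p := fun h => by have := hp h; simp at this
    have h2 : line 1 ⊆ C (0, 1) := by
      intro w hw
      rw [mem_line] at hw
      rw [hC]; exact hline _ _ (by simp [hw]) (by simp)
    have h3 := Finset.card_le_card h2
    rw [card_line, hsc _ h1] at h3
    rcases Nat.lt_or_ge q s with h | h
    · exact h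
    · have : s = q := le_antisymm h h3
      rw [he, this, Nat.mod_self] at he1
      omega
  have hβ2 : 2 ≤ β := by
    rw [hβ]
    apply Finset.one_lt_card.2
    exact ⟨C x1, Finset.mem_image_of_mem _ ((hmΔ _).2 hx1), C y1,
      Finset.mem_image_of_mem _ ((hmΔ _).2 hy1), fun h => hne (hCeq' _ _ h.symm)⟩
  have h2s : 2 * s ≤ q * q - k := by rw [← hΔc, hpart]; exact Nat.mul_le_mul hβ2 le_rfl
  -- transport
  obtain ⟨x0, hx0⟩ : p.Nonempty := Finset.card_pos.1 (by omega)
  set p' := p.erase x0 with hp'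
  have hp'k : p'.card = k - 1 := by rw [hp', Finset.card_erase_of_mem hx0, hpk]
  have hx0' : x0 ∉ p' := Finset.notMem_erase _ _
  have hp'p : ∀ u, u ∈ p ↔ u = x0 ∨ u ∈ p' := by
    intro u; rw [hp', Finset.mem_erase]
    constructor
    · intro h; by_cases h' : u = x0
      · exact Or.inl h'
      · exact Or.inr ⟨h', h⟩
    · rintro (rfl | h)
      · exact hx0
      · exact h.2
  have hp'0 : ∀ u ∈ p', u.2 = 0 := fun u hu => by
    have := hp ((hp'p u).2 (Or.inr hu)); simpa using this
  have hch : ∀ x : F × F, ∃ g ∈ H, (∀ u ∈ p', g u = u) ∧ (x ∉ p' → g x0 = x) := by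
    intro x
    by_cases hx : x ∈ p'
    · exact ⟨1, H.one_mem, by simp, fun h => absurd hx h⟩
    · obtain ⟨g, h1, h2, h3⟩ := (ht.mono (Nat.le_succ k)).fix1 p' (by omega) hx0' hx
      exact ⟨g, h1, h2, fun _ => h3⟩
  choose h hhH hhp hhx using hch
  have hfi : ∀ {g : Perm (F × F)} {u : F × F}, g u = u → g⁻¹ u = u := fun hgu => by
    rw [Perm.inv_eq_iff_eq]; exact hgu.symm
  let S : F × F → F × F → F × F → Prop := fun x z w => R ((h x)⁻¹ z) ((h x)⁻¹ w)
  have hSr : ∀ x z, S x z z := fun x z => hR.refl _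
  have hSs : ∀ {x z w}, S x z w → S x w z := fun h => hR.symm h
  have hSt : ∀ {x z w v}, S x z w → S x w v → S x z v := fun h h' => hR.trans h h'
  have hSe : ∀ g ∈ H, (∀ u ∈ p', g u = u) → ∀ x, x ∉ p' → ∀ z w, S x z w →
      S (g x) (g z) (g w) := by
    intro g hg hgp x hx z w hS
    have hgx : g x ∉ p' := fun hc => by
      have h1 := hgp _ hc
      rw [g.injective h1] at hc; exact hx hc
    have := hinv ((h (g x))⁻¹ * g * h x) (H.mul_mem (H.mul_mem (H.inv_mem (hhH _)) hg) (hhH _)) (by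
      intro u hu
      simp only [Perm.mul_apply]
      rcases (hp'p u).1 hu with rfl | hu
      · rw [hhx x hx, Perm.inv_eq_iff_eq, hhx (g x) hgx]
      · rw [hhp x u hu, hgp u hu, hfi (hhp _ u hu)]) _ _ hS
    simpa [S, Perm.mul_apply] using this
  let D : F × F → F × F → Finset (F × F) := fun x z => Finset.univ.filter (S x z)
  have hD : ∀ x z w, w ∈ D x z ↔ S x z w := fun x z w => by simp [D]
  have hnp' : ∀ x z, x ∉ p' → z ∉ p' → z ≠ x → (h x)⁻¹ z ∉ p := by
    intro x z hx hz hzx hc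
    rcases (hp'p _).1 hc with h1 | h1
    · rw [Perm.inv_eq_iff_eq, hhx x hx] at h1; exact hzx h1
    · have h2 := hhp x _ h1
      rw [show (h x) ((h x)⁻¹ z) = z by simp] at h2
      rw [← h2] at h1; exact hz h1
  have hDc : ∀ x z, x ∉ p' → z ∉ p' → z ≠ x → (D x z).card = s := by
    intro x z hx hz hzx
    have : D x z = (C ((h x)⁻¹ z)).image (h x) := by
      ext w
      rw [hD, Finset.mem_image]
      constructor
      · intro hS; exact ⟨(h x)⁻¹ w, (hC _ _).2 hS, by simp⟩
      · rintro ⟨v, hv, rfl⟩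
        rw [hC] at hv
        simpa [S] using hv
    rw [this, Finset.card_image_of_injective _ (h x).injective, hsc _ (hnp' x z hx hz hzx)]
  have hSx : ∀ x z, x ∉ p' → S x x z → z = x := by
    intro x z hx hS
    have h1 : (h x)⁻¹ x = x0 := by rw [Perm.inv_eq_iff_eq, hhx x hx]
    have h2 : R x0 ((h x)⁻¹ z) := by
      have h3 : R ((h x)⁻¹ x) ((h x)⁻¹ z) := hS
      rwa [h1] at h3
    have h3 := hRp x0 hx0 _ h2
    rw [Perm.inv_eq_iff_eq, hhx x hx] at h3
    exact h3
  have hSp : ∀ x z w, w ∈ p' → S x z w → z = w := by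
    intro x z w hw hS
    have h1 : (h x)⁻¹ w = w := hfi (hhp x w hw)
    have h2 : R w ((h x)⁻¹ z) := by
      have h3 : R ((h x)⁻¹ z) ((h x)⁻¹ w) := hS
      rw [h1] at h3
      exact hR.symm h3
    have h3 := hRp w ((hp'p w).2 (Or.inr hw)) _ h2
    rw [Perm.inv_eq_iff_eq, hhp x w hw] at h3
    exact h3
  -- moving along lines
  have hmove : ∀ x v z w b3 : F × F, x ∉ p' → (x.2 = 0 ∨ x.2 = b3.2) → (v.2 = 0 ∨ v.2 = b3.2) →
      z.2 ≠ 0 → z.2 ≠ b3.2 → w.2 = z.2 → S x v z → S x v w := by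
    intro x v z w b3 hx hx2 hv2 hz0 hzb hw hS
    have : line z.2 ⊆ D x v := by
      apply line_subset (c := z.2 * (z.2 - b3.2)) (mul_ne_zero hz0 (sub_ne_zero.2 hzb))
      intro d
      rw [hD]
      have h1 := hSe (X (fun b => d * (b * (b - b3.2)))) (hH.quad0 _ _)
        (fun u hu => X_fix (by simp [hp'0 u hu])) x hx v z hS
      rw [X_fix (x := x) (by rcases hx2 with e | e <;> simp [e]),
        X_fix (x := v) (by rcases hv2 with e | e <;> simp [e])] at h1
      exact h1
    rw [← hD]; exact this (by simp [hw])
  -- key claim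
  have key : ∀ x z w : F × F, x ∉ p' → z.2 ≠ 0 → w.2 = z.2 → x.2 ≠ z.2 → S x z w := by
    intro x z w hx hz hw hxz
    have hzp : z ∉ p' := fun h => hz (hp'0 z h)
    have hzx : z ≠ x := fun h => hxz (by rw [h])
    by_cases hx0 : x.2 = 0
    · obtain ⟨w', hw', hw2⟩ : ∃ w' ∈ D x z, w'.2 ≠ z.2 := by
        by_contra hcon
        push Not at hcon
        have h1 : D x z ⊆ line z.2 := fun v hv => by rw [mem_line]; exact hcon v hv
        have := Finset.card_le_card h1
        rw [card_line, hDc x z hx hzp hzx] at this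
        omega
      rw [hD] at hw'
      exact hSt hw' (hmove x w' z w w' hx (Or.inl hx0) (Or.inr rfl) hz (Ne.symm hw2) hw (hSs hw'))
    · let W : Finset (F × F) := Finset.univ.filter fun w =>
        w ∉ p' ∧ w ≠ x ∧ ∀ v, S x w v → v.2 ≠ 0 ∧ v.2 ≠ x.2
      have hWm : ∀ w, w ∈ W ↔ w ∉ p' ∧ w ≠ x ∧ ∀ v, S x w v → v.2 ≠ 0 ∧ v.2 ≠ x.2 :=
        fun w => by simp [W]
      have hWq : q ∣ W.card := by
        apply dvd_of_lines
        intro w hw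
        rw [hWm] at hw
        have hw2 := hw.2.2 w (hSr x w)
        apply line_subset (c := w.2 * (w.2 - x.2)) (mul_ne_zero hw2.1 (sub_ne_zero.2 hw2.2))
        intro d
        rw [hWm]
        refine ⟨fun hc => hw2.1 (hp'0 (w.1 + d * (w.2 * (w.2 - x.2)), w.2) hc), fun hc => hw2.2 (by rw [← hc]), ?_⟩
        intro v hv
        by_contra hcon
        have hcon' : v.2 = 0 ∨ v.2 = x.2 := by tauto
        have h1 := hSe (X (fun b => (-d) * (b * (b - x.2)))) (hH.quad0 _ _)
          (fun u hu => X_fix (by simp [hp'0 u hu])) x hx _ v hv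
        rw [X_fix (x := x) (by simp),
          X_fix (x := v) (by rcases hcon' with e | e <;> simp [e])] at h1
        have h2 : X (fun b => (-d) * (b * (b - x.2))) (w.1 + d * (w.2 * (w.2 - x.2)), w.2) = w := by
          rw [X_apply]; ext <;> simp
        rw [h2] at h1
        have := hw.2.2 v h1
        tauto
      have hWpart := card_of_classes W (D x) s (fun z _ => (hD x z z).2 (hSr x z)) (by
        intro z hz v hv
        rw [hD] at hv
        rw [hWm] at hz ⊢
        refine ⟨fun hc => hz.1 (by rwa [hSp x z v hc hv]), fun hc => hz.2.1 ?_, fun u hu =>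
          hz.2.2 u (hSt hv hu)⟩
        rw [hc] at hv
        exact hSx x z hx (hSs hv))
        (fun z hz => hDc x z hx ((hWm z).1 hz).1 ((hWm z).1 hz).2.1) (by
        intro z hz v hv
        rw [hD] at hv
        ext u
        rw [hD, hD]
        exact ⟨fun h' => hSt hv h', fun h' => hSt (hSs hv) h'⟩)
      have hjβ : (W.image (D x)).card ≤ β := by
        have h1 : W ⊆ (Finset.univ \ (insert x p')) := by
          intro v hv
          rw [hWm] at hv
          simp [hv.1, hv.2.1]
        have h2 := Finset.card_le_card h1
        rw [Finset.card_sdiff_of_subset (Finset.subset_univ _), card_plane,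
          Finset.card_insert_of_notMem hx, hp'k, show k - 1 + 1 = k by omega, ← hqd, ← hΔc, hpart,
          hWpart] at h2
        exact Nat.le_of_mul_le_mul_right h2 (by omega)
      set j := (W.image (D x)).card with hj
      have hqj : q ∣ j * e := by
        rw [hWpart] at hWq
        rw [he, Nat.dvd_iff_mod_eq_zero, Nat.mul_mod_mod]
        exact Nat.mod_eq_zero_of_dvd hWq
      have hje : j * e < q := by
        have := Nat.mul_le_mul_right e hjβ
        omega
      have hj0 : j = 0 := by
        have := Nat.eq_zero_of_dvd_of_lt hqj hje
        rcases Nat.mul_eq_zero.1 this with h1 | h1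
        · exact h1
        · omega
      have hW0 : W = ∅ := by
        rw [← Finset.card_eq_zero, hWpart, hj0, zero_mul]
      have hzW : z ∉ W := by rw [hW0]; simp
      obtain ⟨v, hSv, hv⟩ : ∃ v, S x z v ∧ (v.2 = 0 ∨ v.2 = x.2) := by
        by_contra hcon
        push Not at hcon
        exact hzW ((hWm z).2 ⟨hzp, hzx, hcon⟩)
      exact hSt hSv (hmove x v z w x hx (Or.inr rfl) hv hz (Ne.symm hxz) hw (hSs hSv))
  -- counting
  set Ω' : Finset (F × F) := Finset.univ \ p' with hΩ'
  have hmΩ : ∀ z, z ∈ Ω' ↔ z ∉ p' := fun z => by simp [hΩ']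
  have hΩc : Ω'.card = q * q - (k - 1) := by
    rw [hΩ', Finset.card_sdiff_of_subset (Finset.subset_univ _), card_plane, hp'k]
  let z : F × F := (0, 1)
  let w1 : F × F := (1, 1)
  have hzΩ : z ∉ p' := fun h => by have := hp'0 _ h; simp [z] at this
  have hw1Ω : w1 ∉ p' := fun h => by have := hp'0 _ h; simp [w1] at this
  have hzw : z ≠ w1 := by simp [z, w1]
  have hqq : q * 5 ≤ q * q := Nat.mul_le_mul le_rfl hq
  have hΛ1 : q * q - (k - 1) - q ≤ (Ω'.filter (fun x => S x z w1)).card := by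
    have h1 : Ω' \ line 1 ⊆ Ω'.filter (fun x => S x z w1) := by
      intro x hx
      rw [Finset.mem_sdiff, mem_line] at hx
      rw [Finset.mem_filter]
      refine ⟨hx.1, key x z w1 ((hmΩ x).1 hx.1) (by simp [z]) rfl hx.2⟩
    have h2 := Finset.card_le_card h1
    have h3 := Finset.le_card_sdiff (line (1:F)) Ω'
    rw [card_line, hΩc] at h3
    omega
  have hΛ : ∀ w ∈ Ω'.erase z, q * q - (k - 1) - q ≤ ((Ω'.erase z).filter (fun x => S x z w)).card := by
    intro w hw
    rw [Finset.mem_erase] at hw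
    refine hΛ1.trans ?_
    obtain ⟨g, hg, hgp, hgz, hgw⟩ := ht.fix2 p' (by omega) hzΩ hw1Ω hzw hzΩ ((hmΩ w).1 hw.2)
      (Ne.symm hw.1)
    rw [← Finset.card_image_of_injective _ g.injective]
    apply Finset.card_le_card
    intro x hx
    obtain ⟨u, hu, rfl⟩ := Finset.mem_image.1 hx
    rw [Finset.mem_filter] at hu
    have hup := (hmΩ u).1 hu.1
    rw [Finset.mem_filter, Finset.mem_erase]
    have h1 := hSe g hg hgp u hup _ _ hu.2
    rw [hgz, hgw] at h1
    refine ⟨⟨fun hc => ?_, (hmΩ _).2 fun hc => ?_⟩, h1⟩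
    · rw [hc] at h1
      exact hw.1 (hSx z w hzΩ h1)
    · have h1 := hgp _ hc
      rw [g.injective h1] at hc; exact hup hc
  have hdc := Finset.sum_card_bipartiteAbove_eq_sum_card_bipartiteBelow (s := Ω'.erase z)
    (t := Ω'.erase z) (fun w x => S x z w)
  have hl : (Ω'.erase z).card * (q * q - (k - 1) - q) ≤
      ∑ a ∈ Ω'.erase z, (Finset.bipartiteAbove (fun w x => S x z w) (Ω'.erase z) a).card := by
    rw [← smul_eq_mul]
    apply Finset.card_nsmul_le_sum
    intro w hw
    exact hΛ w hw
  have hr : ∑ b ∈ Ω'.erase z, (Finset.bipartiteBelow (fun w x => S x z w) (Ω'.erase z) b).card ≤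
      (Ω'.erase z).card * (s - 1) := by
    rw [← smul_eq_mul]
    apply Finset.sum_le_card_nsmul
    intro x hx
    rw [Finset.mem_erase, hmΩ] at hx
    rw [← hDc x z hx.2 hzΩ (Ne.symm hx.1), ← Finset.card_erase_of_mem ((hD x z z).2 (hSr x z))]
    apply Finset.card_le_card
    intro w hw
    rw [Finset.mem_bipartiteBelow, Finset.mem_erase] at hw
    rw [Finset.mem_erase, hD]
    exact ⟨hw.1.1, hw.2⟩
  have hfin := hl.trans (hdc.le.trans hr)
  have hpos : 0 < (Ω'.erase z).card := by
    rw [Finset.card_erase_of_mem ((hmΩ z).2 hzΩ), hΩc]; omega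
  have := Nat.le_of_mul_le_mul_left hfin hpos
  omega

end large
end S17

open Equiv

namespace S17
section prim
variable {F : Type*} [Field F] [Fintype F] [DecidableEq F]
variable {H : Subgroup (Perm (F × F))}

theorem shear_move (hH : Good H) (p : Finset (F × F)) (hp : p ⊆ line 0) (x y v : F × F)
    (hx : x.2 ≠ 0) (hxy : x.2 = y.2) (hv : v.2 ≠ x.2) :
    ∃ g ∈ H, (∀ u ∈ p, g u = u) ∧ g x = y ∧ g v = v := by
  refine ⟨X (fun b => ((y.1 - x.1) / (x.2 * (x.2 - v.2))) * (b * (b - v.2))), hH.quad0 _ _, ?_, ?_, ?_⟩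
  · intro u hu
    have := hp hu
    rw [mem_line] at this
    exact X_fix (by simp [this])
  · rw [X_apply]
    rw [div_mul_cancel₀ _ (mul_ne_zero hx (sub_ne_zero.2 (Ne.symm hv)))]
    ext <;> simp [hxy]
  · exact X_fix (by simp)

theorem low_empty (hH : Good H) {k : ℕ} (hk : 1 ≤ k) (hkq : k + 2 ≤ Fintype.card F)
    (ht : HT H (k + 1)) (hq : 5 ≤ Fintype.card F) (hodd : Odd (Fintype.card F))
    (p : Finset (F × F)) (hp : p ⊆ line 0) (hpk : p.card = k)
    (E : F × F → F × F → Prop) (hEp : ∀ z w, E z w → z ∉ p ∧ w ∉ p ∧ z ≠ w)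
    (hE : ∀ g ∈ H, (∀ u ∈ p, g u = u) → ∀ x y, E x y → E (g x) (g y))
    (hout : ∀ z, ∀ B : Finset (F × F), (∀ w ∈ B, E z w) → B.card < Fintype.card F)
    (hin : ∀ w, ∀ B : Finset (F × F), (∀ z ∈ B, E z w) → B.card < Fintype.card F)
    (z w : F × F) : ¬ E z w := by
  have hline : ∀ z w, E z w → z.2 = w.2 := by
    intro z w h
    by_contra hne
    by_cases hw : w.2 = 0
    · have hz : z.2 ≠ 0 := fun h => hne (h.trans hw.symm)
      have := hin w (line z.2) (fun v hv => by
        rw [mem_line] at hv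
        obtain ⟨g, hg, hgp, h1, h2⟩ := shear_move hH p hp z v w hz hv.symm (Ne.symm hne)
        have := hE g hg hgp _ _ h
        rwa [h1, h2] at this)
      rw [card_line] at this
      exact lt_irrefl _ this
    · have := hout z (line w.2) (fun v hv => by
        rw [mem_line] at hv
        obtain ⟨g, hg, hgp, h1, h2⟩ := shear_move hH p hp w v z hw hv.symm hne
        have := hE g hg hgp _ _ h
        rwa [h1, h2] at this)
      rw [card_line] at this
      exact lt_irrefl _ this
  intro hzw
  have hnp : ∀ x y, Relation.EqvGen E x y → x = y ∨ (x ∉ p ∧ y ∉ p) := by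
    intro x y h
    induction h with
    | rel x y h => exact Or.inr ⟨(hEp _ _ h).1, (hEp _ _ h).2.1⟩
    | refl x => exact Or.inl rfl
    | symm x y _ ih => rcases ih with h | h
                       · exact Or.inl h.symm
                       · exact Or.inr ⟨h.2, h.1⟩
    | trans x y z _ _ ih1 ih2 => grind
  have := small_case hH hk hkq ht hq hodd p hp hpk (Relation.EqvGen E)
    (Relation.EqvGen.is_equivalence E) (fun x hx y h => by
      rcases hnp x y h with h | h
      · exact h.symm
      · exact absurd hx h.1) (by
      intro g hg hgp x y h
      induction h with
      | rel x y h => exact Relation.EqvGen.rel _ _ (hE g hg hgp _ _ h)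
      | refl x => exact Relation.EqvGen.refl _
      | symm x y _ ih => exact Relation.EqvGen.symm _ _ ih
      | trans x y z _ _ ih1 ih2 => exact Relation.EqvGen.trans _ _ _ ih1 ih2) (by
      intro x y h
      induction h with
      | rel x y h => exact hline _ _ h
      | refl x => rfl
      | symm x y _ ih => exact ih.symm
      | trans x y z _ _ ih1 ih2 => exact ih1.trans ih2) z w (Relation.EqvGen.rel _ _ hzw)
  exact (hEp _ _ hzw).2.2 this

theorem D_complete (hH : Good H) {k : ℕ} (hk : 1 ≤ k) (hkq : k + 2 ≤ Fintype.card F)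
    (ht : HT H (k + 1)) (hq : 5 ≤ Fintype.card F)
    (p : Finset (F × F)) (hp : p ⊆ line 0) (hpk : p.card = k) (z w : F × F) (hz : z ∉ p)
    (hw : w ∉ p) : ∃ g ∈ H, (∀ u ∈ p, g u = u) ∧ (g z).2 = (g w).2 ∧ (g z).2 ≠ 0 := by
  let D : F × F → F × F → Prop := fun z w => ∃ g ∈ H, (∀ u ∈ p, g u = u) ∧ (g z).2 = (g w).2 ∧
    (g z).2 ≠ 0
  have hDs : ∀ g ∈ H, (∀ u ∈ p, g u = u) → ∀ x y, D (g x) (g y) → D x y := by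
    rintro g hg hgp x y ⟨h, hh, hhp, h1, h2⟩
    exact ⟨h * g, H.mul_mem hh hg, fun u hu => by rw [Perm.mul_apply, hgp u hu, hhp u hu], h1, h2⟩
  have hinvp : ∀ {g : Perm (F × F)}, (∀ u ∈ p, g u = u) → ∀ u ∈ p, g⁻¹ u = u := by
    intro g hgp u hu
    rw [Perm.inv_eq_iff_eq, hgp u hu]
  have hDs' : ∀ g ∈ H, (∀ u ∈ p, g u = u) → ∀ x y, D x y → D (g x) (g y) := by
    intro g hg hgp x y h
    apply hDs g⁻¹ (H.inv_mem hg) (hinvp hgp)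
    simpa using h
  have hrefl : ∀ z, z ∉ p → D z z := by
    intro z hz
    obtain ⟨g, hg, hgp, h1⟩ := ht.fix1 p (by omega) hz (y := (0, 1))
      (fun h => by have := hp h; simp at this)
    exact ⟨g, hg, hgp, rfl, by rw [h1]; simp⟩
  have hone : ∀ x y v : F × F, x.2 = y.2 → x.2 ≠ 0 → D x v → D y v := by
    intro x y v hxy hx hD
    by_cases hv : v.2 = x.2
    · exact ⟨1, H.one_mem, by simp, by simp [hv, hxy], by simpa [← hxy] using hx⟩
    · obtain ⟨g, hg, hgp, h1, h2⟩ := shear_move hH p hp x y v hx hxy hv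
      have := hDs' g hg hgp _ _ hD
      rwa [h1, h2] at this
  have key := large_case hH hk hkq ht hq p hp hpk
    (fun z w => z = w ∨ (z ∉ p ∧ w ∉ p ∧ ∀ v, D z v ↔ D w v))
    ⟨fun x => Or.inl rfl, fun h => by
      rcases h with h | h
      · exact Or.inl h.symm
      · exact Or.inr ⟨h.2.1, h.1, fun v => (h.2.2 v).symm⟩, fun h h' => by
      rcases h with rfl | h
      · exact h'
      · rcases h' with rfl | h'
        · exact Or.inr h
        · exact Or.inr ⟨h.1, h'.2.1, fun v => (h.2.2 v).trans (h'.2.2 v)⟩⟩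
    (by
      rintro x hx y (h | h)
      · exact h.symm
      · exact absurd hx h.1)
    (by
      rintro g hg hgp x y (h | h)
      · exact Or.inl (by rw [h])
      · have hn : ∀ x, x ∉ p → g x ∉ p := by
          intro x hx hc
          have h1 := hgp _ hc
          rw [g.injective h1] at hc; exact hx hc
        refine Or.inr ⟨hn _ h.1, hn _ h.2.1, fun v => ?_⟩
        have h1 := h.2.2 (g⁻¹ v)
        have e : g (g⁻¹ v) = v := by simp
        constructor
        · intro hD
          rw [← e]
          apply hDs' g hg hgp
          apply h1.1
          apply hDs g hg hgp
          rwa [e]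
        · intro hD
          rw [← e]
          apply hDs' g hg hgp
          apply h1.2
          apply hDs g hg hgp
          rwa [e])
    (by
      intro x y hxy hx
      refine Or.inr ⟨fun h => hx (by simpa using hp h), fun h => hx (by rw [hxy]; simpa using hp h),
        fun v => ⟨hone x y v hxy hx, hone y x v hxy.symm (hxy ▸ hx)⟩⟩) z w hz hw
  rcases key with rfl | h
  · exact hrefl z hz
  · exact (h.2.2 w).2 (hrefl w hw)

theorem orbital (hH : Good H) {k : ℕ} (hk : 1 ≤ k) (hkq : k + 2 ≤ Fintype.card F)
    (ht : HT H (k + 1)) (hq : 5 ≤ Fintype.card F) (hodd : Odd (Fintype.card F))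
    (p : Finset (F × F)) (hp : p ⊆ line 0) (hpk : p.card = k)
    (E : F × F → F × F → Prop) (hEp : ∀ z w, E z w → z ∉ p ∧ w ∉ p ∧ z ≠ w)
    (hE : ∀ g ∈ H, (∀ u ∈ p, g u = u) → ∀ x y, E x y → E (g x) (g y)) :
    (∀ z w, ¬ E z w) ∨ (∀ z w, z ∉ p → w ∉ p → z ≠ w → E z w) := by
  classical
  set q := Fintype.card F with hqd
  have hinvp : ∀ {g : Perm (F × F)}, (∀ u ∈ p, g u = u) → ∀ u ∈ p, g⁻¹ u = u := by
    intro g hgp u hu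
    rw [Perm.inv_eq_iff_eq, hgp u hu]
  have hE' : ∀ g ∈ H, (∀ u ∈ p, g u = u) → ∀ x y, E (g x) (g y) → E x y := by
    intro g hg hgp x y h
    have := hE g⁻¹ (H.inv_mem hg) (hinvp hgp) _ _ h
    simpa using this
  have hgn : ∀ {g : Perm (F × F)}, (∀ u ∈ p, g u = u) → ∀ x, x ∉ p → g x ∉ p := by
    intro g hgp x hx hc
    have h1 := hgp _ hc
    rw [g.injective h1] at hc; exact hx hc
  let O : F × F → Finset (F × F) := fun z => Finset.univ.filter (E z)
  let I : F × F → Finset (F × F) := fun w => Finset.univ.filter (fun z => E z w)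
  have hO : ∀ z w, w ∈ O z ↔ E z w := fun z w => by simp [O]
  have hI : ∀ z w, z ∈ I w ↔ E z w := fun z w => by simp [I]
  set Δ : Finset (F × F) := Finset.univ \ p with hΔ
  have hmΔ : ∀ z, z ∈ Δ ↔ z ∉ p := fun z => by simp [hΔ]
  have hΔc : Δ.card = q * q - k := by
    rw [hΔ, Finset.card_sdiff_of_subset (Finset.subset_univ _), card_plane, hpk]
  set n := Δ.card with hn
  let z0 : F × F := (0, 1)
  have hz0 : z0 ∉ p := fun h => by have := hp h; simp [z0] at this
  have hOi : ∀ {g : Perm (F × F)}, g ∈ H → (∀ u ∈ p, g u = u) → ∀ z, O (g z) = (O z).image g := by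
    intro g hg hgp z
    ext w
    rw [hO, Finset.mem_image]
    constructor
    · intro h
      refine ⟨g⁻¹ w, (hO _ _).2 (hE' g hg hgp _ _ (by simpa using h)), by simp⟩
    · rintro ⟨v, hv, rfl⟩
      exact hE g hg hgp _ _ ((hO _ _).1 hv)
  have hIi : ∀ {g : Perm (F × F)}, g ∈ H → (∀ u ∈ p, g u = u) → ∀ z, I (g z) = (I z).image g := by
    intro g hg hgp z
    ext w
    rw [hI, Finset.mem_image]
    constructor
    · intro h
      refine ⟨g⁻¹ w, (hI _ _).2 (hE' g hg hgp _ _ (by simpa using h)), by simp⟩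
    · rintro ⟨v, hv, rfl⟩
      exact hE g hg hgp _ _ ((hI _ _).1 hv)
  set κ := (O z0).card with hκ
  have hOc : ∀ z, z ∉ p → (O z).card = κ := by
    intro z hz
    obtain ⟨g, hg, hgp, h1⟩ := ht.fix1 p (by omega) hz0 hz
    rw [← h1, hOi hg hgp, Finset.card_image_of_injective _ g.injective]
  have hIc' : ∀ z, z ∉ p → (I z).card = (I z0).card := by
    intro z hz
    obtain ⟨g, hg, hgp, h1⟩ := ht.fix1 p (by omega) hz0 hz
    rw [← h1, hIi hg hgp, Finset.card_image_of_injective _ g.injective]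
  have hqq : q * 5 ≤ q * q := Nat.mul_le_mul le_rfl hq
  have hnpos : 0 < n := by omega
  have hOsub : ∀ z, O z ⊆ Δ := fun z w hw => (hmΔ w).2 (hEp _ _ ((hO _ _).1 hw)).2.1
  have hIsub : ∀ z, I z ⊆ Δ := fun z w hw => (hmΔ w).2 (hEp _ _ ((hI _ _).1 hw)).1
  have hIκ : (I z0).card = κ := by
    have hdc := Finset.sum_card_bipartiteAbove_eq_sum_card_bipartiteBelow (s := Δ) (t := Δ) E
    rw [Finset.sum_congr rfl (g := fun _ => κ), Finset.sum_congr (s₁ := Δ) (s₂ := Δ) rfl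
      (f := fun b => (Finset.bipartiteBelow E Δ b).card)
      (g := fun _ => (I z0).card), Finset.sum_const, Finset.sum_const, smul_eq_mul, smul_eq_mul] at hdc
    · exact (Nat.eq_of_mul_eq_mul_left hnpos hdc).symm
    · intro z hz
      rw [← hIc' z ((hmΔ z).1 hz)]
      congr 1
      ext w
      rw [Finset.mem_bipartiteBelow, hI]
      exact ⟨fun h => h.2, fun h => ⟨hIsub z ((hI _ _).2 h), h⟩⟩
    · intro z hz
      rw [← hOc z ((hmΔ z).1 hz)]
      congr 1
      ext w
      rw [Finset.mem_bipartiteAbove, hO]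
      exact ⟨fun h => h.2, fun h => ⟨hOsub z ((hO _ _).2 h), h⟩⟩
  have hIc : ∀ z, z ∉ p → (I z).card = κ := fun z hz => (hIc' z hz).trans hIκ
  have hin1 : ∀ x y v : F × F, x.2 = y.2 → x.2 ≠ 0 → v.2 ≠ x.2 → E x v → E y v := by
    intro x y v hxy hx hv h
    obtain ⟨g, hg, hgp, h1, h2⟩ := shear_move hH p hp x y v hx hxy hv
    have := hE g hg hgp _ _ h
    rwa [h1, h2] at this
  have hdiff1 : ∀ x y : F × F, x.2 = y.2 → x.2 ≠ 0 → 2 * (O x \ O y).card ≤ q := by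
    intro x y hxy hx
    have hxp : x ∉ p := fun h => hx (by simpa using hp h)
    have hyp : y ∉ p := fun h => hx (by rw [hxy]; simpa using hp h)
    have h1 : (O x \ O y) ∪ (O y \ O x) ⊆ line x.2 := by
      intro v hv
      rw [mem_line]
      by_contra hne
      rw [Finset.mem_union, Finset.mem_sdiff, Finset.mem_sdiff, hO, hO] at hv
      rcases hv with hv | hv
      · exact hv.2 (hin1 x y v hxy hx hne hv.1)
      · exact hv.2 (hin1 y x v hxy.symm (hxy ▸ hx) (hxy ▸ hne) hv.1)
    have h2 := Finset.card_le_card h1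
    rw [card_line, Finset.card_union_of_disjoint, Finset.card_sdiff_comm
      ((hOc y hyp).trans (hOc x hxp).symm)] at h2
    · omega
    · rw [Finset.disjoint_left]
      intro v hv hv'
      exact (Finset.mem_sdiff.1 hv).2 (Finset.mem_sdiff.1 hv').1
  have hdiff : ∀ x y : F × F, x ∉ p → y ∉ p → 2 * (O x \ O y).card ≤ q := by
    intro x y hx hy
    obtain ⟨g, hg, hgp, h1, h2⟩ := D_complete hH hk hkq ht hq p hp hpk x y hx hy
    have := hdiff1 (g x) (g y) h1 h2
    rwa [hOi hg hgp, hOi hg hgp, ← Finset.image_sdiff _ _ g.injective,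
      Finset.card_image_of_injective _ g.injective] at this
  have hcount : 2 * (κ * (n - κ)) ≤ (n - 1) * q := by
    have hdc := Finset.sum_card_bipartiteAbove_eq_sum_card_bipartiteBelow (s := O z0) (t := Δ)
      (fun y w => ¬ E w y)
    have e1 : ∑ a ∈ O z0, (Finset.bipartiteAbove (fun y w => ¬ E w y) Δ a).card = κ * (n - κ) := by
      rw [Finset.sum_congr rfl (g := fun _ => n - κ), Finset.sum_const, smul_eq_mul]
      intro y hy
      have hyp := (hmΔ y).1 (hOsub _ hy)
      rw [← hIc y hyp, hn, ← Finset.card_sdiff_of_subset (hIsub y)]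
      congr 1
      ext w
      rw [Finset.mem_bipartiteAbove, Finset.mem_sdiff (s := Δ), hI]
    have e2 : ∑ b ∈ Δ, (Finset.bipartiteBelow (fun y w => ¬ E w y) (O z0) b).card =
        ∑ b ∈ Δ.erase z0, (O z0 \ O b).card := by
      rw [← Finset.add_sum_erase _ _ ((hmΔ z0).2 hz0)]
      have e3 : (Finset.bipartiteBelow (fun y w => ¬ E w y) (O z0) z0).card = 0 := by
        rw [Finset.card_eq_zero, Finset.eq_empty_iff_forall_notMem]
        intro v hv
        rw [Finset.mem_bipartiteBelow, hO] at hv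
        exact hv.2 hv.1
      rw [e3, zero_add]
      apply Finset.sum_congr rfl
      intro b _
      congr 1
      ext w
      rw [Finset.mem_bipartiteBelow, Finset.mem_sdiff (s := O z0), hO b]
    rw [← e1, hdc, e2, Finset.mul_sum]
    have := Finset.sum_le_card_nsmul (Δ.erase z0) (fun b => 2 * (O z0 \ O b).card) q (by
      intro b hb
      exact hdiff z0 b hz0 ((hmΔ b).1 (Finset.mem_of_mem_erase hb)))
    rwa [Finset.card_erase_of_mem ((hmΔ z0).2 hz0), smul_eq_mul] at this
  have hκn : κ ≤ n := Finset.card_le_card (hOsub z0)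
  by_cases hlow : κ < q
  · left
    apply low_empty hH hk hkq ht hq hodd p hp hpk E hEp hE
    · intro z B hB
      by_cases hz : z ∈ p
      · have : B = ∅ := by
          rw [Finset.eq_empty_iff_forall_notMem]
          intro w hw; exact (hEp _ _ (hB w hw)).1 hz
        rw [this, Finset.card_empty]; omega
      · refine lt_of_le_of_lt (Finset.card_le_card fun w hw => (hO _ _).2 (hB w hw)) ?_
        rw [hOc z hz]; exact hlow
    · intro z B hB
      by_cases hz : z ∈ p
      · have : B = ∅ := by
          rw [Finset.eq_empty_iff_forall_notMem]
          intro w hw; exact (hEp _ _ (hB w hw)).2.1 hz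
        rw [this, Finset.card_empty]; omega
      · refine lt_of_le_of_lt (Finset.card_le_card fun w hw => (hI _ _).2 (hB w hw)) ?_
        rw [hIc z hz]; exact hlow
  · right
    have hhigh : n - κ < q := by
      by_contra hcon
      push Not at hlow hcon
      obtain ⟨i, hi⟩ : ∃ i, κ = q + i := ⟨κ - q, by omega⟩
      obtain ⟨j, hj⟩ : ∃ j, n - κ = q + j := ⟨n - κ - q, by omega⟩
      have hnij : n = q + i + (q + j) := by omega
      rw [hj, hi] at hcount
      have h1 : n - 1 + 1 = n := by omega
      have h2 : (n - 1) * q + q = (q + i + (q + j)) * q := by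
        rw [← hnij]; nth_rewrite 2 [← h1]; ring
      nlinarith [Nat.zero_le (i * j), Nat.zero_le (i * q), Nat.zero_le (j * q)]
    intro z w hz hw hzw
    by_contra hnE
    refine low_empty hH hk hkq ht hq hodd p hp hpk
      (fun z w => z ∉ p ∧ w ∉ p ∧ z ≠ w ∧ ¬ E z w) (fun z w h => ⟨h.1, h.2.1, h.2.2.1⟩)
      (fun g hg hgp x y h => ⟨hgn hgp _ h.1, hgn hgp _ h.2.1, fun hc => h.2.2.1 (g.injective hc),
        fun hc => h.2.2.2 (hE' g hg hgp _ _ hc)⟩) ?_ ?_ z w ⟨hz, hw, hzw, hnE⟩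
    · intro z B hB
      by_cases hz : z ∈ p
      · have : B = ∅ := by
          rw [Finset.eq_empty_iff_forall_notMem]
          intro w hw; exact (hB w hw).1 hz
        rw [this, Finset.card_empty]; omega
      · have h1 : B ⊆ Δ \ O z := fun w hw => Finset.mem_sdiff.2
          ⟨(hmΔ w).2 (hB w hw).2.1, fun h => (hB w hw).2.2.2 ((hO _ _).1 h)⟩
        have := Finset.card_le_card h1
        rw [Finset.card_sdiff_of_subset (hOsub z), hOc z hz] at this
        omega
    · intro z B hB
      by_cases hz : z ∈ p
      · have : B = ∅ := by
          rw [Finset.eq_empty_iff_forall_notMem]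
          intro w hw; exact (hB w hw).2.1 hz
        rw [this, Finset.card_empty]; omega
      · have h1 : B ⊆ Δ \ I z := fun w hw => Finset.mem_sdiff.2
          ⟨(hmΔ w).2 (hB w hw).1, fun h => (hB w hw).2.2.2 ((hI _ _).1 h)⟩
        have := Finset.card_le_card h1
        rw [Finset.card_sdiff_of_subset (hIsub z), hIc z hz] at this
        omega

theorem HT_succ (hH : Good H) {k : ℕ} (hk : 1 ≤ k) (hkq : k + 2 ≤ Fintype.card F)
    (ht : HT H (k + 1)) (hq : 5 ≤ Fintype.card F) (hodd : Odd (Fintype.card F)) :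
    HT H (k + 2) := by
  obtain ⟨p, hp, hpk⟩ := Finset.exists_subset_card_eq (s := line (0 : F)) (n := k)
    (by rw [card_line]; omega)
  refine ht.step p hpk ?_
  intro x y x' y' hx hy hxy hx' hy' hxy'
  have := orbital hH hk hkq ht hq hodd p hp hpk
    (fun z w => ∃ g ∈ H, (∀ u ∈ p, g u = u) ∧ g x = z ∧ g y = w) ?_ ?_
  · rcases this with h | h
    · exact absurd ⟨1, H.one_mem, by simp, rfl, rfl⟩ (h x y)
    · exact h x' y' hx' hy' hxy'
  · rintro z w ⟨g, hg, hgp, rfl, rfl⟩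
    have hgn : ∀ x, x ∉ p → g x ∉ p := by
      intro x hx hc
      have h1 := hgp _ hc
      rw [g.injective h1] at hc; exact hx hc
    exact ⟨hgn x hx, hgn y hy, fun h => hxy (g.injective h)⟩
  · rintro h hh hhp z w ⟨g, hg, hgp, rfl, rfl⟩
    exact ⟨h * g, H.mul_mem hh hg, fun u hu => by rw [Perm.mul_apply, hgp u hu, hhp u hu], rfl, rfl⟩

theorem HT_q (hH : Good H) (hq : 5 ≤ Fintype.card F) (hodd : Odd (Fintype.card F)) :
    HT H (Fintype.card F) := by
  have : ∀ k, k + 2 ≤ Fintype.card F → HT H (k + 2) := by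
    intro k
    induction k with
    | zero => intro _; exact hH.ht2
    | succ k ih => intro h; exact HT_succ hH (by omega) h (ih (by omega)) hq hodd
  have h := this (Fintype.card F - 2) (by omega)
  rwa [show Fintype.card F - 2 + 2 = Fintype.card F by omega] at h

end prim
end S17

namespace S17
open Equiv
open Polynomial in
lemma cyc_not_sq (n p : ℕ) (hn : 4 ≤ n) (hp : p.Prime) (hpn : p ∣ n) (hp3 : p ≠ 3) (m : ℕ) (hm : ¬ p ∣ m) (e : ℕ)
    (hnm : n = p ^ e * m) (hord : IsPrimitiveRoot (3 : ZMod p) m) :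
    ¬ ((p:ℤ)^2 ∣ (cyclotomic n ℤ).eval 3) := by
  intro hdv
  haveI := Fact.mk hp
  have he : e ≠ 0 := by rintro rfl; simp at hnm; exact hm (hnm ▸ hpn)
  obtain ⟨e, rfl⟩ := Nat.exists_eq_succ_of_ne_zero he
  set d := p ^ e * m with hd
  have hnd : n = d * p := by rw [hnm, hd, pow_succ]; ring
  have hmem : d ∈ n.properDivisors := by
    rw [Nat.mem_properDivisors]
    refine ⟨⟨p, hnd⟩, ?_⟩
    have := hp.two_le
    have : d ≠ 0 := by rintro h; rw [h] at hnd; omega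
    nlinarith [Nat.pos_of_ne_zero this]
  have hdvd := Polynomial.X_pow_sub_one_mul_cyclotomic_dvd_X_pow_sub_one_of_dvd ℤ hmem
  have h2 : ((3:ℤ)^d - 1) * (cyclotomic n ℤ).eval 3 ∣ 3^n - 1 := by
    have := (Polynomial.evalRingHom (3:ℤ)).map_dvd hdvd
    simpa using this
  set y : ℤ := 3^d with hy
  have hyn : (3:ℤ)^n = y^p := by rw [hnd, pow_mul]
  rw [hyn] at h2
  have hy1 : y - 1 ≠ 0 := by
    have : (1:ℤ) < 3^d := one_lt_pow₀ (by norm_num) (by rintro h; rw [h] at hnd; omega)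
    omega
  have hpy : (p:ℤ) ∣ y - 1 := by
    rw [← ZMod.intCast_zmod_eq_zero_iff_dvd]
    have : (3 : ZMod p)^d = 1 := by rw [hd, mul_comm, pow_mul, hord.pow_eq_one, one_pow]
    rw [hy]; push_cast; rw [this]; simp
  have hpny : ¬ (p:ℤ) ∣ y := by
    intro h
    have h1 : (p:ℤ) ∣ 1 := by simpa using dvd_sub h hpy
    exact hp.one_lt.ne' (by exact_mod_cast Int.eq_one_of_dvd_one (by positivity) h1)
  rcases hp.eq_two_or_odd' with rfl | hodd
  · have h3 : (cyclotomic n ℤ).eval 3 ∣ y + 1 := by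
      have : y^2-1 = (y-1)*(y+1) := by ring
      rw [this] at h2
      exact (mul_dvd_mul_iff_left hy1).1 h2
    have h4 : (4:ℤ) ∣ y + 1 := by
      have := hdv.trans h3; norm_num at this; exact this
    have hm1 : m = 1 := by
      have h31 : (3 : ZMod 2) = 1 := rfl
      rw [h31] at hord
      exact IsPrimitiveRoot.unique hord (IsPrimitiveRoot.one)
    have hdd : Even d := by
      rw [hd, hm1]
      have : e ≠ 0 := by rintro rfl; simp [hm1] at hnm; omega
      simp [Nat.even_pow, this]
    obtain ⟨k, hk⟩ := hdd
    have : y = 9^k := by rw [hy, hk, ← two_mul, pow_mul]; norm_num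
    have h5 : (9:ℤ)^k ≡ 1 [ZMOD 4] := by
      have := (show (9:ℤ) ≡ 1 [ZMOD 4] by decide).pow k
      simpa using this
    rw [this] at h4
    have := h5.dvd
    omega
  · have hem := Int.emultiplicity_pow_sub_pow hp hodd (x := y) (y := 1) (by simpa using hpy) hpny p
    rw [one_pow] at hem
    have h3 := emultiplicity_le_emultiplicity_of_dvd_right (a := (p:ℤ)) h2
    rw [emultiplicity_mul (Nat.prime_iff_prime_int.1 hp), hem] at h3
    have hf : FiniteMultiplicity (p:ℤ) (y-1) := by
      rw [Int.finiteMultiplicity_iff]; refine ⟨?_, hy1⟩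
      simpa using hp.one_lt.ne'
    have h4 : (2:ℕ∞) ≤ emultiplicity (p:ℤ) (eval 3 (cyclotomic n ℤ)) := by
      exact_mod_cast le_emultiplicity_of_pow_dvd hdv
    have h5 : emultiplicity p p = 1 := by
      have hfp : FiniteMultiplicity p p := Nat.finiteMultiplicity_iff.2 ⟨hp.one_lt.ne', hp.pos⟩
      exact hfp.emultiplicity_self
    rw [h5, hf.emultiplicity_eq_multiplicity] at h3
    have h6 : ((multiplicity (p:ℤ) (y-1) : ℕ) : ℕ∞) + 2 ≤ (multiplicity (p:ℤ) (y-1) : ℕ) + 1 := le_trans (by gcongr) h3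
    norm_cast at h6
    omega

open Polynomial in
lemma zsig (n : ℕ) (hn : 4 ≤ n) : ∃ s : ℕ, s.Prime ∧ orderOf (3 : ZMod s) = n := by
  by_contra! hcon
  set N := ((cyclotomic n ℤ).eval 3).natAbs with hN
  have hbig := sub_one_pow_totient_lt_natAbs_cyclotomic_eval (n := n) (q := 3) (by omega) (by norm_num)
  have hbig' : 2 ^ n.totient < N := by simpa using hbig
  have hroot : ∀ p : ℕ, p.Prime → p ∣ N → (cyclotomic n (ZMod p)).IsRoot 3 := by
    intro p hp hd
    have hd' : (p:ℤ) ∣ (cyclotomic n ℤ).eval 3 := Int.natCast_dvd.2 hd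
    rw [← ZMod.intCast_zmod_eq_zero_iff_dvd] at hd'
    rw [IsRoot.def, ← map_cyclotomic_int]
    have := eval_intCast_map (Int.castRingHom (ZMod p)) (cyclotomic n ℤ) 3
    simp at this ⊢
    rw [this, hd']
  have key : ∀ p : ℕ, p.Prime → p ∣ N → p ∣ n ∧ p ≠ 3 ∧ ∃ e m, ¬ p ∣ m ∧ n = p^e*m ∧ IsPrimitiveRoot (3 : ZMod p) m := by
    intro p hp hd
    haveI := Fact.mk hp
    have hr := hroot p hp hd
    obtain ⟨e, m, hm, hnm⟩ := Nat.exists_eq_pow_mul_and_not_dvd (n := n) (by omega) p hp.one_lt.ne'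
    have hr' := hr
    haveI : NeZero (m : ZMod p) := NeZero.of_not_dvd (ZMod p) hm
    rw [hnm, isRoot_cyclotomic_prime_pow_mul_iff_of_charP] at hr'
    have hpn : p ∣ n := by
      by_contra hpn
      haveI : NeZero (n : ZMod p) := NeZero.of_not_dvd (ZMod p) hpn
      exact hcon p hp ((isRoot_cyclotomic_iff.1 hr).eq_orderOf).symm
    refine ⟨hpn, ?_, e, m, hm, hnm, hr'⟩
    rintro rfl
    have h30 : (3 : ZMod 3) = 0 := rfl
    have := hr'.pow_eq_one
    rw [h30, zero_pow] at this
    · exact absurd this zero_ne_one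
    · rintro rfl; simp at hm
  have hlt : ∀ p p' : ℕ, p.Prime → p ∣ N → p'.Prime → p' ∣ N → p' ≠ p → p' < p := by
    intro p p' hp hd hp' hd' hne
    haveI := Fact.mk hp
    obtain ⟨h1, h3, e, m, hm, hnm, hr⟩ := key p hp hd
    obtain ⟨h1', -⟩ := key p' hp' hd'
    have : p' ∣ m := by
      rw [hnm] at h1'
      rcases (Nat.Prime.dvd_mul hp').1 h1' with h | h
      · exact absurd ((Nat.prime_dvd_prime_iff_eq hp' hp).1 (hp'.dvd_of_dvd_pow h)) hne
      · exact h
    have hm' : m ∣ p - 1 := by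
      rw [hr.eq_orderOf]
      apply ZMod.orderOf_dvd_card_sub_one
      intro h
      have := (ZMod.natCast_eq_zero_iff 3 p).1 (by exact_mod_cast h)
      exact h3 ((Nat.prime_dvd_prime_iff_eq hp Nat.prime_three).1 this)
    have := Nat.le_of_dvd (by have := hp.two_le; omega) (this.trans hm')
    have := hp.two_le; omega
  have hN1 : N ≠ 1 := by have := Nat.one_le_two_pow (n := n.totient); omega
  obtain ⟨p, hp, hd⟩ := Nat.exists_prime_and_dvd hN1
  obtain ⟨h1, h3, e, m, hm, hnm, hr⟩ := key p hp hd
  have hpow := Nat.eq_prime_pow_of_unique_prime_dvd (n := N) (p := p) (Nat.ne_of_gt (lt_of_le_of_lt (Nat.zero_le _) hbig')) (by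
    intro d hd1 hd2
    by_contra hne
    have a := hlt p d hp hd hd1 hd2 hne
    have b := hlt d p hd1 hd2 hp hd (Ne.symm hne)
    omega)
  have hns := cyc_not_sq n p hn hp h1 h3 m hm e hnm hr
  have hNp : N ≤ p := by
    by_contra hgt
    apply hns
    have : p^2 ∣ N := by
      rw [hpow]
      apply pow_dvd_pow
      by_contra hlt
      apply hgt
      rw [hpow]
      calc _ ≤ p^1 := Nat.pow_le_pow_right hp.pos (by omega)
        _ = p := pow_one p
    rw [← Nat.cast_pow]
    exact Int.natCast_dvd.2 this
  have ht : p - 1 ≤ n.totient := by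
    rw [← Nat.totient_prime hp]
    exact Nat.le_of_dvd (Nat.totient_pos.2 (by omega)) (Nat.totient_dvd_of_dvd h1)
  have : p ≤ 2^(p-1) := by
    have := Nat.lt_two_pow_self (n := p-1); omega
  have := Nat.pow_le_pow_right (show 0 < 2 by norm_num) ht
  omega

/-- consequences -/
lemma zsig' (r : ℕ) (hr : 2 ≤ r) : ∃ s : ℕ, s.Prime ∧ 5 ≤ s ∧ s ≤ 3 ^ r ∧ Odd s ∧
    (∀ i j : ℕ, i ≤ j → j < 2 * r → 3 ^ i ≡ 3 ^ j [MOD s] → i = j) := by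
  obtain ⟨s, hs, ho⟩ := zsig (2*r) (by omega)
  haveI := Fact.mk hs
  have h30 : (3 : ZMod s) ≠ 0 := by
    intro h; rw [h] at ho
    have : orderOf (0 : ZMod s) = 0 := by
      rw [orderOf_eq_zero_iff']; intro n hn; rw [zero_pow hn.ne']; exact zero_ne_one
    omega
  have hd : 2*r ∣ s - 1 := ho ▸ ZMod.orderOf_dvd_card_sub_one h30
  have h5 : 5 ≤ s := by
    have := Nat.le_of_dvd (by have := hs.two_le; omega) hd; omega
  have hodd : Odd s := hs.odd_of_ne_two (by omega)
  have hsd : s ∣ 3^r + 1 := by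
    have h1 : (3:ZMod s)^(2*r) = 1 := by rw [← ho]; exact pow_orderOf_eq_one _
    have h2 : ((3:ZMod s)^r - 1) * ((3:ZMod s)^r + 1) = 0 := by
      have : ((3:ZMod s)^r - 1) * ((3:ZMod s)^r + 1) = 3^(2*r) - 1 := by rw [two_mul, pow_add]; ring
      rw [this, h1, sub_self]
    rcases mul_eq_zero.1 h2 with h | h
    · have := orderOf_dvd_of_pow_eq_one (sub_eq_zero.1 h)
      rw [ho] at this
      have := Nat.le_of_dvd (by omega) this
      omega
    · rw [← ZMod.natCast_eq_zero_iff]; push_cast; exact h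
  refine ⟨s, hs, h5, ?_, hodd, ?_⟩
  · have hle := Nat.le_of_dvd (by positivity) hsd
    rcases hle.lt_or_eq with h | h
    · omega
    · exfalso
      have : Even (3^r+1) := by
        have : Odd (3^r) := Odd.pow (by decide)
        exact this.add_one
      rw [← h] at this
      exact (Nat.not_even_iff_odd.2 hodd) this
  · intro i j hij hj hmod
    have h1 : (3:ZMod s)^i = 3^j := by
      have := (ZMod.natCast_eq_natCast_iff _ _ _).2 hmod
      exact_mod_cast this
    obtain ⟨k, rfl⟩ := Nat.exists_eq_add_of_le hij
    rw [pow_add] at h1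
    have h2 : (3:ZMod s)^k = 1 := by
      have : (3:ZMod s)^i ≠ 0 := pow_ne_zero _ h30
      exact (mul_left_cancel₀ this (by rw [mul_one]; exact h1)).symm
    have := orderOf_dvd_of_pow_eq_one h2
    rw [ho] at this
    rcases Nat.eq_zero_or_pos k with rfl | hk
    · rfl
    · have := Nat.le_of_dvd hk this; omega
end S17

namespace S17
open Equiv

lemma End_pow_apply {β : Type*} (f : Function.End β) (k : ℕ) (x : β) : (f ^ k) x = (f : β → β)^[k] x := by
  induction k generalizing x with
  | zero => rfl
  | succ k ih => rw [pow_succ]; exact ih (f x)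

lemma card_fix_mod {β : Type*} [Fintype β] [DecidableEq β] (f : β → β) (s a : ℕ) (hs : s.Prime)
    (hf : f^[s ^ a] = id) : Fintype.card β ≡ Fintype.card {y // f y = y} [MOD s] := by
  haveI := Fact.mk hs
  let f' : Function.End β := f
  have h := Equiv.Perm.card_fixedPoints_modEq (f := f') (p := s) (n := a) (by
    funext x
    have := End_pow_apply f' (s ^ a) x
    rw [this]
    exact congrFun hf x)
  refine h.trans ?_
  exact congrArg (· % s) (Fintype.card_congr (Equiv.refl _ : Function.fixedPoints f' ≃ {y // f y = y}))

lemma exists_fixed_mod {β : Type*} [Fintype β] (f : β → β) (s a n : ℕ) (hs : s.Prime)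
    (hs3 : s ≠ 3) (hf : f^[s ^ a] = id) (hc : Fintype.card β = 3 ^ n) : ∃ y, f y = y := by
  classical
  have h := card_fix_mod f s a hs hf
  by_contra! hcon
  have h0 : Fintype.card {y // f y = y} = 0 := by
    rw [Fintype.card_eq_zero_iff]
    exact ⟨fun y => hcon y.1 y.2⟩
  rw [h0, hc] at h
  have h2 := (Nat.modEq_zero_iff_dvd.1 h)
  exact hs3 ((Nat.prime_dvd_prime_iff_eq hs Nat.prime_three).1 (hs.dvd_of_dvd_pow h2))

lemma fix_orbit {α : Type*} [Fintype α] [DecidableEq α] (P : Subgroup (Perm α)) (hP : IsPGroup 3 P)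
    (g : Perm α) (s a : ℕ) (hs : s.Prime) (hs3 : s ≠ 3) (hg : g ^ (s ^ a) = 1)
    (hn : ∀ p ∈ P, g * p * g⁻¹ ∈ P) (x : α)
    (hgx : ∀ y ∈ MulAction.orbit P x, g y ∈ MulAction.orbit P x)
    (hZ : ∀ i j, i ≤ j → 3 ^ j ≤ Nat.card (MulAction.orbit P x) → 3 ^ i ≡ 3 ^ j [MOD s] → i = j) :
    g x = x := by
  classical
  haveI := Fact.mk hs
  haveI : Fact (Nat.Prime 3) := ⟨Nat.prime_three⟩
  obtain ⟨j, hj⟩ := hP.card_orbit x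
  set O := MulAction.orbit P x with hO
  let f : O → O := fun y => ⟨g y.1, hgx y.1 y.2⟩
  have hfk : ∀ k (y : O), ((f^[k] y : O) : α) = (g ^ k) y.1 := by
    intro k; induction k with
    | zero => intro y; rfl
    | succ k ih => intro y; rw [Function.iterate_succ_apply, ih, pow_succ]; rfl
  have hf : f^[s ^ a] = id := by
    funext y; apply Subtype.ext; rw [hfk, hg]; rfl
  have hcO : Fintype.card O = 3 ^ j := by rw [← hj, Nat.card_eq_fintype_card]
  obtain ⟨o, ho⟩ := exists_fixed_mod f s a j hs hs3 hf hcO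
  have ho' : g o.1 = o.1 := congrArg Subtype.val ho
  have horb : MulAction.orbit P o.1 = O := MulAction.orbit_eq_iff.2 o.2
  -- centralizer
  let C : Subgroup (Perm α) := P ⊓ Subgroup.centralizer {g}
  have hC : IsPGroup 3 C := hP.to_le inf_le_left
  obtain ⟨i, hi⟩ := hC.card_orbit o.1
  have hfix : ∀ y : α, y ∈ MulAction.orbit C o.1 ↔ (y ∈ O ∧ g y = y) := by
    intro y
    constructor
    · rintro ⟨c, rfl⟩
      have hc := c.2
      constructor
      · exact horb.subset ⟨⟨c.1, hc.1⟩, rfl⟩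
      · have hcm := Subgroup.mem_centralizer_singleton_iff.1 hc.2
        change g (c.1 o.1) = c.1 o.1
        have : (g * c.1) o.1 = (c.1 * g) o.1 := by rw [hcm]
        rw [Perm.mul_apply, Perm.mul_apply, ho'] at this
        exact this
    · rintro ⟨hy, hgy⟩
      rw [← horb] at hy
      obtain ⟨p0, hp0⟩ := hy
      have hp0' : p0.1 o.1 = y := hp0
      let S := {p : P // p.1 o.1 = y}
      let fS : S → S := fun p => ⟨⟨g * p.1.1 * g⁻¹, hn _ p.1.2⟩, by
        have : g⁻¹ o.1 = o.1 := by rw [Perm.inv_eq_iff_eq]; exact ho'.symm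
        simp only [Perm.mul_apply, this, p.2, hgy]⟩
      have hfSk : ∀ k (p : S), ((fS^[k] p : S) : P).1 = g ^ k * p.1.1 * (g ^ k)⁻¹ := by
        intro k; induction k with
        | zero => intro y; simp
        | succ k ih => intro y; rw [Function.iterate_succ_apply, ih, pow_succ]; simp only [fS]; group
      have hfS : fS^[s ^ a] = id := by
        funext p; apply Subtype.ext; apply Subtype.ext; rw [hfSk, hg]; simp
      obtain ⟨n, hn'⟩ := (hP.to_subgroup (MulAction.stabilizer P o.1)).exists_card_eq
      have hcS : Fintype.card S = 3 ^ n := by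
        rw [← hn', ← Nat.card_eq_fintype_card]
        apply Nat.card_congr
        refine ⟨fun p => ⟨p0⁻¹ * p.1, ?_⟩, fun p => ⟨p0 * p.1, ?_⟩, ?_, ?_⟩
        · rw [MulAction.mem_stabilizer_iff, mul_smul]
          rw [inv_smul_eq_iff]
          change p.1.1 o.1 = p0.1 o.1
          rw [p.2, hp0']
        · have := MulAction.mem_stabilizer_iff.1 p.2
          change p0.1 (p.1.1 o.1) = y
          rw [show p.1.1 o.1 = o.1 from this, hp0']
        · intro p; simp
        · intro p; simp
      obtain ⟨p, hp⟩ := exists_fixed_mod fS s a n hs hs3 hfS hcS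
      have hp' : g * p.1.1 * g⁻¹ = p.1.1 := congrArg (fun z : S => z.1.1) hp
      refine ⟨⟨p.1.1, p.1.2, ?_⟩, p.2⟩
      exact Subgroup.mem_centralizer_singleton_iff.2 <| (mul_inv_eq_iff_eq_mul.1 hp').symm
  have hmod := card_fix_mod f s a hs hf
  have hcf : Fintype.card {y // f y = y} = 3 ^ i := by
    rw [← hi, ← Nat.card_eq_fintype_card]
    apply Nat.card_congr
    refine ⟨fun y => ⟨y.1.1, (hfix _).2 ⟨y.1.2, congrArg Subtype.val y.2⟩⟩,
      fun y => ⟨⟨y.1, ((hfix _).1 y.2).1⟩, Subtype.ext ((hfix _).1 y.2).2⟩, fun y => rfl, fun y => rfl⟩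
  have hle : 3 ^ i ≤ 3 ^ j := by
    rw [← hcf, ← hcO]; exact Fintype.card_subtype_le _
  have hij : i ≤ j := (Nat.pow_le_pow_iff_right (by norm_num)).1 hle
  rw [hcf, hcO] at hmod
  have heq := hZ i j hij hj.ge hmod.symm
  have huniv : MulAction.orbit C o.1 = O := by
    apply Set.eq_of_subset_of_ncard_le (fun y hy => ((hfix y).1 hy).1)
    · rw [← Nat.card_coe_set_eq, ← Nat.card_coe_set_eq, hi, hj, heq]
  have hx : x ∈ MulAction.orbit C o.1 := by rw [huniv]; exact MulAction.mem_orbit_self x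
  exact ((hfix x).1 hx).2
end S17

namespace S17
open Equiv

/-- stabilizer of a finset -/
def stabF {α : Type*} (H : Subgroup (Perm α)) (ℓ : Finset α) : Subgroup (Perm α) where
  carrier := {h | h ∈ H ∧ ∀ x, h x ∈ ℓ ↔ x ∈ ℓ}
  mul_mem' := by
    rintro a b ⟨ha, ha'⟩ ⟨hb, hb'⟩
    exact ⟨H.mul_mem ha hb, fun x => by rw [Perm.mul_apply, ha', hb']⟩
  one_mem' := ⟨H.one_mem, fun x => Iff.rfl⟩
  inv_mem' := by
    rintro a ⟨ha, ha'⟩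
    exact ⟨H.inv_mem ha, fun x => by rw [← ha' (a⁻¹ x)]; simp⟩

/-- restriction -/
def resF {α : Type*} (H : Subgroup (Perm α)) (ℓ : Finset α) : stabF H ℓ →* Perm ℓ where
  toFun h := Equiv.Perm.subtypePerm h.1 (fun x => h.2.2 x)
  map_one' := by ext x; rfl
  map_mul' a b := by ext x; rfl

lemma resF_apply {α : Type*} (H : Subgroup (Perm α)) (ℓ : Finset α) (h : stabF H ℓ) (x : ℓ) :
    ((resF H ℓ h x : ℓ) : α) = h.1 x.1 := rfl

lemma resF_surj {α : Type*} [Fintype α] [DecidableEq α] (H : Subgroup (Perm α)) (ℓ : Finset α)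
    (hHT : ∀ φ : α → α, Set.InjOn φ ℓ → ∃ h ∈ H, ∀ x ∈ ℓ, h x = φ x) :
    Function.Surjective (resF H ℓ) := by
  intro π
  let φ : α → α := fun x => if hx : x ∈ ℓ then (π ⟨x, hx⟩ : α) else x
  have hφ : ∀ x (hx : x ∈ ℓ), φ x = (π ⟨x, hx⟩ : α) := fun x hx => by simp only [φ, dif_pos hx]
  obtain ⟨h, hh, hx⟩ := hHT φ (by
    intro x hx y hy hxy
    rw [hφ x hx, hφ y hy] at hxy
    simpa using π.injective (Subtype.ext hxy))
  have hin : ∀ x ∈ ℓ, h x ∈ ℓ := fun x hxl => by rw [hx x hxl, hφ x hxl]; exact (π _).2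
  have hst : ∀ x, h x ∈ ℓ ↔ x ∈ ℓ := by
    intro x
    refine ⟨fun hxl => ?_, hin x⟩
    have hx' : h x = π (π.symm ⟨h x, hxl⟩) := by simp
    rw [← hφ _ (π.symm ⟨h x, hxl⟩).2, ← hx _ (π.symm ⟨h x, hxl⟩).2] at hx'
    rw [h.injective hx']
    exact (π.symm ⟨h x, hxl⟩).2
  refine ⟨⟨h, hh, hst⟩, ?_⟩
  ext x
  rw [resF_apply]
  change h x.1 = _
  rw [hx _ x.2, hφ _ x.2]

lemma frattini {α : Type*} [Fintype α] [DecidableEq α] (H : Subgroup (Perm α)) (ℓ : Finset α)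
    (hHT : ∀ φ : α → α, Set.InjOn φ ℓ → ∃ h ∈ H, ∀ x ∈ ℓ, h x = φ x)
    (N : Subgroup (Perm α)) (hN : N ≤ H) (hN3 : IsPGroup 3 N) (hNfix : ∀ n ∈ N, ∀ x ∈ ℓ, n x = x) :
    ∃ P : Subgroup (Perm α), N ≤ P ∧ P ≤ stabF H ℓ ∧ IsPGroup 3 P ∧
      ∀ π : Perm ℓ, ∃ m : stabF H ℓ, resF H ℓ m = π ∧ ∀ p, p ∈ P ↔ m.1 * p * m.1⁻¹ ∈ P := by
  haveI : Fact (Nat.Prime 3) := ⟨Nat.prime_three⟩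
  have hNB : N ≤ stabF H ℓ := by
    intro n hn
    refine ⟨hN hn, fun x => ⟨fun h => ?_, fun h => by rwa [hNfix n hn x h]⟩⟩
    have := hNfix n hn _ h
    rwa [n.injective this] at h
  let B := stabF H ℓ
  let A0 : Subgroup B := (resF H ℓ).ker
  let N' : Subgroup A0 := (N.subgroupOf B).subgroupOf A0
  have hN' : IsPGroup 3 N' := by
    have h1 : IsPGroup 3 (N.subgroupOf B) := hN3.comap_of_injective B.subtype B.subtype_injective
    exact h1.comap_of_injective A0.subtype A0.subtype_injective
  obtain ⟨P, hP⟩ := hN'.exists_le_sylow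
  have hF := Sylow.normalizer_sup_eq_top P
  refine ⟨(P.map A0.subtype).map B.subtype, ?_, ?_, ?_, ?_⟩
  · intro n hn
    have hnA : (⟨n, hNB hn⟩ : B) ∈ A0 := by
      rw [MonoidHom.mem_ker]
      ext x
      exact hNfix n hn x.1 x.2
    refine ⟨⟨n, hNB hn⟩, ⟨⟨⟨n, hNB hn⟩, hnA⟩, hP ?_, rfl⟩, rfl⟩
    exact hn
  · rintro _ ⟨b, -, rfl⟩
    exact b.2
  · exact (P.2.map A0.subtype).map B.subtype
  · intro π
    obtain ⟨b, hb⟩ := resF_surj H ℓ hHT π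
    have hbm : b ∈ Subgroup.normalizer ((P.map A0.subtype : Subgroup B) : Set B) ⊔ A0 := by
      rw [hF]; trivial
    obtain ⟨m, hm, a, ha, hma⟩ := Subgroup.mem_sup_of_normal_right.1 hbm
    refine ⟨m, ?_, ?_⟩
    · rw [← hb, ← hma, map_mul, MonoidHom.mem_ker.1 ha, mul_one]
    · have hm' := Subgroup.mem_normalizer_iff.1 hm
      intro p
      constructor
      · rintro ⟨b, hb, rfl⟩
        exact ⟨m * b * m⁻¹, (hm' b).1 hb, rfl⟩
      · rintro ⟨b, hb, hb'⟩
        have hp : p = ((m⁻¹ * b * m : B) : Perm α) := by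
          change (b : Perm α) = _ at hb'
          simp only [Subgroup.coe_mul, Subgroup.coe_inv, hb']; group
        rw [hp]
        refine ⟨m⁻¹ * b * m, (hm' _).2 ?_, rfl⟩
        have : m * (m⁻¹ * b * m) * m⁻¹ = b := by group
        rw [this]; exact hb
end S17

namespace S17
open Equiv

/-- orbit-preserving normalizing elements -/
def M0 {α : Type*} (H : Subgroup (Perm α)) (ℓ : Finset α) (P : Subgroup (Perm α)) :
    Subgroup (stabF H ℓ) where
  carrier := {m | (∀ p, p ∈ P ↔ m.1 * p * m.1⁻¹ ∈ P) ∧ ∀ x ∉ ℓ, ∃ p ∈ P, m.1 x = p x}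
  mul_mem' := by
    rintro a b ⟨ha, ha'⟩ ⟨hb, hb'⟩
    refine ⟨fun p => ?_, fun x hx => ?_⟩
    · rw [hb p, ha]
      simp only [Subgroup.coe_mul, mul_inv_rev, mul_assoc]
    · obtain ⟨p, hp, h1⟩ := hb' x hx
      obtain ⟨p', hp', h2⟩ := ha' x hx
      refine ⟨a.1 * p * a.1⁻¹ * p', P.mul_mem ((ha p).1 hp) hp', ?_⟩
      simp only [Perm.mul_apply, Subgroup.coe_mul, h1, ← h2]
      simp
  one_mem' := ⟨fun p => by simp, fun x _ => ⟨1, P.one_mem, rfl⟩⟩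
  inv_mem' := by
    rintro a ⟨ha, ha'⟩
    refine ⟨fun p => ?_, fun x hx => ?_⟩
    · rw [ha (((a⁻¹ : stabF H ℓ) : Perm α) * p * ((a⁻¹ : stabF H ℓ) : Perm α)⁻¹)]
      simp only [Subgroup.coe_inv]
      have : a.1 * (a.1⁻¹ * p * a.1⁻¹⁻¹) * a.1⁻¹ = p := by group
      rw [this]
    · obtain ⟨p, hp, h1⟩ := ha' x hx
      refine ⟨a.1⁻¹ * p⁻¹ * a.1, ?_, ?_⟩
      · rw [ha]
        have : a.1 * (a.1⁻¹ * p⁻¹ * a.1) * a.1⁻¹ = p⁻¹ := by group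
        rw [this]; exact P.inv_mem hp
      · simp only [Perm.mul_apply, h1, Subgroup.coe_inv]
        simp

lemma M0_conj {α : Type*} (H : Subgroup (Perm α)) (ℓ : Finset α) (P : Subgroup (Perm α))
    (m : stabF H ℓ) (hm : ∀ p, p ∈ P ↔ m.1 * p * m.1⁻¹ ∈ P) (a : stabF H ℓ) (ha : a ∈ M0 H ℓ P) :
    m * a * m⁻¹ ∈ M0 H ℓ P := by
  obtain ⟨ha, ha'⟩ := ha
  refine ⟨fun p => ?_, fun x hx => ?_⟩
  · have h1 := hm (m.1⁻¹ * p * m.1)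
    have : m.1 * (m.1⁻¹ * p * m.1) * m.1⁻¹ = p := by group
    rw [this] at h1
    rw [← h1, ha, hm]
    simp only [Subgroup.coe_mul, Subgroup.coe_inv, mul_inv_rev, inv_inv, mul_assoc]
  · have hx' : m.1⁻¹ x ∉ ℓ := by
      intro h
      have := (m.2.2 _).2 h
      simp at this; exact hx this
    obtain ⟨p, hp, h1⟩ := ha' _ hx'
    refine ⟨m.1 * p * m.1⁻¹, (hm p).1 hp, ?_⟩
    simp only [Perm.mul_apply, Subgroup.coe_mul, Subgroup.coe_inv, h1]

lemma core_nontriv {α : Type*} [Fintype α] [DecidableEq α] (H : Subgroup (Perm α)) (ℓ : Finset α)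
    (q : ℕ) (hq : 2 ≤ q) (hℓ : ℓ.card = q) (hα : Fintype.card α = q * q)
    (P : Subgroup (Perm α)) (hPB : P ≤ stabF H ℓ)
    (horb : ∀ x ∉ ℓ, q ≤ Nat.card (MulAction.orbit P x))
    (hM : ∀ π : Perm ℓ, ∃ m : stabF H ℓ, resF H ℓ m = π ∧ ∀ p, p ∈ P ↔ m.1 * p * m.1⁻¹ ∈ P) :
    ∃ m ∈ M0 H ℓ P, resF H ℓ m ≠ 1 := by
  classical
  let Γ := {x // x ∉ ℓ}
  let s : Setoid Γ := ⟨fun x y => ∃ p ∈ P, p x.1 = y.1, ⟨fun x => ⟨1, P.one_mem, rfl⟩,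
    fun {x y} ⟨p, hp, h⟩ => ⟨p⁻¹, P.inv_mem hp, by rw [← h]; simp⟩,
    fun {x y z} ⟨p, hp, h⟩ ⟨p', hp', h'⟩ => ⟨p' * p, P.mul_mem hp' hp, by rw [← h', ← h]; rfl⟩⟩⟩
  have hcΓ : Fintype.card Γ = q * q - q := by
    have := Fintype.card_subtype_compl (fun x => x ∈ ℓ)
    rw [this, hα, Fintype.card_coe, hℓ]
  have hQ : Fintype.card (Quotient s) * q ≤ q * q - q := by
    rw [← hcΓ]
    have := Finset.mul_card_image_le_card_of_maps_to (f := fun x : Γ => (Quotient.mk s x))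
      (s := Finset.univ) (t := Finset.univ) (fun _ _ => Finset.mem_univ _) q ?_
    · rw [mul_comm]; simpa using this
    · intro b _
      induction b using Quotient.inductionOn with
      | _ x =>
      refine (horb x.1 x.2).trans ?_
      rw [Nat.card_eq_fintype_card, ← Set.toFinset_card]
      refine Finset.card_le_card_of_surjOn (fun y : Γ => y.1) ?_
      rintro y hy
      simp only [Set.coe_toFinset] at hy
      obtain ⟨p, hp⟩ := hy
      have hp' : p.1 x.1 = y := hp
      have hyΓ : y ∉ ℓ := by
        rw [← hp', (hPB p.2).2]; exact x.2
      refine ⟨⟨y, hyΓ⟩, ?_, rfl⟩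
      simp only [Finset.coe_filter, Finset.mem_univ, true_and, Set.mem_setOf_eq]
      apply Quotient.sound
      exact ⟨p.1⁻¹, P.inv_mem p.2, by rw [Perm.inv_eq_iff_eq]; exact hp'.symm⟩
  have hQ' : Fintype.card (Quotient s) < q := by
    by_contra h
    have : q * q ≤ Fintype.card (Quotient s) * q := Nat.mul_le_mul_right _ (by omega)
    have : 0 < q * q := by positivity
    omega
  choose m hm1 hm2 using hM
  have hΓ : ∀ (g : stabF H ℓ) (x : α), g.1 x ∉ ℓ ↔ x ∉ ℓ := fun g x => not_congr (g.2.2 x)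
  let e : Perm ℓ → Perm Γ := fun π => Equiv.Perm.subtypePerm (m π).1 (fun x => hΓ _ x)
  let θ : Perm ℓ → Perm (Quotient s) := fun π => Quotient.congr (e π) (by
    intro x y
    constructor
    · rintro ⟨p, hp, h⟩
      refine ⟨_, (hm2 π p).1 hp, ?_⟩
      change _ = (m π).1 y.1
      rw [← h]
      change ((m π).1 * p * (m π).1⁻¹) ((m π).1 x.1) = _
      simp
    · rintro ⟨p, hp, h⟩
      change p ((m π).1 x.1) = (m π).1 y.1 at h
      refine ⟨(m π).1⁻¹ * p * (m π).1, (hm2 π _).2 ?_, ?_⟩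
      · have : (m π).1 * ((m π).1⁻¹ * p * (m π).1) * (m π).1⁻¹ = p := by group
        rw [this]; exact hp
      · simp only [Perm.mul_apply, h]; simp)
  obtain ⟨π, π', hne, heq⟩ := Fintype.exists_ne_map_eq_of_card_lt θ (by
    rw [Fintype.card_perm, Fintype.card_perm, Fintype.card_coe, hℓ]
    have h1 : Fintype.card (Quotient s) ≤ q - 1 := by omega
    have h2 : (q - 1).factorial < q.factorial := (Nat.factorial_lt (by omega)).2 (by omega)
    exact lt_of_le_of_lt (Nat.factorial_le h1) h2)
  have conjinv : ∀ (a : stabF H ℓ), (∀ p, p ∈ P ↔ a.1 * p * a.1⁻¹ ∈ P) →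
      ∀ p, p ∈ P ↔ a.1⁻¹ * p * a.1 ∈ P := by
    intro a ha p
    have : a.1 * (a.1⁻¹ * p * a.1) * a.1⁻¹ = p := by group
    rw [ha (a.1⁻¹ * p * a.1), this]
  refine ⟨(m π)⁻¹ * m π', ⟨?_, ?_⟩, ?_⟩
  · intro p
    rw [hm2 π' p, conjinv (m π) (hm2 π)]
    simp only [Subgroup.coe_mul, Subgroup.coe_inv, mul_inv_rev, inv_inv, mul_assoc]
  · intro x hx
    have h1 : θ π (Quotient.mk s ⟨x, hx⟩) = θ π' (Quotient.mk s ⟨x, hx⟩) := by rw [heq]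
    obtain ⟨p, hp, h2⟩ := Quotient.exact h1
    change p ((m π).1 x) = (m π').1 x at h2
    refine ⟨(m π).1⁻¹ * p * (m π).1, (conjinv (m π) (hm2 π) p).1 hp, ?_⟩
    simp only [Subgroup.coe_mul, Subgroup.coe_inv, Perm.mul_apply, h2]
  · rw [map_mul, map_inv, hm1, hm1, Ne, inv_mul_eq_one]
    exact hne

lemma core {α : Type*} [Fintype α] [DecidableEq α] (H : Subgroup (Perm α)) (ℓ : Finset α)
    (r : ℕ) (hr : 2 ≤ r) (hℓ : ℓ.card = 3 ^ r) (hα : Fintype.card α = 3 ^ r * 3 ^ r)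
    (hHT : ∀ φ : α → α, Set.InjOn φ ℓ → ∃ h ∈ H, ∀ x ∈ ℓ, h x = φ x)
    (N : Subgroup (Perm α)) (hN : N ≤ H) (hN3 : IsPGroup 3 N) (hNfix : ∀ n ∈ N, ∀ x ∈ ℓ, n x = x)
    (horb : ∀ x ∉ ℓ, 3 ^ r ≤ Nat.card (MulAction.orbit N x)) :
    ∃ g ∈ H, g ≠ 1 ∧ ∀ x ∉ ℓ, g x = x := by
  classical
  have hq9 : 9 ≤ 3 ^ r := by
    calc 9 = 3 ^ 2 := by norm_num
      _ ≤ 3 ^ r := Nat.pow_le_pow_right (by norm_num) hr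
  obtain ⟨P, hNP, hPB, hP3, hM⟩ := frattini H ℓ hHT N hN hN3 hNfix
  have horbP : ∀ x ∉ ℓ, 3 ^ r ≤ Nat.card (MulAction.orbit P x) := by
    intro x hx
    refine (horb x hx).trans ?_
    apply Nat.card_mono (Set.toFinite _)
    rintro _ ⟨n, rfl⟩
    exact ⟨⟨n.1, hNP n.2⟩, rfl⟩
  obtain ⟨m1, hm1, hm1'⟩ := core_nontriv H ℓ (3 ^ r) (by omega) hℓ hα P hPB horbP hM
  have hnorm : ((M0 H ℓ P).map (resF H ℓ)).Normal := by
    constructor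
    rintro _ ⟨a, ha, rfl⟩ π
    obtain ⟨m, hm, hm'⟩ := hM π
    refine ⟨m * a * m⁻¹, M0_conj H ℓ P m hm' a ha, ?_⟩
    rw [map_mul, map_mul, map_inv, hm]
  have hnt : Nontrivial ((M0 H ℓ P).map (resF H ℓ)) := by
    rw [Subgroup.nontrivial_iff_exists_ne_one]
    exact ⟨_, ⟨m1, hm1, rfl⟩, hm1'⟩
  have hcl : Nat.card ℓ = 3 ^ r := by rw [Nat.card_eq_fintype_card, Fintype.card_coe, hℓ]
  have hAlt : alternatingGroup ℓ ≤ (M0 H ℓ P).map (resF H ℓ) :=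
    Equiv.Perm.alternatingGroup_le_of_normal (by rw [hcl]; omega) hnt
  obtain ⟨s, hs, hs5, hsq, hsodd, hZ⟩ := zsig' r hr
  haveI := Fact.mk hs
  haveI : Nontrivial ℓ := by
    rw [← Fintype.one_lt_card_iff_nontrivial, Fintype.card_coe, hℓ]; omega
  have hsd : s ∣ Nat.card (alternatingGroup ℓ) := by
    have h1 := two_mul_nat_card_alternatingGroup (α := ℓ)
    rw [Nat.card_eq_fintype_card (α := Perm ℓ), Fintype.card_perm, Fintype.card_coe, hℓ] at h1
    have h2 : s ∣ 2 * Nat.card (alternatingGroup ℓ) := by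
      rw [h1]; exact (Nat.Prime.dvd_factorial hs).2 hsq
    rcases (Nat.Prime.dvd_mul hs).1 h2 with h | h
    · have := Nat.le_of_dvd (by norm_num) h; omega
    · exact h
  obtain ⟨t, ht⟩ := exists_prime_orderOf_dvd_card' s hsd
  obtain ⟨m0, hm0, hm0t⟩ := hAlt t.2
  have hto : orderOf (t : Perm ℓ) = s := by rw [Subgroup.orderOf_coe, ht]
  have hmo : orderOf m0 ≠ 0 := (orderOf_pos m0).ne'
  obtain ⟨a, k, hk, hak⟩ := Nat.exists_eq_pow_mul_and_not_dvd hmo s hs.one_lt.ne'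
  set g : stabF H ℓ := m0 ^ k with hg
  have hgM : g ∈ M0 H ℓ P := Subgroup.pow_mem _ hm0 k
  have hgs : g ^ (s ^ a) = 1 := by
    rw [hg, ← pow_mul, mul_comm, ← hak, pow_orderOf_eq_one]
  have hgne : g ≠ 1 := by
    intro h
    have h1 : (t : Perm ℓ) ^ k = 1 := by rw [← hm0t, ← map_pow, ← hg, h, map_one]
    have := orderOf_dvd_of_pow_eq_one h1
    rw [hto] at this
    exact hk this
  refine ⟨g.1, g.2.1, fun h => hgne (Subtype.ext h), fun x hx => ?_⟩
  refine fix_orbit P hP3 g.1 s a hs (by omega) (by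
    have := congrArg Subtype.val hgs; simpa using this) (fun p hp => (hgM.1 p).1 hp) x ?_ ?_
  · rintro _ ⟨p, rfl⟩
    have hpx : p.1 x ∉ ℓ := by rw [(hPB p.2).2]; exact hx
    obtain ⟨p', hp', h⟩ := hgM.2 _ hpx
    exact ⟨⟨p' * p.1, P.mul_mem hp' p.2⟩, h.symm⟩
  · intro i j hij hj hmod
    refine hZ i j hij ?_ hmod
    have hle : Nat.card (MulAction.orbit P x) ≤ Nat.card {y // y ∉ ℓ} := by
      apply Nat.card_mono (Set.toFinite {y | y ∉ ℓ})
      rintro _ ⟨p, rfl⟩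
      change p.1 x ∉ ℓ
      rw [(hPB p.2).2]; exact hx
    rw [Nat.card_eq_fintype_card (α := {y // y ∉ ℓ}), Fintype.card_subtype_compl (fun x => x ∈ ℓ), hα, Fintype.card_coe, hℓ] at hle
    have hlt : 3 ^ j < 3 ^ (2 * r) := by
      rw [two_mul, pow_add]
      have : 0 < 3 ^ r * 3 ^ r := by positivity
      omega
    exact (Nat.pow_lt_pow_iff_right (by norm_num)).1 hlt
end S17

namespace S17
open Equiv

lemma three_cycle_comm {α : Type*} [Fintype α] [DecidableEq α] (g g' : Perm α) (y : α) (hg : g y ≠ y)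
    (hg' : g' y ≠ y) (hd : ∀ x, x ≠ y → g x = x ∨ g' x = x) :
    (g * g' * g⁻¹ * g'⁻¹).IsThreeCycle := by
  set u := g y with hu
  set v := g' y with hv
  have hgu : g u ≠ u := fun h => hg (g.injective (by rw [h]))
  have hg'v : g' v ≠ v := fun h => hg' (g'.injective (by rw [h]))
  have hg'u : g' u = u := (hd u hg).resolve_left hgu
  have huv : u ≠ v := by rintro h; rw [h] at hg'u; exact hg'v hg'u
  have hdis : Perm.Disjoint (swap y u * g) g' := by
    intro x
    by_cases hxy : x = y
    · left; rw [hxy, Perm.mul_apply, ← hu, swap_apply_right]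
    · rcases hd x hxy with h | h
      · left
        have hxu : x ≠ u := by rintro h'; rw [h'] at h; exact hgu h
        rw [Perm.mul_apply, h, swap_apply_of_ne_of_ne hxy hxu]
      · right; exact h
  have hc := hdis.commute
  have h1 : g * g' * g⁻¹ = swap y u * g' * swap y u := by
    have h2 : swap y u * g * g' = g' * (swap y u * g) := hc
    have hss : swap y u * swap y u = 1 := swap_mul_self y u
    calc g * g' * g⁻¹ = (swap y u * swap y u) * g * g' * g⁻¹ := by rw [hss, one_mul]
      _ = swap y u * (swap y u * g * g') * g⁻¹ := by group
      _ = swap y u * (g' * (swap y u * g)) * g⁻¹ := by rw [h2]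
      _ = _ := by group
  have h3 : g' * swap y u * g'⁻¹ = swap v u := by
    have := Equiv.swap_apply_apply g' y u
    rw [← hv, hg'u] at this
    rw [this]
  rw [h1]
  have : swap y u * g' * swap y u * g'⁻¹ = swap u y * swap u v := by
    rw [mul_assoc, mul_assoc, ← mul_assoc g', h3, swap_comm y u, swap_comm v u]
  rw [this]
  exact Perm.isThreeCycle_swap_mul_swap_same hg huv (Ne.symm hg')

variable {F : Type*} [Field F] [Fintype F] [DecidableEq F]
variable {H : Subgroup (Perm (F × F))}

lemma Good.alt_of_line (hH : Good H) (g : Perm (F × F)) (hg : g ∈ H) (hg1 : g ≠ 1)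
    (hgl : ∀ x : F × F, x.2 ≠ 0 → g x = x) : alternatingGroup (F × F) ≤ H := by
  have hex : ∃ y, g y ≠ y := by
    by_contra! h; exact hg1 (Equiv.ext h)
  obtain ⟨y, hy⟩ := hex
  have hy2 : y.2 = 0 := by by_contra h; exact hy (hgl y h)
  obtain ⟨t1, ht1, ht1x⟩ := hH.trans (-y)
  obtain ⟨t2, ht2, ht2x⟩ := hH.trans y
  set h := t2 * rot F * t1 with hh
  have hhH : h ∈ H := H.mul_mem (H.mul_mem ht2 hH.rot_mem) ht1
  have hhx : ∀ x : F × F, h x = (x.2 - y.2 + y.1, -(x.1 - y.1) + y.2) := by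
    intro x
    rw [hh, Perm.mul_apply, Perm.mul_apply, ht1x, ht2x, rot_apply]
    ext <;> simp [sub_eq_add_neg]
  have hhy : h y = y := by rw [hhx]; ext <;> simp
  have hhy' : h⁻¹ y = y := by rw [Perm.inv_eq_iff_eq, hhy]
  have key := three_cycle_comm g (h * g * h⁻¹) y hy (by
      rw [Perm.mul_apply, Perm.mul_apply, hhy']
      intro h'; exact hy (h.injective (by rw [h', hhy]))) (by
      intro x hx
      by_cases hx2 : x.2 = 0
      · right
        rw [Perm.mul_apply, Perm.mul_apply]
        have hz : h (h⁻¹ x) = x := by simp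
        set z := h⁻¹ x with hzdef
        have hz2 : z.2 ≠ 0 := by
          intro h0
          have h1 := hhx z
          rw [hz] at h1
          apply hx
          have h2 : x.1 = _ := congrArg Prod.fst h1
          simp only [h0, hy2, sub_self, zero_add] at h2
          exact Prod.ext h2 (by rw [hx2, hy2])
        rw [hgl z hz2, hz]
      · left; exact hgl x hx2)
  have hmem : g * (h * g * h⁻¹) * g⁻¹ * (h * g * h⁻¹)⁻¹ ∈ H := by
    have : h * g * h⁻¹ ∈ H := H.mul_mem (H.mul_mem hhH hg) (H.inv_mem hhH)
    exact H.mul_mem (H.mul_mem (H.mul_mem hg this) (H.inv_mem hg)) (H.inv_mem this)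
  refine Equiv.Perm.alternatingGroup_le_of_isPreprimitive_of_isThreeCycle_mem ?_ key hmem
  apply MulAction.isPreprimitive_of_is_two_pretransitive
  rw [MulAction.is_two_pretransitive_iff]
  intro a b c d hab hcd
  obtain ⟨k, hk, hkx⟩ := hH.ht2 {a, b} (fun x => if x = a then c else d) (Finset.card_le_two) (by
    intro x hx z hz hxz
    simp only [Finset.coe_insert, Finset.coe_singleton, Set.mem_insert_iff, Set.mem_singleton_iff] at hx hz
    rcases hx with rfl | rfl <;> rcases hz with rfl | rfl <;> simp_all [Ne.symm])
  refine ⟨⟨k, hk⟩, ?_, ?_⟩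
  · have := hkx a (by simp); simpa using this
  · have := hkx b (by simp); rw [if_neg (Ne.symm hab)] at this; exact this

lemma X_mul (f g : F → F) : X f * X g = X (fun b => g b + f b) := by
  ext x <;> simp [X_apply, add_assoc]

lemma X_zero : X (fun _ : F => (0:F)) = 1 := by ext x <;> simp

lemma X_pow_three [CharP F 3] (f : F → F) : X f ^ 3 = 1 := by
  have : X f ^ 3 = X (fun b => (3:F) * f b) := by
    rw [pow_succ, pow_two, X_mul, X_mul]; congr 1; funext b; ring
  rw [this]
  have h3 : (3:F) = 0 := by exact_mod_cast CharP.cast_eq_zero F 3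
  simp only [h3, zero_mul, X_zero]

theorem Good.alt [CharP F 3] (hH : Good H) (r : ℕ) (hr : 1 ≤ r) (hc : Fintype.card F = 3 ^ r) :
    alternatingGroup (F × F) ≤ H := by
  rcases Nat.lt_or_ge r 2 with h | h
  · have hr1 : r = 1 := by omega
    rw [hr1] at hc
    have hs := hH.shear 1 0 (-1)
    refine hH.alt_of_line _ hs ?_ ?_
    · intro h
      have := congrArg (fun k : Perm (F × F) => (k (0, 0)).1) h
      simp at this
    · intro x hx
      apply X_fix
      have h1 := FiniteField.pow_card_sub_one_eq_one x.2 hx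
      rw [hc] at h1
      have h1 : x.2 ^ 2 = 1 := h1
      rw [h1]; ring
  · have hq9 : 9 ≤ 3 ^ r := by
      calc 9 = 3 ^ 2 := by norm_num
        _ ≤ 3 ^ r := Nat.pow_le_pow_right (by norm_num) h
    have hT := HT_q hH (by omega) (by rw [hc]; exact Odd.pow (by decide))
    let N : Subgroup (Perm (F × F)) :=
      { carrier := {g | ∃ d : F, g = X (fun b => d * b)}
        mul_mem' := by
          rintro _ _ ⟨d, rfl⟩ ⟨d', rfl⟩
          exact ⟨d' + d, by rw [X_mul]; congr 1; funext b; ring⟩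
        one_mem' := ⟨0, by simp only [zero_mul, X_zero]⟩
        inv_mem' := by
          rintro _ ⟨d, rfl⟩
          refine ⟨-d, ?_⟩
          rw [inv_eq_iff_mul_eq_one, X_mul, ← X_zero]
          congr 1; funext b; ring }
    obtain ⟨g, hg, hg1, hgl⟩ := core H (line (0:F)) r h (by rw [card_line, hc])
      (by rw [Fintype.card_prod, hc]) (fun φ hφ => hT _ φ (by rw [card_line]) hφ) N
      (by rintro _ ⟨d, rfl⟩; exact hH.lin d)
      (by
        rintro ⟨_, d, rfl⟩
        exact ⟨1, by apply Subtype.ext; simp [X_pow_three]⟩)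
      (by
        rintro _ ⟨d, rfl⟩ x hx
        rw [mem_line] at hx
        apply X_fix; rw [hx, mul_zero])
      (by
        intro x hx
        rw [mem_line] at hx
        rw [← hc, ← Nat.card_eq_fintype_card]
        refine Nat.card_le_card_of_injective
          (fun d : F => (⟨(x.1 + d * x.2, x.2), ⟨⟨X (fun b => d * b), d, rfl⟩, ?_⟩⟩ : MulAction.orbit N x)) ?_
        · change X (fun b => d * b) x = _
          simp [X_apply]
        · intro d d' hdd
          have := congrArg (fun z : MulAction.orbit N x => z.1.1) hdd
          simp only [add_right_inj] at this
          exact mul_right_cancel₀ hx this)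
    refine hH.alt_of_line g hg hg1 (fun x hx => hgl x ?_)
    rw [mem_line]; exact hx
end S17

namespace S17
open Equiv

lemma subdirect {ι S : Type*} [Finite ι] [DecidableEq ι] [Group S] [IsSimpleGroup S]
    (hperf : commutator S = ⊤) (L : Subgroup (ι → S)) (hsurj : ∀ i s, ∃ k ∈ L, k i = s)
    (hd : ∀ i j, i ≠ j → (∃ k ∈ L, k i = 1 ∧ k j ≠ 1) ∨ (∃ k ∈ L, k j = 1 ∧ k i ≠ 1)) : L = ⊤ := by
  have h1 : ∀ i j, (∃ k ∈ L, k j = 1 ∧ k i ≠ 1) → ∀ s, ∃ k ∈ L, k j = 1 ∧ k i = s := by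
    rintro i j ⟨k, hk, hkj, hki⟩
    let N : Subgroup S :=
      { carrier := {s | ∃ k ∈ L, k j = 1 ∧ k i = s}
        mul_mem' := by
          rintro _ _ ⟨k, hk, h, rfl⟩ ⟨k', hk', h', rfl⟩
          exact ⟨k * k', L.mul_mem hk hk', by simp [h, h'], rfl⟩
        one_mem' := ⟨1, L.one_mem, rfl, rfl⟩
        inv_mem' := by
          rintro _ ⟨k, hk, h, rfl⟩
          exact ⟨k⁻¹, L.inv_mem hk, by simp [h], rfl⟩ }
    have hN : N.Normal := by
      constructor
      rintro _ ⟨k, hk, h, rfl⟩ g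
      obtain ⟨l, hl, rfl⟩ := hsurj i g
      exact ⟨l * k * l⁻¹, L.mul_mem (L.mul_mem hl hk) (L.inv_mem hl), by simp [h], rfl⟩
    rcases hN.eq_bot_or_eq_top with h | h
    · exfalso
      have : k i ∈ N := ⟨k, hk, hkj, rfl⟩
      rw [h, Subgroup.mem_bot] at this
      exact hki this
    · intro s
      have : s ∈ N := by rw [h]; trivial
      exact this
  have h2 : ∀ i j, i ≠ j → ∃ k ∈ L, k j = 1 ∧ k i ≠ 1 := by
    intro i j hij
    rcases hd i j hij with h | h
    · obtain ⟨s, hs⟩ := exists_ne (1 : S)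
      obtain ⟨k, hk, rfl⟩ := hsurj i s
      obtain ⟨k', hk', hki, hkj⟩ := h1 j i h (k j)
      exact ⟨k * k'⁻¹, L.mul_mem hk (L.inv_mem hk'), by simp [hkj], by simp [hki, hs]⟩
    · exact h
  have h3 : ∀ (i : ι) (J : Finset ι), i ∉ J → ∀ s, ∃ k ∈ L, (∀ j ∈ J, k j = 1) ∧ k i = s := by
    intro i J
    induction J using Finset.induction_on with
    | empty =>
      intro _ s
      obtain ⟨k, hk, h⟩ := hsurj i s
      exact ⟨k, hk, by simp, h⟩
    | insert j J hj ih =>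
      intro hi s
      rw [Finset.mem_insert, not_or] at hi
      let N : Subgroup S :=
        { carrier := {s | ∃ k ∈ L, (∀ x ∈ insert j J, k x = 1) ∧ k i = s}
          mul_mem' := by
            rintro _ _ ⟨k, hk, h, rfl⟩ ⟨k', hk', h', rfl⟩
            exact ⟨k * k', L.mul_mem hk hk', fun x hx => by simp [h x hx, h' x hx], rfl⟩
          one_mem' := ⟨1, L.one_mem, fun _ _ => rfl, rfl⟩
          inv_mem' := by
            rintro _ ⟨k, hk, h, rfl⟩
            exact ⟨k⁻¹, L.inv_mem hk, fun x hx => by simp [h x hx], rfl⟩ }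
      have hN : commutator S ≤ N := by
        rw [commutator_def, Subgroup.commutator_le]
        intro s1 _ s2 _
        obtain ⟨k1, hk1, ha1, rfl⟩ := ih hi.2 s1
        obtain ⟨k2, hk2, ha2, rfl⟩ := h1 i j (h2 i j hi.1) s2
        refine ⟨k1 * k2 * k1⁻¹ * k2⁻¹, ?_, ?_, rfl⟩
        · exact L.mul_mem (L.mul_mem (L.mul_mem hk1 hk2) (L.inv_mem hk1)) (L.inv_mem hk2)
        · intro x hx
          rcases Finset.mem_insert.1 hx with rfl | hx
          · simp [ha2]
          · simp [ha1 x hx]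
      have : s ∈ N := hN (by rw [hperf]; trivial)
      exact this
  rw [eq_top_iff]
  intro x _
  haveI := Fintype.ofFinite ι
  apply Subgroup.pi_mem_of_mulSingle_mem
  intro i
  obtain ⟨k, hk, hj, hi⟩ := h3 i (Finset.univ.erase i) (by simp) (x i)
  have : Pi.mulSingle i (x i) = k := by
    funext j
    by_cases hji : j = i
    · subst hji; simp [hi]
    · rw [Pi.mulSingle_eq_of_ne hji, hj j (by simp [hji])]
  rw [this]; exact hk

variable {F : Type*} [Field F]

/-- blockwise action -/
def blk : (F → Perm (F × F)) →* Perm (F × F × F) where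
  toFun k :=
    { toFun := fun x => ((k x.2.2 (x.1, x.2.1)).1, (k x.2.2 (x.1, x.2.1)).2, x.2.2)
      invFun := fun x => (((k x.2.2).symm (x.1, x.2.1)).1, ((k x.2.2).symm (x.1, x.2.1)).2, x.2.2)
      left_inv := fun x => by simp
      right_inv := fun x => by simp }
  map_one' := by ext x <;> rfl
  map_mul' a b := by ext x <;> rfl

lemma blk_apply (k : F → Perm (F × F)) (x : F × F × F) :
    blk k x = ((k x.2.2 (x.1, x.2.1)).1, (k x.2.2 (x.1, x.2.1)).2, x.2.2) := rfl

lemma blk_inj : Function.Injective (blk (F := F)) := by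
  intro k k' h
  funext c
  ext x
  · have := congrArg (fun p : Perm (F × F × F) => (p (x.1, x.2, c)).1) h
    exact this
  · have := congrArg (fun p : Perm (F × F × F) => (p (x.1, x.2, c)).2.1) h
    exact this

/-- blocks, even -/
def Phi (F : Type*) [Field F] [Fintype F] [DecidableEq F] : (F → alternatingGroup (F × F)) →* Perm (F × F × F) where
  toFun k := blk (fun c => (k c).1)
  map_one' := by ext x <;> rfl
  map_mul' a b := by ext x <;> rfl

lemma Phi_inj [Fintype F] [DecidableEq F] : Function.Injective (Phi F) := by
  intro k k' h
  have h' : blk (fun c => (k c).1) = blk (fun c => (k' c).1) := h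
  have := blk_inj h'
  funext c
  exact Subtype.ext (congrFun this c)

lemma Phi_range [Fintype F] [DecidableEq F] (k : F → Perm (F × F)) (hk : ∀ c, Perm.sign (k c) = 1) :
    blk k ∈ (Phi F).range := ⟨fun c => ⟨k c, Perm.mem_alternatingGroup.2 (hk c)⟩, rfl⟩

lemma Phi_range' [Fintype F] [DecidableEq F] (k : F → Perm (F × F)) (hk : blk k ∈ (Phi F).range) (c : F) :
    Perm.sign (k c) = 1 := by
  obtain ⟨k', h⟩ := hk
  have h' : blk (fun c => (k' c).1) = blk k := h
  have := congrFun (blk_inj h') c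
  rw [← this]
  exact Perm.mem_alternatingGroup.1 (k' c).2

lemma sign_of_cube {α : Type*} [Fintype α] [DecidableEq α] (g : Perm α) (h : g ^ 3 = 1) : Perm.sign g = 1 := by
  have h1 : Perm.sign g ^ 3 = 1 := by rw [← map_pow, h, map_one]
  rcases Int.units_eq_one_or (Perm.sign g) with h2 | h2
  · exact h2
  · rw [h2] at h1; exact absurd h1 (by decide)

/-- translation -/
def tr (u v : F) : Perm (F × F) where
  toFun x := (x.1 + u, x.2 + v)
  invFun x := (x.1 - u, x.2 - v)
  left_inv x := by simp
  right_inv x := by simp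

/-- diagonal -/
def dg (m : Fˣ) : Perm (F × F) where
  toFun x := (m * x.1, (m⁻¹ : Fˣ) * x.2)
  invFun x := ((m⁻¹ : Fˣ) * x.1, m * x.2)
  left_inv x := by simp
  right_inv x := by simp

section
variable [Fintype F] [DecidableEq F] [CharP F 3]

lemma three0 : (3 : F) = 0 := by exact_mod_cast CharP.cast_eq_zero F 3

lemma sign_X (f : F → F) : Perm.sign (X f) = 1 := sign_of_cube _ (X_pow_three f)

lemma sign_tr (u v : F) : Perm.sign (tr u v) = 1 := by
  apply sign_of_cube
  have h3 := three0 (F := F)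
  ext x
  · change x.1 + u + u + u = x.1
    linear_combination u * h3
  · change x.2 + v + v + v = x.2
    linear_combination v * h3

lemma rot_symm_apply (x : F × F) : (Equiv.symm (rot F)) x = (-x.2, x.1) := rfl

lemma sign_rot : Perm.sign (rot F) = 1 := by
  have : rot F = X (fun b => b) * (rot F * X (fun b => b) * (rot F)⁻¹) * X (fun b => b) := by
    ext x <;> simp [X_apply, rot_symm_apply]
  rw [this]
  simp only [map_mul, sign_X, map_inv]
  simp

lemma sign_dg (m : Fˣ) : Perm.sign (dg m) = 1 := by
  have : dg m * rot F = X (fun b => (m : F) * b) * (rot F * X (fun b => ((m⁻¹ : Fˣ) : F) * b) * (rot F)⁻¹) * X (fun b => (m : F) * b) := by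
    have hm : (m : F) ≠ 0 := m.ne_zero
    ext x
    · simp [X_apply, rot_symm_apply, dg]; field_simp; ring
    · simp [X_apply, rot_symm_apply, dg]; field_simp; ring
  have h2 := congrArg Perm.sign this
  simpa [sign_X, sign_rot] using h2
end
end S17

namespace S17
open Equiv
variable {F : Type*} [Field F] [Fintype F] [DecidableEq F] [CharP F 3]

/-- the group K -/
abbrev KK (F : Type*) [Field F] (ε : ℕ) : Subgroup (Perm (F × F × F)) := K1grp F ε ⊔ K2grp F ε

lemma mem_alpha (ε : ℕ) (u v : F) : alphaPerm u v 0 ∈ KK F ε :=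
  (le_sup_left.trans le_sup_left : Vgrp F ≤ KK F ε) (Subgroup.subset_closure ⟨u, v, rfl⟩)
lemma mem_gamma (ε : ℕ) (e : F) : gammaPerm e ∈ KK F ε :=
  ((le_sup_left.trans le_sup_left).trans (le_sup_right.trans le_sup_left) : Cgrp F ≤ KK F ε)
    (Subgroup.subset_closure ⟨e, rfl⟩)
lemma mem_delta (ε : ℕ) : deltaPerm F ∈ KK F ε :=
  ((le_sup_right.trans le_sup_left).trans (le_sup_right.trans le_sup_left) : Dgrp F ≤ KK F ε)
    (Subgroup.subset_closure rfl)
lemma mem_beta (ε : ℕ) (m : Fˣ) : betaPerm ε m m⁻¹ ∈ KK F ε :=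
  (le_sup_right.trans (le_sup_right.trans le_sup_left) : Tgrp F ε ≤ KK F ε)
    (Subgroup.subset_closure ⟨m, rfl⟩)
lemma mem_tau (ε : ℕ) (d : F) : tauPerm ε d ∈ KK F ε :=
  ((le_sup_right.trans le_sup_left).trans le_sup_right : Egrp F ε ≤ KK F ε)
    (Subgroup.subset_closure ⟨d, rfl⟩)

lemma blk_alpha (u v : F) : alphaPerm u v 0 = blk (fun _ => tr u v) := by
  ext x <;> simp [alphaPerm, blk_apply, tr]
lemma blk_gamma (e : F) : gammaPerm e = blk (fun _ => X (fun b => e * b)) := by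
  ext x <;> simp [gammaPerm, blk_apply, X_apply]
lemma blk_delta : deltaPerm F = blk (fun _ => rot F) := by
  ext x <;> simp [deltaPerm, blk_apply]
lemma blk_tau (ε : ℕ) (d : F) : tauPerm ε d = blk (fun c => X (fun b => d * b ^ 2 + d ^ ε * c)) := by
  ext x <;> simp [tauPerm, blk_apply, X_apply, add_assoc]
lemma blk_beta (ε : ℕ) (m : Fˣ) : betaPerm ε m m⁻¹ = blk (fun _ => dg m) := by
  ext x <;> simp [betaPerm, blk_apply, dg]

lemma KK_le (ε : ℕ) : KK F ε ≤ (Phi F).range := by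
  have hV : Vgrp F ≤ (Phi F).range := by
    rw [Vgrp, Subgroup.closure_le]
    rintro _ ⟨u, v, rfl⟩
    rw [blk_alpha]; exact Phi_range _ (fun c => sign_tr u v)
  have hC : Cgrp F ≤ (Phi F).range := by
    rw [Cgrp, Subgroup.closure_le]
    rintro _ ⟨e, rfl⟩
    rw [blk_gamma]; exact Phi_range _ (fun c => sign_X _)
  have hD : Dgrp F ≤ (Phi F).range := by
    rw [Dgrp, Subgroup.closure_le]
    rintro _ rfl
    rw [blk_delta]; exact Phi_range _ (fun c => sign_rot)
  have hT : Tgrp F ε ≤ (Phi F).range := by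
    rw [Tgrp, Subgroup.closure_le]
    rintro _ ⟨e, rfl⟩
    rw [blk_beta]; exact Phi_range _ (fun c => sign_dg _)
  have hE : Egrp F ε ≤ (Phi F).range := by
    rw [Egrp, Subgroup.closure_le]
    rintro _ ⟨e, rfl⟩
    rw [blk_tau]; exact Phi_range _ (fun c => sign_X _)
  exact sup_le (sup_le hV (sup_le (sup_le hC hD) hT)) (sup_le (sup_le (sup_le hV hC) hE) hT)

/-- comap -/
abbrev KB (F : Type*) [Field F] (ε : ℕ) : Subgroup (F → Perm (F × F)) := (KK F ε).comap blk

lemma KB_X (ε : ℕ) (e0 e1 e2 : F) : (fun c => X (fun b => e0 + e1 * b + e2 * b ^ 2 + e2 ^ ε * c)) ∈ KB F ε := by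
  rw [Subgroup.mem_comap]
  have : blk (fun c => X (fun b => e0 + e1 * b + e2 * b ^ 2 + e2 ^ ε * c)) =
      alphaPerm e0 0 0 * gammaPerm e1 * tauPerm ε e2 := by
    ext x <;> simp [tauPerm, blk_apply, X_apply, alphaPerm, gammaPerm]
    ring
  rw [this]
  exact Subgroup.mul_mem _ (Subgroup.mul_mem _ (mem_alpha ε e0 0) (mem_gamma ε e1)) (mem_tau ε e2)

lemma KB_rot (ε : ℕ) : (fun _ => rot F) ∈ KB F ε := by
  rw [Subgroup.mem_comap, ← blk_delta]
  exact mem_delta ε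

lemma KB_sign (ε : ℕ) {k : F → Perm (F × F)} (hk : k ∈ KB F ε) (c : F) : Perm.sign (k c) = 1 :=
  Phi_range' k (KK_le ε hk) c

lemma KB_lift (ε : ℕ) (r : ℕ) (hr : 1 ≤ r) (hc : Fintype.card F = 3 ^ r) (c : F) (t : Perm (F × F))
    (ht : Perm.sign t = 1) : ∃ k ∈ KB F ε, k c = t := by
  have hG : Good ((KB F ε).map (Pi.evalMonoidHom (fun _ : F => Perm (F × F)) c)) := by
    refine ⟨fun e0 e1 e2 => ?_, ⟨_, KB_rot ε, rfl⟩⟩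
    refine ⟨_, KB_X ε (e0 - e2 ^ ε * c) e1 e2, ?_⟩
    simp only [Pi.evalMonoidHom_apply]
    congr 1
    funext b; ring
  obtain ⟨k, hk, h⟩ := hG.alt r hr hc (Perm.mem_alternatingGroup.2 ht)
  exact ⟨k, hk, h⟩

lemma commutant (ε : ℕ) (hε : ∀ x : F, (x ^ ε) ^ 3 = x) (x : F) (h0 : x ≠ 0) (h1 : x ≠ 1) (h2 : x ≠ -1)
    (e : F) (he : e ≠ 0) (z : Perm (F × F))
    (hz : ∀ e1 d : F, z * X (fun b => e1 * b + d * b ^ 2 + d ^ ε * e) = X (fun b => e1 * b + d * b ^ 2 + d ^ ε * e) * z) :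
    ∃ g, z = X g := by
  have hε0 : ε ≠ 0 := by
    rintro rfl
    have := hε 0
    simp at this
  have hz' : ∀ e1 d a b : F, z (a + (e1 * b + d * b ^ 2 + d ^ ε * e), b) =
      X (fun b => e1 * b + d * b ^ 2 + d ^ ε * e) (z (a, b)) := by
    intro e1 d a b
    have := congrArg (fun p : Perm (F × F) => p (a, b)) (hz e1 d)
    simpa [X_apply] using this
  have hb : ∀ a b, (z (a, b)).2 = b := by
    intro a b
    by_contra hne
    set b' := (z (a, b)).2 with hb'
    have key : ∀ e1 d : F, e1 * b + d * b ^ 2 + d ^ ε * e = 0 → e1 * b' + d * b' ^ 2 + d ^ ε * e = 0 := by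
      intro e1 d h
      have := hz' e1 d a b
      rw [h, add_zero] at this
      have := congrArg Prod.fst this
      simp only [X_apply] at this
      rw [← hb'] at this
      simpa using this
    by_cases hb0 : b = 0
    · have := key 1 0 (by simp [hb0, hε0])
      simp [hε0] at this
      exact hne (this.trans hb0.symm)
    · have key2 : ∀ d : F, d * b * b' = d ^ ε * e := by
        intro d
        have := key (-(d * b ^ 2 + d ^ ε * e) / b) d (by field_simp; ring)
        field_simp at this
        have h3 : (b' - b) * (d * b * b' - d ^ ε * e) = 0 := by linear_combination this
        rcases mul_eq_zero.1 h3 with h | h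
        · exact absurd (sub_eq_zero.1 h) hne
        · exact sub_eq_zero.1 h
      have k1 := key2 1
      simp at k1
      have k2 := key2 x
      rw [mul_assoc, k1] at k2
      have k3 : x = x ^ ε := mul_right_cancel₀ he k2
      have k4 := hε x
      rw [← k3] at k4
      have : x * (x - 1) * (x + 1) = 0 := by linear_combination k4
      rcases mul_eq_zero.1 this with h | h
      · rcases mul_eq_zero.1 h with h | h
        · exact h0 h
        · exact h1 (sub_eq_zero.1 h)
      · exact h2 (eq_neg_of_add_eq_zero_left h)
  have hex : ∀ a b : F, ∃ e1 d : F, e1 * b + d * b ^ 2 + d ^ ε * e = a := by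
    intro a b
    by_cases hb0 : b = 0
    · refine ⟨0, (a / e) ^ 3, ?_⟩
      have h6 : ((a / e) ^ 3) ^ ε = a / e := by rw [← pow_mul, mul_comm, pow_mul, hε]
      rw [hb0, h6]
      field_simp
      ring
    · refine ⟨a / b, 0, ?_⟩
      simp [hε0, hb0]
  refine ⟨fun b => (z (0, b)).1, ?_⟩
  ext ⟨a, b⟩
  · obtain ⟨e1, d, h⟩ := hex a b
    have := hz' e1 d 0 b
    rw [h, zero_add] at this
    rw [this]
    simp only [X_apply]
    rw [hb, h, add_comm]
  · rw [hb]; simp [X_apply]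

lemma sep9 (ε : ℕ) (hε : ∀ x : F, (x ^ ε) ^ 3 = x) (r : ℕ) (hr : 1 ≤ r) (hc : Fintype.card F = 3 ^ r)
    (x : F) (h0 : x ≠ 0) (h1 : x ≠ 1) (h2 : x ≠ -1) (c c' : F) (hcc : c ≠ c') :
    (∃ k ∈ KB F ε, k c = 1 ∧ k c' ≠ 1) ∨ (∃ k ∈ KB F ε, k c' = 1 ∧ k c ≠ 1) := by
  by_cases h : ∃ k ∈ KB F ε, k c = 1 ∧ k c' ≠ 1
  · exact Or.inl h
  right
  push Not at h
  have hcomm : ∀ k l, k ∈ KB F ε → l ∈ KB F ε → k c * l c = l c * k c → k c' * l c' = l c' * k c' := by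
    intro k l hk hl hkl
    have h5 := h (k * l * (l * k)⁻¹) (Subgroup.mul_mem _ (Subgroup.mul_mem _ hk hl)
      (Subgroup.inv_mem _ (Subgroup.mul_mem _ hl hk))) (by
        change k c * l c * (l c * k c)⁻¹ = 1
        rw [hkl, mul_inv_cancel])
    change k c' * l c' * (l c' * k c')⁻¹ = 1 at h5
    exact mul_inv_eq_one.1 h5
  have hlift : ∀ a b d : F, a ≠ b → a ≠ d → ∃ k ∈ KB F ε,
      k c = swap ((a, 0) : F × F) (b, 0) * swap (a, 0) (d, 0) ∧ ∃ g, k c' = X g := by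
    intro a b d hab had
    obtain ⟨k, hk, hkc⟩ := KB_lift ε r hr hc c (swap ((a, 0) : F × F) (b, 0) * swap (a, 0) (d, 0)) (by
      rw [map_mul, Perm.sign_swap (by simpa using hab), Perm.sign_swap (by simpa using had)]; rfl)
    refine ⟨k, hk, hkc, ?_⟩
    apply commutant ε hε x h0 h1 h2 (c' - c) (sub_ne_zero.2 hcc.symm)
    intro e1 d'
    have hl := KB_X ε (-(d' ^ ε * c)) e1 d'
    have := hcomm k _ hk hl (by
      rw [hkc]
      have hfix : ∀ p : F, X (fun b => -(d' ^ ε * c) + e1 * b + d' * b ^ 2 + d' ^ ε * c) (p, 0) = (p, 0) := by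
        intro p
        apply X_fix
        simp
      generalize X (fun b => -(d' ^ ε * c) + e1 * b + d' * b ^ 2 + d' ^ ε * c) = Y at hfix
      have hs : ∀ p p' : F, Y * swap (p, 0) (p', 0) = swap (p, 0) (p', 0) * Y := by
        intro p p'
        rw [mul_swap_eq_swap_mul, hfix, hfix]
      rw [← mul_assoc, hs, mul_assoc, mul_assoc, hs])
    have hf : (fun b => -(d' ^ ε * c) + e1 * b + d' * b ^ 2 + d' ^ ε * c') =
        (fun b => e1 * b + d' * b ^ 2 + d' ^ ε * (c' - c)) := by
      funext b; ring
    simp only [hf] at this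
    exact this
  have h11 : (1 : F) ≠ -1 := by
    intro h
    have h3 := three0 (F := F)
    have : (1 : F) = 0 := by linear_combination h3 - h
    exact one_ne_zero this
  obtain ⟨k, hk, hkc, g, hg⟩ := hlift 0 1 (-1) (by simp) (by simp)
  obtain ⟨l, hl, hlc, g', hg'⟩ := hlift 0 1 x (by simp) (Ne.symm h0)
  refine ⟨k * l * (l * k)⁻¹, Subgroup.mul_mem _ (Subgroup.mul_mem _ hk hl)
      (Subgroup.inv_mem _ (Subgroup.mul_mem _ hl hk)), ?_, ?_⟩
  · change k c' * l c' * (l c' * k c')⁻¹ = 1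
    rw [hg, hg', X_mul, X_mul, mul_inv_eq_one]
    congr 1; funext b; ring
  · change k c * l c * (l c * k c)⁻¹ ≠ 1
    rw [Ne, mul_inv_eq_one, hkc, hlc]
    intro h
    have := congrArg (fun p : Perm (F × F) => p (0, 0)) h
    simp only [Perm.mul_apply] at this
    have s1 : swap ((0, 0) : F × F) (x, 0) (0, 0) = (x, 0) := swap_apply_left _ _
    have s2 : swap ((0, 0) : F × F) (-1, 0) (0, 0) = (-1, 0) := swap_apply_left _ _
    have s3 : ∀ p : F, p ≠ 0 → p ≠ 1 → swap ((0, 0) : F × F) (1, 0) (p, 0) = (p, 0) := fun p hp hp' =>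
      swap_apply_of_ne_of_ne (by simpa using hp) (by simpa using hp')
    have s4 : swap ((0, 0) : F × F) (-1, 0) (x, 0) = (x, 0) :=
      swap_apply_of_ne_of_ne (by simpa using h0) (by simpa using h2)
    have s5 : swap ((0, 0) : F × F) (x, 0) (-1, 0) = (-1, 0) :=
      swap_apply_of_ne_of_ne (by simp) (by simpa using Ne.symm h2)
    rw [s1, s2, s3 x h0 h1, s4, s3 x h0 h1, s3 (-1) (by simp) (Ne.symm h11), s5, s3 (-1) (by simp) (Ne.symm h11)] at this
    exact h2 (congrArg Prod.fst this)
end S17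

namespace S17
open Equiv

section
variable {R : Type*} [CommRing R]
/-- explicit word -/
def wf (e : R) (x : R × R) : R × R :=
  let y : R × R → R × R := fun x => (x.1 + (1 - e - x.2 ^ 2), x.2)
  let y' : R × R → R × R := fun x => (x.1 - (1 - e - x.2 ^ 2), x.2)
  let t : R × R → R × R := fun x => (x.2, -x.1)
  let t' : R × R → R × R := fun x => (-x.2, x.1)
  y (t (y (t' (y' (t (y' (t' x)))))))

lemma wf_map {R' : Type*} [CommRing R'] (φ : R →+* R') (e : R) (x : R × R) :
    wf (φ e) (φ x.1, φ x.2) = (φ (wf e x).1, φ (wf e x).2) := by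
  simp [wf]
end

lemma wf_dec : ∀ e : ZMod 3, e ≠ 0 → ∃ x, wf e (wf e (wf e x)) ≠ x := by decide

variable {F : Type*} [Field F] [Fintype F] [DecidableEq F] [CharP F 3]

lemma wf_F (hF : ∀ x : F, x = 0 ∨ x = 1 ∨ x = -1) (e : F) (he : e ≠ 0) :
    ∃ x, wf e (wf e (wf e x)) ≠ x := by
  let φ : ZMod 3 →+* F := ZMod.castHom (dvd_refl 3) F
  have hφ : Function.Injective φ := φ.injective
  obtain ⟨e', rfl⟩ : ∃ e', φ e' = e := by
    rcases hF e with h | h | h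
    · exact ⟨0, by simp [h]⟩
    · exact ⟨1, by simp [h]⟩
    · exact ⟨-1, by simp [h]⟩
  obtain ⟨x, hx⟩ := wf_dec e' (by rintro rfl; simp at he)
  refine ⟨(φ x.1, φ x.2), ?_⟩
  rw [wf_map, wf_map, wf_map]
  intro h
  apply hx
  exact Prod.ext (hφ (congrArg Prod.fst h)) (hφ (congrArg Prod.snd h))

lemma X_symm_apply (f : F → F) (x : F × F) : (X f).symm x = (x.1 - f x.2, x.2) := by
  rw [Equiv.symm_apply_eq]; simp [X_apply]

lemma sep3 (ε : ℕ) (hε : ∀ x : F, (x ^ ε) ^ 3 = x) (hF : ∀ x : F, x = 0 ∨ x = 1 ∨ x = -1)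
    (c c' : F) (hcc : c ≠ c') : ∃ k ∈ KB F ε, k c = 1 ∧ k c' ≠ 1 := by
  have hsq : ∀ x : F, x ≠ 0 → x ^ 2 = 1 := by
    intro x hx
    rcases hF x with h | h | h
    · exact absurd h hx
    · simp [h]
    · simp [h]
  have hcu : ∀ x : F, x ^ 3 = x := by
    intro x
    rcases hF x with h | h | h
    · simp [h]
    · simp [h]
    · rw [h]; ring
  have hee : ∀ x : F, x ^ ε = x := fun x => by rw [← hcu (x ^ ε), hε]
  have hy := KB_X ε (1 + c) 0 (-1 : F)
  set y : F → Perm (F × F) := fun c_1 => X fun b => 1 + c + 0 * b + -1 * b ^ 2 + (-1) ^ ε * c_1 with hyd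
  have hr := KB_rot (F := F) ε
  set t : F → Perm (F × F) := fun _ => rot F with htd
  have hyt : t * y * t⁻¹ ∈ KB F ε := Subgroup.mul_mem _ (Subgroup.mul_mem _ hr hy) (Subgroup.inv_mem _ hr)
  have hyc : ∀ e x, y (c + e) x = (x.1 + (1 - e - x.2 ^ 2), x.2) := by
    intro e x
    simp only [hyd, X_apply, hee]
    ext
    · ring
    · rfl
  have hyc' : ∀ e x, (y (c + e)).symm x = (x.1 - (1 - e - x.2 ^ 2), x.2) := by
    intro e x
    simp only [hyd, X_symm_apply, hee]
    ext
    · ring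
    · rfl
  refine ⟨(y * (t * y * t⁻¹) * y⁻¹ * (t * y * t⁻¹)⁻¹) ^ 3,
    Subgroup.pow_mem _ (Subgroup.mul_mem _ (Subgroup.mul_mem _ (Subgroup.mul_mem _ hy hyt)
      (Subgroup.inv_mem _ hy)) (Subgroup.inv_mem _ hyt)) 3, ?_, ?_⟩
  · change (y c * (rot F * y c * (rot F)⁻¹) * (y c)⁻¹ * (rot F * y c * (rot F)⁻¹)⁻¹) ^ 3 = 1
    have h3 : (y c * (rot F * y c * (rot F)⁻¹) * (y c)⁻¹ * (rot F * y c * (rot F)⁻¹)⁻¹).IsThreeCycle := by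
      have h0 := hyc 0
      rw [add_zero] at h0
      have h1 : ∀ x, (rot F * y c * (rot F)⁻¹) x = (x.1, x.2 - (1 - x.1 ^ 2)) := by
        intro x
        simp [rot_symm_apply, h0]
        ring
      apply three_cycle_comm _ _ (0, 0)
      · rw [h0]; simp
      · rw [h1]; simp
      · intro x hx
        by_cases h2 : x.2 = 0
        · right
          have : x.1 ≠ 0 := fun h => hx (Prod.ext h h2)
          rw [h1, hsq _ this]; simp
        · left
          rw [h0, hsq _ h2]; simp
    rw [← h3.orderOf]; exact pow_orderOf_eq_one _
  · change (y c' * (rot F * y c' * (rot F)⁻¹) * (y c')⁻¹ * (rot F * y c' * (rot F)⁻¹)⁻¹) ^ 3 ≠ 1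
    obtain ⟨e, rfl⟩ : ∃ e, c' = c + e := ⟨c' - c, by ring⟩
    have he : e ≠ 0 := by rintro rfl; simp at hcc
    have hw : ∀ x, (y (c + e) * (rot F * y (c + e) * (rot F)⁻¹) * (y (c + e))⁻¹ * (rot F * y (c + e) * (rot F)⁻¹)⁻¹) x
        = wf e x := by
      intro x
      rw [mul_inv_rev, mul_inv_rev, inv_inv]
      change y (c + e) (rot F (y (c + e) ((rot F).symm ((y (c + e)).symm (rot F ((y (c + e)).symm ((rot F).symm x))))))) = _
      simp only [hyc, hyc', rot_apply, rot_symm_apply, wf]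
    intro h
    obtain ⟨x, hx⟩ := wf_F hF e he
    apply hx
    have := congrArg (fun p : Perm (F × F) => p x) h
    simp only [pow_succ, pow_zero, one_mul] at this
    rw [Perm.mul_apply, Perm.mul_apply, hw, hw, hw] at this
    exact this

lemma KK_eq (ε : ℕ) (hε : ∀ x : F, (x ^ ε) ^ 3 = x) (r : ℕ) (hr : 1 ≤ r) (hc : Fintype.card F = 3 ^ r) :
    KK F ε = (Phi F).range := by
  apply le_antisymm (KK_le ε)
  have h5 : 5 ≤ Nat.card (F × F) := by
    rw [Nat.card_prod, Nat.card_eq_fintype_card, hc]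
    have : 3 ^ 1 ≤ 3 ^ r := Nat.pow_le_pow_right (by norm_num) hr
    nlinarith
  haveI := alternatingGroup.isSimpleGroup h5
  have hcm := commutator_alternatingGroup_eq_top h5
  have hL : (KK F ε).comap (Phi F) = ⊤ := by
    have tolift : ∀ k ∈ KB F ε, ∃ l ∈ (KK F ε).comap (Phi F), ∀ c, (l c).1 = k c := fun k hk =>
      ⟨fun c => ⟨k c, Perm.mem_alternatingGroup.2 (KB_sign ε hk c)⟩, hk, fun c => rfl⟩
    apply subdirect hcm
    · intro c s
      obtain ⟨k, hk, h⟩ := KB_lift ε r hr hc c s.1 (Perm.mem_alternatingGroup.1 s.2)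
      obtain ⟨l, hl, h'⟩ := tolift k hk
      exact ⟨l, hl, Subtype.ext ((h' c).trans h)⟩
    · intro c c' hcc
      have hs : (∃ k ∈ KB F ε, k c = 1 ∧ k c' ≠ 1) ∨ (∃ k ∈ KB F ε, k c' = 1 ∧ k c ≠ 1) := by
        by_cases hF : ∀ x : F, x = 0 ∨ x = 1 ∨ x = -1
        · exact Or.inl (sep3 ε hε hF c c' hcc)
        · push Not at hF
          obtain ⟨x, h0, h1, h2⟩ := hF
          exact sep9 ε hε r hr hc x h0 h1 h2 c c' hcc
      have conv : ∀ c c' : F, (∃ k ∈ KB F ε, k c = 1 ∧ k c' ≠ 1) →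
          ∃ k ∈ (KK F ε).comap (Phi F), k c = 1 ∧ k c' ≠ 1 := by
        rintro c c' ⟨k, hk, h1, h2⟩
        obtain ⟨l, hl, h'⟩ := tolift k hk
        refine ⟨l, hl, Subtype.ext ((h' c).trans h1), fun h => h2 ?_⟩
        rw [← h' c', h]; rfl
      exact hs.imp (conv c c') (conv c' c)
  rintro _ ⟨k, rfl⟩
  have : k ∈ (KK F ε).comap (Phi F) := by rw [hL]; trivial
  exact this
end S17

namespace S17
open Equiv
variable {F : Type*} [Field F] [Fintype F] [DecidableEq F] [CharP F 3]

/-- complement -/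
def Ysub (F : Type*) [Field F] : Subgroup (Perm (F × F × F)) where
  carrier := {g | ∃ (φ : F ≃+* F) (m w : F), m ≠ 0 ∧
    ∀ x, g x = (m ^ 2 * φ x.1, m * φ x.2.1, m ^ 2 * φ x.2.2 + w)}
  mul_mem' := by
    rintro g g' ⟨φ, m, w, hm, h⟩ ⟨φ', m', w', hm', h'⟩
    refine ⟨φ'.trans φ, m * φ m', m ^ 2 * φ w' + w, mul_ne_zero hm (by simpa using hm'), ?_⟩
    intro x
    rw [Perm.mul_apply, h', h]
    simp only [map_mul, map_add, map_pow, RingEquiv.trans_apply]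
    refine Prod.ext ?_ (Prod.ext ?_ ?_) <;> simp only [] <;> ring
  one_mem' := ⟨RingEquiv.refl F, 1, 0, one_ne_zero, fun x => by simp⟩
  inv_mem' := by
    rintro g ⟨φ, m, w, hm, h⟩
    refine ⟨φ.symm, φ.symm m⁻¹, - φ.symm ((m⁻¹) ^ 2 * w), by simpa using hm, ?_⟩
    intro x
    rw [Perm.inv_eq_iff_eq, h]
    simp only [map_mul, map_add, map_pow, map_neg, RingEquiv.apply_symm_apply]
    refine Prod.ext ?_ (Prod.ext ?_ ?_) <;> simp only [] <;> field_simp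
    ring

lemma Y_conj {y : Perm (F × F × F)} (hy : y ∈ Ysub F) {k : Perm (F × F × F)} (hk : k ∈ (Phi F).range) :
    y * k * y⁻¹ ∈ (Phi F).range := by
  obtain ⟨φ, m, w, hm, h⟩ := hy
  obtain ⟨k, rfl⟩ := hk
  let h0 : Perm (F × F) := Equiv.ofBijective (fun x => (m ^ 2 * φ x.1, m * φ x.2))
    (Finite.injective_iff_bijective.mp (by
      intro x x' hx
      simp [hm] at hx
      exact Prod.ext hx.1 hx.2))
  let p0 : Perm F := Equiv.ofBijective (fun x => m ^ 2 * φ x + w)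
    (Finite.injective_iff_bijective.mp (by
      intro x x' hx
      simpa [hm] using hx))
  have hh : ∀ x, h0 x = (m ^ 2 * φ x.1, m * φ x.2) := fun x => rfl
  have hp : ∀ x, p0 x = m ^ 2 * φ x + w := fun x => rfl
  have : y * Phi F k * y⁻¹ = blk (fun c => h0 * (k (p0.symm c)).1 * h0⁻¹) := by
    rw [mul_inv_eq_iff_eq_mul]
    apply Equiv.ext
    intro x
    rw [Perm.mul_apply, Perm.mul_apply, h x]
    change y (blk (fun c => (k c).1) x) = _
    rw [h, blk_apply, blk_apply]
    simp only []
    rw [← hp]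
    have e1 : h0⁻¹ (m ^ 2 * φ x.1, m * φ x.2.1) = (x.1, x.2.1) := by
      rw [Perm.inv_eq_iff_eq, hh]
    rw [Equiv.symm_apply_apply, Perm.mul_apply, Perm.mul_apply, e1, hh]
  rw [this]
  apply Phi_range
  intro c
  have := Perm.mem_alternatingGroup.1 (k (p0.symm c)).2
  rw [map_mul, map_mul, this, map_inv]
  simp

lemma Y_norm : Ysub F ≤ Subgroup.normalizer (((Phi F).range : Subgroup _) : Set (Perm (F × F × F))) := by
  intro y hy
  rw [Subgroup.mem_normalizer_iff]
  intro k
  constructor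
  · exact fun hk => Y_conj hy hk
  · intro hk
    have := Y_conj (Subgroup.inv_mem _ hy) hk
    have h2 : y⁻¹ * (y * k * y⁻¹) * y⁻¹⁻¹ = k := by group
    rwa [h2] at this

lemma G_le (ε : ℕ) (hε : ∀ x : F, (x ^ ε) ^ 3 = x) : G1grp F ε ⊔ G2grp F ε ≤ Ysub F ⊔ KK F ε := by
  have hK : KK F ε ≤ Ysub F ⊔ KK F ε := le_sup_right
  have hY : Ysub F ≤ Ysub F ⊔ KK F ε := le_sup_left
  have hA : Agrp F ≤ Ysub F ⊔ KK F ε := by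
    rw [Agrp, Subgroup.closure_le]
    rintro _ ⟨u, v, w, rfl⟩
    have : alphaPerm u v w = alphaPerm u v 0 * alphaPerm 0 0 w := by
      ext x <;> simp [alphaPerm]
    rw [this]
    exact Subgroup.mul_mem _ (hK (mem_alpha ε u v))
      (hY ⟨RingEquiv.refl F, 1, w, one_ne_zero, fun x => by simp [alphaPerm]⟩)
  have hM : Mgrp F ε ≤ Ysub F ⊔ KK F ε := (le_sup_right.trans le_sup_left : Mgrp F ε ≤ KK F ε).trans hK
  have hC : Cgrp F ≤ Ysub F ⊔ KK F ε := (le_sup_left.trans le_sup_left : Cgrp F ≤ Mgrp F ε).trans hM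
  have hT : Tgrp F ε ≤ Ysub F ⊔ KK F ε := (le_sup_right : Tgrp F ε ≤ Mgrp F ε).trans hM
  have hE : Egrp F ε ≤ Ysub F ⊔ KK F ε :=
    ((le_sup_right.trans le_sup_left).trans le_sup_right : Egrp F ε ≤ KK F ε).trans hK
  have hS : Sgrp F ε ≤ Ysub F ⊔ KK F ε := by
    rw [Sgrp, Subgroup.closure_le]
    rintro _ ⟨m, rfl⟩
    apply hY
    refine ⟨RingEquiv.refl F, m, 0, m.ne_zero, fun x => ?_⟩
    have h6 : ((m : F) ^ 2 * m) ^ (2 * ε) = (m : F) ^ 2 := by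
      calc ((m : F) ^ 2 * m) ^ (2 * ε) = (((m : F) ^ ε) ^ 3) ^ 2 := by ring
        _ = _ := by rw [hε]
    simp [betaPerm, h6]
  have hSig : Siggrp F ≤ Ysub F ⊔ KK F ε := by
    rw [Siggrp, Subgroup.closure_le]
    rintro _ rfl
    apply hY
    refine ⟨RingEquiv.ofBijective (frobenius F 3) (Finite.injective_iff_bijective.mp (frobenius_inj F 3)),
      1, 0, one_ne_zero, fun x => ?_⟩
    simp [sigmaPerm, frobPerm, frobenius_def]
    rfl
  exact sup_le (sup_le (sup_le (sup_le hA hM) hS) hSig)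
    (sup_le (sup_le (sup_le (sup_le (sup_le hA hC) hS) hE) hT) hSig)

/-- block-preserving -/
def Bsub (F : Type*) [Field F] : Subgroup (Perm (F × F × F)) where
  carrier := {g | ∀ x, (g x).2.2 = x.2.2}
  mul_mem' := by
    intro g g' h h' x
    rw [Perm.mul_apply, h, h']
  one_mem' := fun x => rfl
  inv_mem' := by
    intro g h x
    have := h (g⁻¹ x)
    rw [← this]; simp

lemma Bsub_iff (g : Perm (F × F × F)) : g ∈ Bsub F ↔
    ∀ c : F, ⇑g '' {x : F × F × F | x.2.2 = c} = {x : F × F × F | x.2.2 = c} := by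
  constructor
  · intro h c
    ext x
    constructor
    · rintro ⟨y, hy, rfl⟩
      exact (h y).trans hy
    · intro hx
      exact ⟨g⁻¹ x, ((Bsub F).inv_mem h x).trans hx, by simp⟩
  · intro h x
    have : g x ∈ ⇑g '' {y : F × F × F | y.2.2 = x.2.2} := ⟨x, rfl, rfl⟩
    rw [h] at this
    exact this

lemma Phi_B : (Phi F).range ≤ Bsub F := by
  rintro _ ⟨k, rfl⟩ x
  rfl

lemma beta_Y (ε : ℕ) (x : F × F × F) : betaPerm ε (1 : Fˣ) (-1) x = (x.1, -x.2.1, x.2.2) := by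
  simp [betaPerm, pow_mul]

lemma part_i (ε : ℕ) (hε : ∀ x : F, (x ^ ε) ^ 3 = x) (r : ℕ) (hr : 1 ≤ r) (hc : Fintype.card F = 3 ^ r)
    (g : Perm (F × F × F)) (hg : g ∈ G1grp F ε ⊔ G2grp F ε) :
    g ∈ Bsub F ↔ g ∈ KK F ε ⊔ Subgroup.closure {betaPerm ε (1 : Fˣ) (-1)} := by
  constructor
  · intro hB
    have h1 := G_le ε hε hg
    rw [KK_eq ε hε r hr hc] at h1 ⊢
    rw [← SetLike.mem_coe, Subgroup.coe_mul_of_left_le_normalizer_right _ _ Y_norm] at h1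
    obtain ⟨y, hy, k, hk, rfl⟩ := h1
    have hyB : y ∈ Bsub F := by
      have := (Bsub F).mul_mem hB ((Bsub F).inv_mem (Phi_B hk))
      simpa using this
    apply Subgroup.mul_mem _ _ ((le_sup_left : (Phi F).range ≤ _) hk)
    obtain ⟨φ, m, w, hm, h⟩ := hy
    have h2 : ∀ c : F, m ^ 2 * φ c + w = c := by
      intro c
      have := hyB (0, 0, c)
      rw [h] at this
      exact this
    have hw : w = 0 := by simpa using h2 0
    have hm1 : m ^ 2 = 1 := by simpa [hw] using h2 1
    have hφ : ∀ c, φ c = c := by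
      intro c
      simpa [hw, hm1] using h2 c
    rcases (mul_self_eq_one_iff.1 (by rw [← sq]; exact hm1) : m = 1 ∨ m = -1) with h3 | h3
    · have : y = 1 := by
        apply Equiv.ext; intro x
        rw [h]; simp [hφ, h3, hw]
      rw [this]; exact Subgroup.one_mem _
    · have : y = betaPerm ε (1 : Fˣ) (-1) := by
        apply Equiv.ext; intro x
        rw [h, beta_Y]; simp [hφ, h3, hw]
      rw [this]
      exact (le_sup_right : Subgroup.closure {betaPerm ε (1 : Fˣ) (-1)} ≤ _) (Subgroup.subset_closure rfl)
  · intro h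
    refine (sup_le ((KK_le ε).trans Phi_B) ?_ : KK F ε ⊔ Subgroup.closure {betaPerm ε (1 : Fˣ) (-1)} ≤ Bsub F) h
    rw [Subgroup.closure_le]
    rintro _ rfl x
    rw [beta_Y]

lemma exists_off {α : Type*} [Fintype α] [DecidableEq α] (s : Finset α) (h : s.card < Fintype.card α) : ∃ p, p ∉ s := by
  by_contra hn
  push Not at hn
  have : s = Finset.univ := Finset.eq_univ_iff_forall.2 hn
  rw [this, Finset.card_univ] at h
  exact lt_irrefl _ h

lemma part_iii (hc : 3 ≤ Fintype.card F) (g : Perm (F × F × F))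
    (hg : ∀ k ∈ (Phi F).range, k * g = g * k) : g = 1 := by
  by_contra hne
  obtain ⟨x, hx⟩ : ∃ x, g x ≠ x := by
    by_contra hn
    push Not at hn
    exact hne (Equiv.ext hn)
  set y := g x with hy
  have hcard : 9 ≤ Fintype.card (F × F) := by
    rw [Fintype.card_prod]; nlinarith
  obtain ⟨p, hp⟩ := exists_off ({(x.1, x.2.1), (y.1, y.2.1)} : Finset (F × F))
    (lt_of_le_of_lt Finset.card_le_two (by omega))
  obtain ⟨p', hp'⟩ := exists_off ({(x.1, x.2.1), (y.1, y.2.1), p} : Finset (F × F))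
    (lt_of_le_of_lt Finset.card_le_three (by omega))
  simp only [Finset.mem_insert, Finset.mem_singleton, not_or] at hp hp'
  set Yp : F × F := (y.1, y.2.1) with hYp
  let t : Perm (F × F) := swap Yp p * swap Yp p'
  have ht : Perm.sign t = 1 := by
    rw [map_mul, Perm.sign_swap (Ne.symm hp.2), Perm.sign_swap (Ne.symm hp'.2.1)]; rfl
  have hty : t Yp = p' := by
    simp only [t, Perm.mul_apply, swap_apply_left]
    exact swap_apply_of_ne_of_ne hp'.2.1 hp'.2.2
  let k : F → Perm (F × F) := fun c => if c = y.2.2 then t else 1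
  have hk : blk k ∈ (Phi F).range := by
    apply Phi_range
    intro c
    by_cases h : c = y.2.2
    · simp [k, h, ht]
    · simp [k, h]
  have hkx : blk k x = x := by
    rw [blk_apply]
    by_cases h : x.2.2 = y.2.2
    · have hxy : (x.1, x.2.1) ≠ Yp := by
        intro h'
        apply hx
        rw [hYp, Prod.mk.injEq] at h'
        exact (Prod.ext h'.1 (Prod.ext h'.2 h)).symm
      have : k x.2.2 (x.1, x.2.1) = (x.1, x.2.1) := by
        simp only [k, h, if_true, t, Perm.mul_apply]
        rw [swap_apply_of_ne_of_ne hxy (Ne.symm hp'.1), swap_apply_of_ne_of_ne hxy (Ne.symm hp.1)]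
      rw [this]
    · simp [k, h]
  have hky : blk k y ≠ y := by
    rw [blk_apply]
    intro h
    have h1 : k y.2.2 (y.1, y.2.1) = p' := by
      simp only [k, if_true]; exact hty
    rw [h1] at h
    apply hp'.2.1
    exact Prod.ext (congrArg (fun z : F × F × F => z.1) h) (congrArg (fun z : F × F × F => z.2.1) h)
  apply hky
  have := congrArg (fun q : Perm (F × F × F) => q x) (hg _ hk)
  simp only [Perm.mul_apply] at this
  rw [hkx, ← hy] at this
  exact this

end S17

/-- Lemma 3.4 (parts i, ii): the kernel of the action of `G = ⟨G₁,G₂⟩` on the blocks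
`Ω_c` is `K⟨β_{1,-1}⟩`, `K = ⟨K₁,K₂⟩` is isomorphic to the direct product of `q` copies
of the alternating group on `q²` letters, and `C_G(K) = 1`. -/
theorem stmt17 (r : ℕ) (hr : 1 ≤ r) (K : Type*) [Field K] [Fintype K] [DecidableEq K] [CharP K 3]
    (hcard : Fintype.card K = 3 ^ r) (ε : ℕ) (hε : ε = 3 ^ (r - 1)) :
    (∀ g ∈ G1grp K ε ⊔ G2grp K ε,
      ((∀ c : K, ⇑g '' {x : K × K × K | x.2.2 = c} = {x : K × K × K | x.2.2 = c})
        ↔ g ∈ (K1grp K ε ⊔ K2grp K ε) ⊔ Subgroup.closure {betaPerm ε (1 : Kˣ) (-1)}))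
    ∧ Nonempty (↥(K1grp K ε ⊔ K2grp K ε) ≃* (K → ↥(alternatingGroup (K × K))))
    ∧ (G1grp K ε ⊔ G2grp K ε) ⊓
        Subgroup.centralizer ((K1grp K ε ⊔ K2grp K ε : Subgroup (Equiv.Perm (K × K × K))) :
          Set (Equiv.Perm (K × K × K))) = ⊥ := by
  have hε' : ∀ x : K, (x ^ ε) ^ 3 = x := by
    intro x
    have h1 : ε * 3 = Fintype.card K := by
      rw [hε, hcard, ← pow_succ, Nat.sub_add_cancel hr]
    rw [← pow_mul, h1, FiniteField.pow_card]
  have hKK := S17.KK_eq ε hε' r hr hcard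
  refine ⟨?_, ?_, ?_⟩
  · intro g hg
    rw [← S17.Bsub_iff]
    exact S17.part_i ε hε' r hr hcard g hg
  · exact ⟨(MulEquiv.subgroupCongr hKK).trans (MonoidHom.ofInjective S17.Phi_inj).symm⟩
  · rw [eq_bot_iff]
    intro g hg
    rw [Subgroup.mem_bot]
    apply S17.part_iii
    · rw [hcard]
      calc 3 = 3 ^ 1 := by norm_num
        _ ≤ 3 ^ r := Nat.pow_le_pow_right (by norm_num) hr
    · intro k hk
      rw [← hKK] at hk
      exact Subgroup.mem_centralizer_iff.1 hg.2 k hk
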